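/- Let n ≥ 1, let D be an n×n real symmetric invertible matrix, and let S₁, S₂ ⊂ ℂ^n be closed cubes such that (z₂ − z₁)^t D (z₂ − z₁) ≠ 0 for every z₁ ∈ S₁ and z₂ ∈ S₂. Then for q > (n+3)/(n+1) and 1/p + ((n+3)/(n+1))·(1/(2q)) < 1, there is a constant C such that ‖E_γ f · E_γ g‖_{L^q(ℂ^{n+1})} ≤ C ‖f‖_{L^p(ℂ^n)} ‖g‖_{L^p(ℂ^n)} whenever f is supported in S₁ and g is supported in S₂. -/

import Mathlib

open MeasureTheory ENNReal Matrix

noncomputable section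

/-- The real pairing `ζ ⊙ η = Re ⟨ζ, η⟩ = Re (∑ ζⱼ conj ηⱼ)` on `ℂ^m`,
i.e. the standard inner product on `ℝ^{2m}`. -/
def odot (m : ℕ) (z w : Fin m → ℂ) : ℝ :=
  ∑ j, ((z j).re * (w j).re + (z j).im * (w j).im)

/-- The real pairing `Re (a * conj b)` of two complex numbers. -/
def odot1 (a b : ℂ) : ℝ := a.re * b.re + a.im * b.im

/-- The complex quadratic form `z ↦ ½ zᵗ D z` on `ℂ^n` associated to a real
matrix `D`. -/
def quadD (n : ℕ) (D : Matrix (Fin n) (Fin n) ℝ) (z : Fin n → ℂ) : ℂ :=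
  (1 / 2 : ℂ) * ∑ i, ∑ j, (D i j : ℂ) * z i * z j

/-- The extension operator `E_γ` for the complex quadratic surface
`γ(z) = (z, ½ zᵗ D z) ⊆ ℂ^{n+1}`, where `ℂ^{n+1}` is identified with
`(Fin n → ℂ) × ℂ`: `E_γ f (w) = ∫_{ℂ^n} e^{2πi (w ⊙ γ(z))} f(z) dz`. -/
def extGamma (n : ℕ) (D : Matrix (Fin n) (Fin n) ℝ) (f : (Fin n → ℂ) → ℂ)
    (w : (Fin n → ℂ) × ℂ) : ℂ :=
  ∫ z : Fin n → ℂ, Complex.exp (2 * Real.pi * Complex.I *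
    ((odot n w.1 z + odot1 w.2 (quadD n D z) : ℝ) : ℂ)) * f z

/-- `S` is a closed cube in `ℂ^n ≅ ℝ^{2n}`. -/
def IsClosedCubeC (n : ℕ) (S : Set (Fin n → ℂ)) : Prop :=
  ∃ (a : Fin n → ℂ) (r : ℝ), 0 ≤ r ∧
    S = {z | ∀ j, |(z j).re - (a j).re| ≤ r ∧ |(z j).im - (a j).im| ≤ r}

section FourierL2
open scoped FourierTransform SchwartzMap ComplexConjugate
open Real

variable {V : Type*} [NormedAddCommGroup V] [InnerProductSpace ℝ V] [FiniteDimensional ℝ V]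
  [MeasurableSpace V] [BorelSpace V]

/-- The Fourier transform of a square integrable function, as a genuine function. -/
def l2Fourier (h : V → ℂ) : V → ℂ :=
  open Classical in
  if hh : MemLp h 2 (volume : Measure V) then
    ((𝓕 (hh.toLp h) : Lp ℂ 2 (volume : Measure V)) : V → ℂ) else 0

/-- The inverse Fourier transform of a square integrable function, as a genuine function. -/
def l2FourierInv (h : V → ℂ) : V → ℂ :=
  open Classical in
  if hh : MemLp h 2 (volume : Measure V) then
    ((𝓕⁻ (hh.toLp h) : Lp ℂ 2 (volume : Measure V)) : V → ℂ) else 0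

lemma l2Fourier_measurable (h : V → ℂ) : Measurable (l2Fourier h) := by
  unfold l2Fourier
  split_ifs with hh
  · exact (Lp.stronglyMeasurable _).measurable
  · exact measurable_zero

lemma l2FourierInv_measurable (h : V → ℂ) : Measurable (l2FourierInv h) := by
  unfold l2FourierInv
  split_ifs with hh
  · exact (Lp.stronglyMeasurable _).measurable
  · exact measurable_zero

lemma l2Fourier_eq {h : V → ℂ} (hh : MemLp h 2 (volume : Measure V)) :
    l2Fourier h = ((𝓕 (hh.toLp h) : Lp ℂ 2 (volume : Measure V)) : V → ℂ) := by
  simp [l2Fourier, hh]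

lemma l2FourierInv_eq {h : V → ℂ} (hh : MemLp h 2 (volume : Measure V)) :
    l2FourierInv h = ((𝓕⁻ (hh.toLp h) : Lp ℂ 2 (volume : Measure V)) : V → ℂ) := by
  simp [l2FourierInv, hh]

lemma l2FourierInv_memLp {h : V → ℂ} (hh : MemLp h 2 (volume : Measure V)) :
    MemLp (l2FourierInv h) 2 (volume : Measure V) := by
  rw [l2FourierInv_eq hh]; exact Lp.memLp _

lemma eLpNorm_l2Fourier {h : V → ℂ} (hh : MemLp h 2 (volume : Measure V)) :
    eLpNorm (l2Fourier h) 2 volume = eLpNorm h 2 (volume : Measure V) := by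
  rw [l2Fourier_eq hh]
  have h1 := Lp.norm_fourier_eq (hh.toLp h)
  rw [Lp.norm_def, Lp.norm_def, ENNReal.toReal_eq_toReal_iff' (Lp.eLpNorm_ne_top _)
    (Lp.eLpNorm_ne_top _)] at h1
  rw [h1]
  exact eLpNorm_congr_ae hh.coeFn_toLp

lemma eLpNorm_l2FourierInv {h : V → ℂ} (hh : MemLp h 2 (volume : Measure V)) :
    eLpNorm (l2FourierInv h) 2 volume = eLpNorm h 2 (volume : Measure V) := by
  rw [l2FourierInv_eq hh]
  have h1 := Lp.norm_fourier_eq (𝓕⁻ (hh.toLp h))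
  rw [FourierTransform.fourier_fourierInv_eq, Lp.norm_def, Lp.norm_def,
    ENNReal.toReal_eq_toReal_iff' (Lp.eLpNorm_ne_top _) (Lp.eLpNorm_ne_top _)] at h1
  rw [← h1]
  exact eLpNorm_congr_ae hh.coeFn_toLp

lemma l2Fourier_l2FourierInv {h : V → ℂ} (hh : MemLp h 2 (volume : Measure V)) :
    l2Fourier (l2FourierInv h) =ᵐ[volume] h := by
  rw [l2FourierInv_eq hh, l2Fourier_eq (Lp.memLp _), Lp.toLp_coeFn,
    FourierTransform.fourier_fourierInv_eq]
  exact hh.coeFn_toLp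

lemma l2Fourier_add {h h' : V → ℂ} (hh : MemLp h 2 (volume : Measure V))
    (hh' : MemLp h' 2 (volume : Measure V)) :
    l2Fourier (h + h') =ᵐ[volume] l2Fourier h + l2Fourier h' := by
  rw [l2Fourier_eq hh, l2Fourier_eq hh', l2Fourier_eq (hh.add hh'), MemLp.toLp_add hh hh',
    FourierTransform.fourier_add]
  exact Lp.coeFn_add _ _

lemma l2Fourier_sum {J : Type*} (s : Finset J) (h : J → V → ℂ)
    (hh : ∀ j ∈ s, MemLp (h j) 2 (volume : Measure V)) :
    l2Fourier (fun x => ∑ j ∈ s, h j x) =ᵐ[volume] fun x => ∑ j ∈ s, l2Fourier (h j) x := by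
  classical
  induction s using Finset.induction_on with
  | empty =>
    simp only [Finset.sum_empty]
    have h0 : MemLp (fun _ : V => (0 : ℂ)) 2 volume := MemLp.zero'
    rw [l2Fourier_eq h0]
    have : h0.toLp _ = 0 := MemLp.toLp_zero h0
    rw [this, FourierTransform.fourier_zero]
    exact Lp.coeFn_zero _ _ _
  | insert a s ha ih =>
    have hs := fun j hj => hh j (Finset.mem_insert_of_mem hj)
    have h1 := l2Fourier_add (hh a (Finset.mem_insert_self _ _))
      (memLp_finsetSum s hs)
    have e : (fun x => ∑ j ∈ insert a s, h j x) = h a + fun x => ∑ j ∈ s, h j x := by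
      ext x; simp [Finset.sum_insert ha]
    rw [e]
    filter_upwards [h1, ih hs] with x hx hx'
    rw [hx, Finset.sum_insert ha, Pi.add_apply, hx']

/-- Multiplication formula for a Schwartz function and an `L²` function. -/
lemma integral_schwartz_mul_l2Fourier (G : 𝓢(V, ℂ)) {h : V → ℂ}
    (hh : MemLp h 2 (volume : Measure V)) :
    ∫ x, G x * l2Fourier h x = ∫ x, 𝓕 (G : V → ℂ) x * h x := by
  have h1 := congrArg (fun T => T G) (Lp.fourier_toTemperedDistribution_eq (hh.toLp h))
  simp only [TemperedDistribution.fourier_apply, Lp.toTemperedDistribution_apply] at h1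
  rw [l2Fourier_eq hh]
  simp only [smul_eq_mul] at h1
  rw [← h1]
  refine integral_congr_ae ?_
  filter_upwards [hh.coeFn_toLp] with x hx
  rw [hx, SchwartzMap.fourier_coe]

lemma integral_schwartz_mul_l2FourierInv (G : 𝓢(V, ℂ)) {h : V → ℂ}
    (hh : MemLp h 2 (volume : Measure V)) :
    ∫ x, G x * l2FourierInv h x = ∫ x, 𝓕⁻ (G : V → ℂ) x * h x := by
  have h1 := congrArg (fun T => T G) (Lp.fourierInv_toTemperedDistribution_eq (hh.toLp h))
  simp only [TemperedDistribution.fourierInv_apply, Lp.toTemperedDistribution_apply] at h1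
  rw [l2FourierInv_eq hh]
  simp only [smul_eq_mul] at h1
  rw [← h1]
  refine integral_congr_ae ?_
  filter_upwards [hh.coeFn_toLp] with x hx
  rw [hx, SchwartzMap.fourierInv_coe]

/-- For `f ∈ L¹ ∩ L²` the two inverse Fourier transforms agree. -/
lemma fourierInv_ae_eq_l2FourierInv {f : V → ℂ} (hf : Integrable f)
    (hf2 : MemLp f 2 (volume : Measure V)) : 𝓕⁻ f =ᵐ[volume] l2FourierInv f := by
  have hcont : Continuous (𝓕⁻ f) := by
    have := VectorFourier.fourierIntegral_continuous (V := V) (W := V)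
      (L := -(innerₗ V)) continuous_fourierChar (by
        simp only [LinearMap.neg_apply, innerₗ_apply_apply]
        exact (continuous_inner (𝕜 := ℝ) (E := V)).neg) hf
    have e : (𝓕⁻ f) = VectorFourier.fourierIntegral 𝐞 volume (-(innerₗ V)) f := by
      ext w
      rw [Real.fourierInv_eq', VectorFourier.fourierIntegral]
      simp [Circle.smul_def, Real.fourierChar_apply, mul_comm, real_inner_comm]
    rw [e]; exact this
  have hl2 := (l2FourierInv_memLp hf2)
  have hloc : LocallyIntegrable (l2FourierInv f) (volume : Measure V) :=
    hl2.locallyIntegrable (by norm_num)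
  refine (ae_eq_of_integral_contDiff_smul_eq hcont.locallyIntegrable hloc ?_)
  intro g hg hgc
  let G : 𝓢(V, ℂ) := (HasCompactSupport.toSchwartzMap (f := fun x => (g x : ℂ))
    (hgc.comp_left (g := fun x : ℝ => (x : ℂ)) (by simp)) (Complex.ofRealCLM.contDiff.comp hg))
  have hG : ∀ x, G x = g x := fun x => rfl
  have h1 := integral_schwartz_mul_l2FourierInv G hf2
  simp only [hG] at h1
  simp only [Complex.real_smul]
  rw [h1]
  have h2 := VectorFourier.integral_fourierIntegral_smul_eq_flip (L := -(innerₗ V))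
    (μ := volume) (ν := volume) (e := 𝐞) (f := (G : V → ℂ)) (g := f)
      continuous_fourierChar (by
        simp only [LinearMap.neg_apply, innerₗ_apply_apply]
        exact (continuous_inner (𝕜 := ℝ) (E := V)).neg) G.integrable hf
  have e : ∀ F : V → ℂ, (𝓕⁻ F) = VectorFourier.fourierIntegral 𝐞 volume (-(innerₗ V)) F := by
    intro F
    ext w
    rw [Real.fourierInv_eq', VectorFourier.fourierIntegral]
    simp [Circle.smul_def, Real.fourierChar_apply, mul_comm, real_inner_comm]
  have e' : (-(innerₗ V)).flip = -(innerₗ V) := by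
    ext x y; simp [real_inner_comm]
  rw [e', ← e, ← e] at h2
  simp only [smul_eq_mul, hG] at h2
  exact h2.symm

lemma memLp_fourierInv {f : V → ℂ} (hf : Integrable f) (hf2 : MemLp f 2 (volume : Measure V)) :
    MemLp (𝓕⁻ f) 2 (volume : Measure V) :=
  (memLp_congr_ae (fourierInv_ae_eq_l2FourierInv hf hf2)).2 (l2FourierInv_memLp hf2)

lemma lintegral_sq_fourierInv {f : V → ℂ} (hf : Integrable f)
    (hf2 : MemLp f 2 (volume : Measure V)) :
    ∫⁻ x, ‖𝓕⁻ f x‖ₑ ^ 2 = ∫⁻ x, ‖f x‖ₑ ^ 2 := by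
  have h1 : eLpNorm (𝓕⁻ f) 2 volume = eLpNorm f 2 volume := by
    rw [eLpNorm_congr_ae (fourierInv_ae_eq_l2FourierInv hf hf2), eLpNorm_l2FourierInv hf2]
  have h2 := congrArg (fun x => x ^ 2) h1
  have e : ∀ F : V → ℂ, (eLpNorm F 2 volume) ^ 2 = ∫⁻ x, ‖F x‖ₑ ^ 2 := by
    intro F
    have := eLpNorm_nnreal_pow_eq_lintegral (f := F) (μ := volume) (p := 2) (by norm_num)
    simpa using this
  simpa only [e] using h2

/-- The Parseval identity for `L¹ ∩ L²`. -/
lemma integral_fourierInv_mul_conj {f g : V → ℂ} (hf : Integrable f)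
    (hf2 : MemLp f 2 (volume : Measure V)) (hg : Integrable g)
    (hg2 : MemLp g 2 (volume : Measure V)) :
    ∫ x, 𝓕⁻ f x * conj (𝓕⁻ g x) = ∫ x, f x * conj (g x) := by
  have h1 := Lp.inner_fourier_eq (𝓕⁻ (hg2.toLp g)) (𝓕⁻ (hf2.toLp f))
  rw [FourierTransform.fourier_fourierInv_eq, FourierTransform.fourier_fourierInv_eq,
    L2.inner_def, L2.inner_def] at h1
  have h2 : ∫ x, f x * conj (g x) =
      ∫ x, inner ℂ ((hg2.toLp g : Lp ℂ 2 (volume : Measure V)) x)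
        ((hf2.toLp f : Lp ℂ 2 (volume : Measure V)) x) := by
    refine integral_congr_ae ?_
    filter_upwards [hf2.coeFn_toLp, hg2.coeFn_toLp] with x hx hx'
    rw [hx, hx']; simp
  rw [h2, h1]
  refine integral_congr_ae ?_
  have a1 := fourierInv_ae_eq_l2FourierInv hf hf2
  have a2 := fourierInv_ae_eq_l2FourierInv hg hg2
  rw [l2FourierInv_eq hf2] at a1
  rw [l2FourierInv_eq hg2] at a2
  filter_upwards [a1, a2] with x hx hx'
  rw [hx, hx']; simp

end FourierL2

section Weights

/-- The polynomial weight `(1 + ‖x‖)^{-N}`. -/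
def wt {E : Type*} [SeminormedAddCommGroup E] (N : ℕ) (x : E) : ℝ := ((1 + ‖x‖) ^ N)⁻¹

variable {E : Type*} [NormedAddCommGroup E]

lemma wt_pos (N : ℕ) (x : E) : 0 < wt N x := by unfold wt; positivity

lemma wt_nonneg (N : ℕ) (x : E) : 0 ≤ wt N x := (wt_pos N x).le

lemma wt_le_one (N : ℕ) (x : E) : wt N x ≤ 1 := by
  unfold wt
  apply inv_le_one_of_one_le₀
  exact one_le_pow₀ (by linarith [norm_nonneg x])

lemma wt_neg (N : ℕ) (x : E) : wt N (-x) = wt N x := by simp [wt]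

lemma wt_add (N M : ℕ) (x : E) : wt (N + M) x = wt N x * wt M x := by
  unfold wt; rw [pow_add, mul_inv]

lemma continuous_wt (N : ℕ) : Continuous (wt N : E → ℝ) := by
  unfold wt
  exact Continuous.inv₀ (by fun_prop) fun x => by positivity

lemma wt_mul_wt_le (N : ℕ) (x y : E) : wt N x * wt N y ≤ wt N (x + y) := by
  unfold wt
  rw [← mul_inv, ← mul_pow]
  gcongr
  nlinarith [norm_add_le x y, norm_nonneg x, norm_nonneg y]

lemma wt_le_of_norm_le {F : Type*} [NormedAddCommGroup F] (N : ℕ) {C : ℝ} {x : E}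
    {y : F} (h : 1 + ‖y‖ ≤ C * (1 + ‖x‖)) : wt N x ≤ C ^ N * wt N y := by
  unfold wt
  rw [← div_eq_mul_inv, inv_eq_one_div, div_le_div_iff₀ (by positivity) (by positivity), one_mul,
    ← mul_pow]
  gcongr

variable [NormedSpace ℝ E] [FiniteDimensional ℝ E] [MeasurableSpace E] [BorelSpace E]

lemma lintegral_wt_lt_top (μ : Measure E) [μ.IsAddHaarMeasure] {N : ℕ}
    (hN : Module.finrank ℝ E < N) : ∫⁻ x : E, ENNReal.ofReal (wt N x) ∂μ < ∞ := by
  have := finite_integral_one_add_norm (E := E) (μ := μ) (r := N) (by exact_mod_cast hN)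
  refine lt_of_le_of_lt (lintegral_mono fun x => ?_) this
  apply ENNReal.ofReal_le_ofReal
  unfold wt
  rw [Real.rpow_neg (by positivity), Real.rpow_natCast]

/-- The integral of a translated and dilated function. -/
lemma lintegral_comp_smul_sub (μ : Measure E) [μ.IsAddHaarMeasure] (f : E → ℝ≥0∞)
    (a : E) {r : ℝ} (hr : 0 < r) :
    ∫⁻ x, f (r⁻¹ • (x - a)) ∂μ =
      ENNReal.ofReal r ^ Module.finrank ℝ E * ∫⁻ x, f x ∂μ := by
  rw [lintegral_sub_right_eq_self (fun x => f (r⁻¹ • x)) a]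
  have e : MeasurableEmbedding (fun x : E => r⁻¹ • x) :=
    (Homeomorph.smulOfNeZero r⁻¹ (inv_ne_zero hr.ne')).measurableEmbedding
  rw [← e.lintegral_map, Measure.map_addHaar_smul μ (inv_ne_zero hr.ne'), lintegral_smul_measure]
  congr 1
  rw [inv_pow, inv_inv, abs_of_pos (by positivity), ENNReal.ofReal_pow hr.le]

end Weights

section Decay
open scoped FourierTransform SchwartzMap ComplexConjugate ContDiff
open Real

variable {V : Type*} [NormedAddCommGroup V] [InnerProductSpace ℝ V] [FiniteDimensional ℝ V]
  [MeasurableSpace V] [BorelSpace V]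
  {E : Type*} [NormedAddCommGroup E] [NormedSpace ℝ E] [FiniteDimensional ℝ E]

/-- Fourier transforms of a smooth compactly supported family decay rapidly, uniformly for
parameters in a compact set. -/
lemma exists_fourierInv_family_decay (F : E × V → ℂ) (hF : ContDiff ℝ ∞ F) (K : Set V)
    (hK : IsCompact K) (hFK : ∀ s, ∀ u ∉ K, F (s, u) = 0) (ρ : ℝ) (N : ℕ) :
    ∃ C : ℝ, 0 ≤ C ∧ ∀ s : E, ‖s‖ ≤ ρ → ∀ y : V, ‖𝓕⁻ (fun u => F (s, u)) y‖ ≤ C * wt N y := by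
  have hslice : ∀ s, ContDiff ℝ ∞ (fun u => F (s, u)) := fun s =>
    hF.comp (contDiff_const.prodMk contDiff_id)
  have hsupp : ∀ s (j : ℕ), ∀ u ∉ K, iteratedFDeriv ℝ j (fun u => F (s, u)) u = 0 := by
    intro s j u hu
    have h1 : u ∉ tsupport (fun u => F (s, u)) := by
      intro h
      refine hu (closure_minimal (fun v hv => ?_) hK.isClosed h)
      by_contra hvK
      exact hv (hFK s v hvK)
    have h2 := tsupport_iteratedFDeriv_subset (𝕜 := ℝ) (f := fun u => F (s, u)) j
    exact image_eq_zero_of_notMem_tsupport (fun h => h1 (h2 h))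
  have hbd : ∀ j : ℕ, ∃ M : ℝ, ∀ s : E, ‖s‖ ≤ ρ → ∀ u,
      ‖iteratedFDeriv ℝ j (fun u => F (s, u)) u‖ ≤ K.indicator (fun _ => M) u := by
    intro j
    have hc : IsCompact ((Metric.closedBall (0 : E) ρ) ×ˢ K) :=
      (isCompact_closedBall _ _).prod hK
    obtain ⟨M, hM⟩ := hc.exists_bound_of_continuousOn
      (f := iteratedFDeriv ℝ j F)
      (hF.continuous_iteratedFDeriv (by exact_mod_cast le_top)).continuousOn
    refine ⟨M * ∏ _i : Fin j, ‖ContinuousLinearMap.inr ℝ E V‖, fun s hs u => ?_⟩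
    by_cases hu : u ∈ K
    · rw [Set.indicator_of_mem hu]
      have e : (fun u => F (s, u)) =
          (fun z => F ((s, 0) + z)) ∘ (ContinuousLinearMap.inr ℝ E V) := by
        ext v; simp
      have hF' : ContDiff ℝ ∞ (fun z => F ((s, 0) + z)) :=
        hF.comp (contDiff_const.add contDiff_id)
      rw [e, ContinuousLinearMap.iteratedFDeriv_comp_right _ hF' _ (by exact_mod_cast le_top)]
      refine (ContinuousMultilinearMap.norm_compContinuousLinearMap_le _ _).trans ?_
      gcongr
      rw [iteratedFDeriv_comp_add_left]
      have := hM (s, u) ⟨by simpa using hs, hu⟩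
      simpa using this
    · rw [Set.indicator_of_notMem hu, hsupp s j u hu, norm_zero]
  choose M hM using hbd
  have h_integ : ∀ s : E, ∀ k j : ℕ, ‖s‖ ≤ ρ →
      Integrable (fun v : V => ‖v‖ ^ k * ‖iteratedFDeriv ℝ j (fun u => F (s, u)) v‖) ∧
      ∫ v : V, ‖v‖ ^ k * ‖iteratedFDeriv ℝ j (fun u => F (s, u)) v‖ ≤
        ∫ v : V, ‖v‖ ^ k * K.indicator (fun _ => M j) v := by
    intro s k j hs
    have i1 : Integrable (fun v : V => ‖v‖ ^ k * K.indicator (fun _ => M j) v) := by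
      have e : (fun v : V => ‖v‖ ^ k * K.indicator (fun _ => M j) v) =
          K.indicator (fun v => ‖v‖ ^ k * M j) := by
        ext v; by_cases hv : v ∈ K <;> simp [hv]
      rw [e, integrable_indicator_iff hK.measurableSet]
      exact ContinuousOn.integrableOn_compact hK (by fun_prop)
    have i2 : Integrable (fun v : V => ‖v‖ ^ k * ‖iteratedFDeriv ℝ j (fun u => F (s, u)) v‖) := by
      refine i1.mono' ?_ ?_
      · have := (hslice s).continuous_iteratedFDeriv (m := j) (by exact_mod_cast le_top)
        exact (by fun_prop : Continuous (fun v : V => ‖v‖ ^ k *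
            ‖iteratedFDeriv ℝ j (fun u => F (s, u)) v‖)).aestronglyMeasurable
      · refine Filter.Eventually.of_forall fun v => ?_
        rw [Real.norm_of_nonneg (by positivity)]
        exact mul_le_mul_of_nonneg_left (hM j s hs v) (by positivity)
    exact ⟨i2, integral_mono i2 i1 fun v => mul_le_mul_of_nonneg_left (hM j s hs v) (by positivity)⟩
  have hdec : ∀ n : ℕ, ∃ C : ℝ, 0 ≤ C ∧ ∀ s : E, ‖s‖ ≤ ρ → ∀ y : V,
      ‖y‖ ^ n * ‖𝓕⁻ (fun u => F (s, u)) y‖ ≤ C := by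
    intro n
    refine ⟨|(2 * 0 + 2) ^ n * ∑ p ∈ Finset.range (0 + 1) ×ˢ Finset.range (n + 1),
        ∫ v : V, ‖v‖ ^ p.1 * K.indicator (fun _ => M p.2) v|, abs_nonneg _, fun s hs y => ?_⟩
    have h1 := Real.pow_mul_norm_iteratedFDeriv_fourier_le
      (f := fun u => F (s, u)) (N := ⊤) (K := ⊤)
      (hslice s) (fun k j _ _ => (h_integ s k j hs).1) (k := 0) (n := n) (by simp) (by simp) (-y)
    rw [norm_iteratedFDeriv_zero, norm_neg] at h1
    rw [fourierInv_eq_fourier_neg]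
    refine h1.trans (le_trans ?_ (le_abs_self _))
    simp only [pow_zero, one_mul, Nat.cast_zero]
    refine mul_le_mul_of_nonneg_left (Finset.sum_le_sum fun p _ => (h_integ s p.1 p.2 hs).2) ?_
    positivity
  obtain ⟨C0, h0, hC0⟩ := hdec 0
  obtain ⟨C1, h1, hC1⟩ := hdec N
  refine ⟨2 ^ N * (C0 + C1), by positivity, fun s hs y => ?_⟩
  unfold wt
  rw [← div_eq_mul_inv, le_div_iff₀ (by positivity)]
  have a0 := hC0 s hs y
  have a1 := hC1 s hs y
  rw [pow_zero, one_mul] at a0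
  have : (1 + ‖y‖) ^ N ≤ 2 ^ N * (1 + ‖y‖ ^ N) := by
    rcases le_total ‖y‖ 1 with h | h
    · calc (1 + ‖y‖) ^ N ≤ 2 ^ N := by gcongr; linarith
        _ ≤ _ := by nlinarith [pow_nonneg (norm_nonneg y) N, pow_pos (two_pos (α := ℝ)) N]
    · calc (1 + ‖y‖) ^ N ≤ (2 * ‖y‖) ^ N := by gcongr; linarith
        _ ≤ _ := by
          rw [mul_pow]
          nlinarith [pow_nonneg (norm_nonneg y) N, pow_pos (two_pos (α := ℝ)) N]
  calc ‖𝓕⁻ (fun u => F (s, u)) y‖ * (1 + ‖y‖) ^ N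
      ≤ ‖𝓕⁻ (fun u => F (s, u)) y‖ * (2 ^ N * (1 + ‖y‖ ^ N)) := by gcongr
    _ = 2 ^ N * (‖𝓕⁻ (fun u => F (s, u)) y‖ + ‖y‖ ^ N * ‖𝓕⁻ (fun u => F (s, u)) y‖) := by ring
    _ ≤ _ := by gcongr

end Decay

section CauchySchwarz
variable {α : Type*} [MeasurableSpace α] {μ : Measure α}

lemma lintegral_mul_sq_le {a b : α → ℝ≥0∞} (ha : AEMeasurable a μ) (hb : AEMeasurable b μ) :
    (∫⁻ x, a x * b x ∂μ) ^ 2 ≤ (∫⁻ x, a x ^ 2 ∂μ) * ∫⁻ x, b x ^ 2 ∂μ := by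
  have h := ENNReal.lintegral_mul_le_Lp_mul_Lq μ Real.HolderConjugate.two_two ha hb
  calc (∫⁻ x, a x * b x ∂μ) ^ 2 ≤ _ := pow_le_pow_left' h 2
    _ = _ := by
      rw [mul_pow, ← ENNReal.rpow_natCast, ← ENNReal.rpow_mul, ← ENNReal.rpow_natCast,
        ← ENNReal.rpow_mul]
      simp

lemma lintegral_mul_sq_le_weight {a b : α → ℝ≥0∞} (ha : AEMeasurable a μ)
    (hb : AEMeasurable b μ) :
    (∫⁻ x, a x * b x ∂μ) ^ 2 ≤ (∫⁻ x, a x ∂μ) * ∫⁻ x, a x * b x ^ 2 ∂μ := by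
  have h := lintegral_mul_sq_le (μ := μ) (a := fun x => a x ^ (2⁻¹ : ℝ))
    (b := fun x => a x ^ (2⁻¹ : ℝ) * b x) (ha.pow_const _) ((ha.pow_const _).mul hb)
  have e : ∀ y : ℝ≥0∞, (y ^ (2⁻¹ : ℝ)) * (y ^ (2⁻¹ : ℝ)) = y := by
    intro y
    rw [← ENNReal.rpow_add_of_nonneg _ _ (by norm_num) (by norm_num)]
    norm_num
  have e1 : ∀ x, a x ^ (2⁻¹ : ℝ) * (a x ^ (2⁻¹ : ℝ) * b x) = a x * b x := fun x => by
    rw [← mul_assoc, e]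
  have e2 : ∀ x, (a x ^ (2⁻¹ : ℝ)) ^ 2 = a x := fun x => by rw [pow_two, e]
  have e3 : ∀ x, (a x ^ (2⁻¹ : ℝ) * b x) ^ 2 = a x * b x ^ 2 := fun x => by rw [mul_pow, e2]
  simpa only [e1, e2, e3] using h

end CauchySchwarz

/-- A complex-valued quadratic phase on `ℝ^ι`, with the data used to describe how its wave
packets move. -/
structure QuadPhase (ι : Type*) [Fintype ι] where
  /-- The complex bilinear form of the phase. -/
  B : EuclideanSpace ℝ ι →L[ℝ] EuclideanSpace ℝ ι →L[ℝ] ℂ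
  symm : ∀ x y, B x y = B y x
  /-- The displacement of a packet of frequency `x` at time `t`. -/
  A : ℂ →L[ℝ] EuclideanSpace ℝ ι →L[ℝ] EuclideanSpace ℝ ι
  inner_A : ∀ t x y, inner ℝ (A t x) y = (starRingEnd ℂ t * B x y).re
  /-- A pairing turning displacements into conjugates of `B`. -/
  H : EuclideanSpace ℝ ι →L[ℝ] EuclideanSpace ℝ ι →L[ℝ] ℂ
  H_A : ∀ t x y, H (A t x) y = t * starRingEnd ℂ (B x y)
  /-- A lower bound for the displacement. -/
  c : ℝ
  c_pos : 0 < c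
  lower : ∀ t x, c * ‖t‖ * ‖x‖ ≤ ‖A t x‖

section Packets
open scoped FourierTransform SchwartzMap ComplexConjugate ContDiff
open Real

/-- A smooth bump on the line whose integer translates have squares summing to one. -/
def bump1 (x : ℝ) : ℝ := sin (π / 2 * smoothTransition (1 + x)) * cos (π / 2 * smoothTransition x)

lemma contDiff_bump1 : ContDiff ℝ ∞ bump1 := by
  unfold bump1
  have h := smoothTransition.contDiff (n := (⊤ : ℕ∞))
  exact (contDiff_sin.comp (contDiff_const.mul (h.comp (contDiff_const.add contDiff_id)))).mul
    (contDiff_cos.comp (contDiff_const.mul h))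

lemma bump1_eq_zero {x : ℝ} (h : 1 ≤ |x|) : bump1 x = 0 := by
  unfold bump1
  rcases le_abs.1 h with h | h
  · rw [smoothTransition.one_of_one_le h, mul_one, cos_pi_div_two, mul_zero]
  · rw [smoothTransition.zero_of_nonpos (by linarith : 1 + x ≤ 0), mul_zero, sin_zero, zero_mul]

lemma bump1_sq_add {x : ℝ} (h0 : 0 ≤ x) (h1 : x ≤ 1) : bump1 x ^ 2 + bump1 (x - 1) ^ 2 = 1 := by
  unfold bump1
  rw [smoothTransition.one_of_one_le (by linarith : 1 ≤ 1 + x),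
    smoothTransition.zero_of_nonpos (by linarith : x - 1 ≤ 0)]
  simp

lemma abs_bump1_le (x : ℝ) : |bump1 x| ≤ 1 := by
  unfold bump1
  rw [abs_mul]
  exact mul_le_one₀ (abs_sin_le_one _) (abs_nonneg _) (abs_cos_le_one _)

lemma bump1_eq_zero_of_ne {x : ℝ} {k : ℤ} (h0 : k ≠ ⌊x⌋) (h1 : k ≠ ⌊x⌋ + 1) :
    bump1 (x - k) = 0 := by
  apply bump1_eq_zero
  rcases lt_or_gt_of_ne h0 with h | h
  · have : (k : ℝ) + 1 ≤ ⌊x⌋ := by exact_mod_cast h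
    rw [le_abs]; left; linarith [Int.floor_le x]
  · have h2 : ⌊x⌋ + 2 ≤ k := by omega
    have : (⌊x⌋ : ℝ) + 2 ≤ k := by exact_mod_cast h2
    rw [le_abs]; right; linarith [Int.lt_floor_add_one x]

lemma sum_bump1_pair (x : ℝ) : ∑ k ∈ ({⌊x⌋, ⌊x⌋ + 1} : Finset ℤ), bump1 (x - k) ^ 2 = 1 := by
  rw [Finset.sum_pair (by omega)]
  have := bump1_sq_add (x := x - ⌊x⌋) (by linarith [Int.floor_le x])
    (by linarith [Int.lt_floor_add_one x])
  rw [Int.cast_add, Int.cast_one, ← sub_sub]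
  exact this

lemma sum_bump1_le (s : Finset ℤ) (x : ℝ) : ∑ k ∈ s, bump1 (x - k) ^ 2 ≤ 1 := by
  classical
  rw [← sum_bump1_pair x]
  have h1 : ∑ k ∈ s, bump1 (x - k) ^ 2 ≤
      ∑ k ∈ s ∪ {⌊x⌋, ⌊x⌋ + 1}, bump1 (x - k) ^ 2 :=
    Finset.sum_le_sum_of_subset_of_nonneg Finset.subset_union_left fun _ _ _ => sq_nonneg _
  refine h1.trans (le_of_eq (Finset.sum_subset Finset.subset_union_right ?_).symm)
  intro k _ hk
  simp only [Finset.mem_insert, Finset.mem_singleton, not_or] at hk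
  rw [bump1_eq_zero_of_ne hk.1 hk.2]; simp

lemma sum_bump1_eq {s : Finset ℤ} {x : ℝ} (h0 : ⌊x⌋ ∈ s) (h1 : ⌊x⌋ + 1 ∈ s) :
    ∑ k ∈ s, bump1 (x - k) ^ 2 = 1 := by
  rw [← sum_bump1_pair x]
  refine (Finset.sum_subset ?_ ?_).symm
  · intro k hk
    simp only [Finset.mem_insert, Finset.mem_singleton] at hk
    rcases hk with rfl | rfl <;> assumption
  · intro k _ hk
    simp only [Finset.mem_insert, Finset.mem_singleton, not_or] at hk
    rw [bump1_eq_zero_of_ne hk.1 hk.2]; simp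

variable {ι : Type*} [Fintype ι]

/-- The lattice point of `ℝ^ι` with integer coordinates `k`. -/
def lat {ι : Type*} (k : ι → ℤ) : EuclideanSpace ℝ ι := WithLp.toLp 2 fun i => (k i : ℝ)

@[simp] lemma lat_apply {ι : Type*} (k : ι → ℤ) (i : ι) : lat k i = k i := rfl

/-- The product bump on `ℝ^ι`. -/
def bump (u : EuclideanSpace ℝ ι) : ℝ := ∏ i, bump1 (u i)

lemma contDiff_bump : ContDiff ℝ ∞ (bump : EuclideanSpace ℝ ι → ℝ) := by
  unfold bump
  exact contDiff_prod fun i _ => contDiff_bump1.comp (by fun_prop)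

lemma norm_le_card_of_bump_ne {u : EuclideanSpace ℝ ι} (h : bump u ≠ 0) :
    ‖u‖ ≤ Fintype.card ι := by
  have h1 : ∀ i, ‖u i‖ ≤ 1 := by
    intro i
    by_contra! hi
    exact h (Finset.prod_eq_zero (Finset.mem_univ i) (bump1_eq_zero hi.le))
  have h2 : ‖u‖ ^ 2 ≤ Fintype.card ι := by
    rw [EuclideanSpace.norm_sq_eq]
    calc ∑ i, ‖u i‖ ^ 2 ≤ ∑ _i : ι, (1 : ℝ) :=
          Finset.sum_le_sum fun i _ => pow_le_one₀ (norm_nonneg _) (h1 i)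
      _ = _ := by simp
  rcases Nat.eq_zero_or_pos (Fintype.card ι) with h0 | h0
  · rw [h0] at h2 ⊢
    push_cast at h2 ⊢
    nlinarith [norm_nonneg u]
  · have : (1 : ℝ) ≤ Fintype.card ι := by exact_mod_cast h0
    nlinarith [norm_nonneg u]

lemma abs_bump_le (u : EuclideanSpace ℝ ι) : |bump u| ≤ 1 := by
  unfold bump
  rw [Finset.abs_prod]
  exact Finset.prod_le_one (fun _ _ => abs_nonneg _) fun _ _ => abs_bump1_le _

/-- The frequency cutoff centred at `r⁻¹ k`. -/
def packet (r : ℝ) (k : ι → ℤ) (ξ : EuclideanSpace ℝ ι) : ℝ := bump (r • ξ - lat k)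

/-- The centre of the packet. -/
def pc (r : ℝ) (k : ι → ℤ) : EuclideanSpace ℝ ι := r⁻¹ • lat k

lemma contDiff_packet (r : ℝ) (k : ι → ℤ) : ContDiff ℝ ∞ (packet r k) :=
  contDiff_bump.comp (by fun_prop)

lemma continuous_packet (r : ℝ) (k : ι → ℤ) : Continuous (packet r k) :=
  (contDiff_packet r k).continuous

lemma abs_packet_le (r : ℝ) (k : ι → ℤ) (ξ : EuclideanSpace ℝ ι) : |packet r k ξ| ≤ 1 :=
  abs_bump_le _

lemma norm_sub_pc_le {r : ℝ} (hr : 0 < r) {k : ι → ℤ} {ξ : EuclideanSpace ℝ ι}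
    (h : packet r k ξ ≠ 0) : ‖ξ - pc r k‖ ≤ Fintype.card ι / r := by
  have h1 := norm_le_card_of_bump_ne h
  have e : r • ξ - lat k = r • (ξ - pc r k) := by
    rw [pc, smul_sub, smul_inv_smul₀ hr.ne']
  rw [e, norm_smul, Real.norm_of_nonneg hr.le] at h1
  rw [le_div_iff₀ hr]; linarith

lemma sum_packet_le (s : Finset (ι → ℤ)) (r : ℝ) (ξ : EuclideanSpace ℝ ι) :
    ∑ k ∈ s, packet r k ξ ^ 2 ≤ 1 := by
  classical
  have hs : s ⊆ Fintype.piFinset fun i => s.image fun k => k i := by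
    intro k hk
    rw [Fintype.mem_piFinset]
    exact fun i => Finset.mem_image_of_mem _ hk
  refine (Finset.sum_le_sum_of_subset_of_nonneg hs fun _ _ _ => sq_nonneg _).trans ?_
  have : ∀ k : ι → ℤ, packet r k ξ ^ 2 = ∏ i, bump1 (r * ξ i - k i) ^ 2 := by
    intro k; simp [packet, bump, Finset.prod_pow]
  simp only [this]
  rw [← Finset.prod_univ_sum (fun i => s.image fun k => k i)
    fun i (k : ℤ) => bump1 (r * ξ i - k) ^ 2]
  exact Finset.prod_le_one (fun i _ => Finset.sum_nonneg fun _ _ => sq_nonneg _)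
    fun i _ => sum_bump1_le _ _

/-- The box of lattice points with coordinates bounded by `M`. -/
def latBox (ι : Type*) [Fintype ι] (M : ℕ) : Finset (ι → ℤ) :=
  open Classical in Fintype.piFinset fun _ => Finset.Icc (-(M : ℤ)) M

lemma card_latBox (M : ℕ) : (latBox ι M).card = (2 * M + 1) ^ Fintype.card ι := by
  classical
  simp only [latBox, Fintype.card_piFinset, Int.card_Icc, Finset.prod_const, Finset.card_univ]
  congr 1
  omega

lemma sum_packet_latBox {M : ℕ} {r : ℝ} {ξ : EuclideanSpace ℝ ι} (hr : 0 ≤ r)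
    (h : r * ‖ξ‖ + 1 ≤ M) : ∑ k ∈ latBox ι M, packet r k ξ ^ 2 = 1 := by
  classical
  have : ∀ k : ι → ℤ, packet r k ξ ^ 2 = ∏ i, bump1 (r * ξ i - k i) ^ 2 := by
    intro k; simp [packet, bump, Finset.prod_pow]
  simp only [this, latBox]
  rw [← Finset.prod_univ_sum (fun i => Finset.Icc (-(M : ℤ)) M)
    fun i (k : ℤ) => bump1 (r * ξ i - k) ^ 2]
  refine Finset.prod_eq_one fun i _ => ?_
  have h1 : |r * ξ i| ≤ r * ‖ξ‖ := by
    rw [abs_mul, abs_of_nonneg hr]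
    exact mul_le_mul_of_nonneg_left (PiLp.norm_apply_le ξ i) hr
  have h2 := abs_le.1 (h1.trans (by linarith : r * ‖ξ‖ ≤ M - 1))
  have a1 : -(M : ℤ) ≤ ⌊r * ξ i⌋ := by
    rw [Int.le_floor]; push_cast; linarith
  have a2 : ⌊r * ξ i⌋ + 1 ≤ M := by
    have := (Int.floor_le (r * ξ i)).trans h2.2
    have h3 : (⌊r * ξ i⌋ : ℝ) + 1 ≤ M := by linarith
    exact_mod_cast h3
  exact sum_bump1_eq (Finset.mem_Icc.2 ⟨a1, by omega⟩) (Finset.mem_Icc.2 ⟨by omega, a2⟩)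

/-- The finite set of packets meeting the set `T` inside the box of size `M`. -/
def activeSet (r : ℝ) (M : ℕ) (T : Set (EuclideanSpace ℝ ι)) : Finset (ι → ℤ) :=
  open Classical in (latBox ι M).filter fun k => ∃ ξ ∈ T, packet r k ξ ≠ 0

lemma sum_packet_activeSet {M : ℕ} {r : ℝ} {T : Set (EuclideanSpace ℝ ι)}
    {ξ : EuclideanSpace ℝ ι} (hr : 0 ≤ r) (h : r * ‖ξ‖ + 1 ≤ M) (hξ : ξ ∈ T) :
    ∑ k ∈ activeSet r M T, packet r k ξ ^ 2 = 1 := by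
  classical
  rw [← sum_packet_latBox hr h, activeSet, Finset.sum_filter]
  refine Finset.sum_congr rfl fun k _ => ?_
  split_ifs with hk
  · rfl
  · push Not at hk
    rw [hk ξ hξ]; simp

lemma card_activeSet_le (r : ℝ) (M : ℕ) (T : Set (EuclideanSpace ℝ ι)) :
    (activeSet r M T).card ≤ (2 * M + 1) ^ Fintype.card ι := by
  classical
  rw [← card_latBox]; exact Finset.card_filter_le _ _

lemma exists_of_mem_activeSet {r : ℝ} {M : ℕ} {T : Set (EuclideanSpace ℝ ι)} {k : ι → ℤ}
    (h : k ∈ activeSet r M T) : ∃ ξ ∈ T, packet r k ξ ≠ 0 := by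
  classical
  exact (Finset.mem_filter.1 h).2

end Packets

namespace QuadPhase
open scoped FourierTransform SchwartzMap ComplexConjugate ContDiff
open Real

variable {ι : Type*} [Fintype ι] (P : QuadPhase ι)

local notation "𝔼" => EuclideanSpace ℝ ι

/-- The real phase at time `t`. -/
def ph (t : ℂ) (ξ : 𝔼) : ℝ := (conj t * P.B ξ ξ).re / 2

/-- The extension operator. -/
def ext (f : 𝔼 → ℂ) (x : 𝔼) (t : ℂ) : ℂ :=
  ∫ ξ, (𝐞 (inner ℝ ξ x + P.ph t ξ) : ℂ) * f ξ

lemma ext_eq_fourierInv (f : 𝔼 → ℂ) (x : 𝔼) (t : ℂ) :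
    P.ext f x t = 𝓕⁻ (fun ξ => (𝐞 (P.ph t ξ) : ℂ) * f ξ) x := by
  rw [ext, Real.fourierInv_eq']
  refine integral_congr_ae (Filter.Eventually.of_forall fun ξ => ?_)
  simp only [AddChar.map_add_eq_mul, Circle.coe_mul, smul_eq_mul]
  rw [mul_assoc]
  congr 1

lemma ph_add (t : ℂ) (ξ η : 𝔼) :
    P.ph t (ξ + η) = P.ph t ξ + inner ℝ (P.A t ξ) η + P.ph t η := by
  simp only [ph, P.inner_A, map_add, _root_.add_apply, mul_add, Complex.add_re]
  rw [P.symm η ξ]; ring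

lemma ph_smul (t : ℂ) (a : ℝ) (ξ : 𝔼) : P.ph t (a • ξ) = a ^ 2 * P.ph t ξ := by
  simp only [ph, map_smul, _root_.smul_apply, Complex.real_smul]
  have : conj t * ((a : ℂ) * ((a : ℂ) * P.B ξ ξ)) = ((a ^ 2 : ℝ) : ℂ) * (conj t * P.B ξ ξ) := by
    push_cast; ring
  rw [this, Complex.re_ofReal_mul]; ring

lemma ph_smul_time (t : ℂ) (a : ℝ) (ξ : 𝔼) : P.ph (a • t) ξ = a * P.ph t ξ := by
  simp only [ph, Complex.real_smul, map_mul, Complex.conj_ofReal, mul_assoc,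
    Complex.re_ofReal_mul]
  ring

lemma ph_add_time (s t : ℂ) (ξ : 𝔼) : P.ph (s + t) ξ = P.ph s ξ + P.ph t ξ := by
  simp only [ph, map_add, add_mul, Complex.add_re]; ring

lemma contDiff_ph : ContDiff ℝ ∞ (fun z : ℂ × 𝔼 => P.ph z.1 z.2) := by
  unfold ph
  have h1 : ContDiff ℝ ∞ (fun z : ℂ × 𝔼 => P.B z.2 z.2) :=
    (P.B.contDiff.comp contDiff_snd).clm_apply contDiff_snd
  have h2 : ContDiff ℝ ∞ (fun z : ℂ × 𝔼 => conj z.1) :=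
    Complex.conjCLE.contDiff.comp contDiff_fst
  exact (Complex.reCLM.contDiff.comp (h2.mul h1)).div_const _

lemma continuous_ph : Continuous (fun z : ℂ × 𝔼 => P.ph z.1 z.2) := P.contDiff_ph.continuous

lemma contDiff_fourierChar : ContDiff ℝ ∞ (fun s : ℝ => (𝐞 s : ℂ)) := by
  simp only [Real.fourierChar_apply]
  exact ((Complex.ofRealCLM.contDiff.comp (contDiff_const.mul contDiff_id)).mul
    contDiff_const).cexp

lemma norm_ext_le (f : 𝔼 → ℂ) (x : 𝔼) (t : ℂ) : ‖P.ext f x t‖ₑ ≤ ∫⁻ ξ, ‖f ξ‖ₑ := by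
  refine (enorm_integral_le_lintegral_enorm _).trans (le_of_eq (lintegral_congr fun ξ => ?_))
  rw [enorm_mul, ← ofReal_norm, Circle.norm_coe]; simp

/-- Rescaling of the packet kernel. -/
lemma ext_packet_eq {r : ℝ} (hr : 0 < r) (k : ι → ℤ) (z : 𝔼) (t : ℂ) :
    ‖P.ext (fun ξ => (packet r k ξ : ℂ)) z t‖ = (r ^ Fintype.card ι)⁻¹ *
      ‖P.ext (fun u => (bump u : ℂ)) (r⁻¹ • (z + P.A t (pc r k))) ((r⁻¹ ^ 2 : ℝ) • t)‖ := by
  have e1 : ∀ u : 𝔼, (𝐞 (inner ℝ (r⁻¹ • (u + lat k)) z + P.ph t (r⁻¹ • (u + lat k))) : ℂ) =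
      (𝐞 (inner ℝ (r⁻¹ • lat k) z + P.ph t (r⁻¹ • lat k)) : ℂ) *
      (𝐞 (inner ℝ u (r⁻¹ • (z + P.A t (pc r k))) + P.ph ((r⁻¹ ^ 2 : ℝ) • t) u) : ℂ) := by
    intro u
    rw [← Circle.coe_mul, ← AddChar.map_add_eq_mul]
    congr 2
    rw [add_comm u, smul_add, ph_add, ph_smul, ph_smul, ph_smul_time, pc]
    simp only [inner_add_left, inner_add_right, inner_smul_left, inner_smul_right,
      real_inner_comm u, conj_trivial, map_smul, inner_smul_left]
    ring
  have h1 := Measure.integral_comp_smul (volume : Measure 𝔼)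
    (fun ξ => (𝐞 (inner ℝ ξ z + P.ph t ξ) : ℂ) * (packet r k ξ : ℂ)) r⁻¹
  have h2 := integral_add_right_eq_self (μ := (volume : Measure 𝔼))
    (fun u => (𝐞 (inner ℝ (r⁻¹ • u) z + P.ph t (r⁻¹ • u)) : ℂ) * (packet r k (r⁻¹ • u) : ℂ))
    (lat k)
  have e2 : ∀ u : 𝔼, packet r k (r⁻¹ • (u + lat k)) = bump u := by
    intro u; rw [packet, smul_inv_smul₀ hr.ne']; simp
  simp only [e1, e2, mul_assoc] at h2
  rw [integral_const_mul] at h2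
  simp only [finrank_euclideanSpace] at h1
  rw [h1] at h2
  have h3 := congrArg norm h2
  rw [norm_mul, Circle.norm_coe, one_mul, norm_smul, Real.norm_eq_abs, abs_abs,
    abs_of_pos (by positivity), inv_pow _ (Fintype.card ι), inv_inv] at h3
  simp only [ext]
  rw [h3, ← mul_assoc, inv_mul_cancel₀ (by positivity), one_mul]

/-- The packet kernel is concentrated on a tube. -/
lemma exists_kernel_bound (N : ℕ) : ∃ C : ℝ, 0 ≤ C ∧ ∀ r : ℝ, 0 < r → ∀ (k : ι → ℤ) (z : 𝔼) (t : ℂ),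
    ‖t‖ ≤ 4 * r ^ 2 → ‖P.ext (fun ξ => (packet r k ξ : ℂ)) z t‖ ≤
      C * (r ^ Fintype.card ι)⁻¹ * wt N (r⁻¹ • (z + P.A t (pc r k))) := by
  obtain ⟨C, hC, h⟩ := exists_fourierInv_family_decay (V := 𝔼) (E := ℂ)
    (fun z => (𝐞 (P.ph z.1 z.2) : ℂ) * (bump z.2 : ℂ))
    ((contDiff_fourierChar.comp P.contDiff_ph).mul
      (Complex.ofRealCLM.contDiff.comp (contDiff_bump.comp contDiff_snd)))
    (Metric.closedBall 0 (Fintype.card ι)) (isCompact_closedBall _ _)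
    (fun s u hu => by
      by_cases hb : bump u = 0
      · simp [hb]
      · exact absurd (by simpa using norm_le_card_of_bump_ne hb) hu) 4 N
  refine ⟨C, hC, fun r hr k z t ht => ?_⟩
  rw [P.ext_packet_eq hr, ext_eq_fourierInv, mul_comm C, mul_assoc]
  gcongr
  refine h _ ?_ _
  rw [norm_smul, Real.norm_of_nonneg (by positivity), inv_pow]
  rw [inv_mul_le_iff₀ (by positivity)]; linarith

lemma hasCompactSupport_packet {r : ℝ} (hr : 0 < r) (k : ι → ℤ) :
    HasCompactSupport (packet r k : 𝔼 → ℝ) := by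
  refine HasCompactSupport.intro (isCompact_closedBall (pc r k) (Fintype.card ι / r)) fun ξ hξ => ?_
  by_contra h
  exact hξ (by simpa [dist_eq_norm] using norm_sub_pc_le hr h)

/-- The extension of a packet piece of an `L²` Fourier transform, as an integral against the
packet kernel. -/
lemma ext_packet_mul_eq {r : ℝ} (hr : 0 < r) (k : ι → ℤ) {h b : 𝔼 → ℂ}
    (hh : MemLp h 2 (volume : Measure 𝔼)) (hb : b =ᵐ[volume] l2Fourier h) (x : 𝔼) (t : ℂ) :
    P.ext (fun ξ => (packet r k ξ : ℂ) * b ξ) x t =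
      ∫ y, P.ext (fun ξ => (packet r k ξ : ℂ)) (x - y) t * h y := by
  let G0 : 𝔼 → ℂ := fun ξ => (𝐞 (inner ℝ ξ x + P.ph t ξ) : ℂ) * (packet r k ξ : ℂ)
  have hG0 : ContDiff ℝ ∞ G0 := by
    have h1 : ContDiff ℝ ∞ (fun ξ : 𝔼 => inner ℝ ξ x + P.ph t ξ) :=
      (contDiff_id.inner ℝ contDiff_const).add
        (P.contDiff_ph.comp (contDiff_const.prodMk contDiff_id))
    exact (contDiff_fourierChar.comp h1).mul
      (Complex.ofRealCLM.contDiff.comp (contDiff_packet r k))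
  have hG0c : HasCompactSupport G0 :=
    ((hasCompactSupport_packet hr k).comp_left (g := fun x : ℝ => (x : ℂ)) (by simp)).mul_left
  have key := integral_schwartz_mul_l2Fourier (hG0c.toSchwartzMap hG0) hh
  have hG : ∀ ξ, (hG0c.toSchwartzMap hG0) ξ = G0 ξ := fun ξ => rfl
  have hG' : ((hG0c.toSchwartzMap hG0 : 𝓢(𝔼, ℂ)) : 𝔼 → ℂ) = G0 := rfl
  rw [hG'] at key
  have e1 : P.ext (fun ξ => (packet r k ξ : ℂ) * b ξ) x t = ∫ ξ, G0 ξ * l2Fourier h ξ := by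
    rw [ext]
    refine integral_congr_ae ?_
    filter_upwards [hb] with ξ hξ
    rw [hξ]; simp only [G0, mul_assoc]
  rw [e1, key]
  refine integral_congr_ae (Filter.Eventually.of_forall fun y => ?_)
  simp only
  congr 1
  rw [Real.fourier_eq', ext]
  refine integral_congr_ae (Filter.Eventually.of_forall fun ξ => ?_)
  simp only [G0, smul_eq_mul, inner_sub_right]
  rw [← mul_assoc]
  congr 1
  rw [Real.fourierChar_apply, Real.fourierChar_apply, ← Complex.exp_add]
  congr 1
  push_cast; ring

/-- Pointwise bound for a wave packet in terms of its profile. -/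
lemma exists_packet_bound {N : ℕ} (hN : Fintype.card ι < N) : ∃ C : NNReal, ∀ r : ℝ, 0 < r →
    ∀ (k : ι → ℤ) (h b : 𝔼 → ℂ), MemLp h 2 (volume : Measure 𝔼) → b =ᵐ[volume] l2Fourier h →
    ∀ (x : 𝔼) (t : ℂ), ‖t‖ ≤ 4 * r ^ 2 →
    ‖P.ext (fun ξ => (packet r k ξ : ℂ) * b ξ) x t‖ₑ ^ 2 ≤
      C * (ENNReal.ofReal r ^ Fintype.card ι)⁻¹ *
        ∫⁻ y, ENNReal.ofReal (wt N (r⁻¹ • (x - y + P.A t (pc r k)))) * ‖h y‖ₑ ^ 2 := by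
  obtain ⟨C, hC, hK⟩ := P.exists_kernel_bound N
  have hfin := lintegral_wt_lt_top (volume : Measure 𝔼) (N := N) (by simpa using hN)
  set I := ∫⁻ x : 𝔼, ENNReal.ofReal (wt N x) with hI
  refine ⟨C.toNNReal ^ 2 * I.toNNReal, fun r hr k h b hh hb x t ht => ?_⟩
  have hρ0 : ENNReal.ofReal r ^ Fintype.card ι ≠ 0 := by
    simp [hr]
  have hρ1 : ENNReal.ofReal r ^ Fintype.card ι ≠ ⊤ := by finiteness
  set ρ := ENNReal.ofReal r ^ Fintype.card ι with hρ
  have hWm : Measurable fun y : 𝔼 => ENNReal.ofReal (wt N (r⁻¹ • (x - y + P.A t (pc r k)))) := by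
    have : Continuous fun y : 𝔼 => wt N (r⁻¹ • (x - y + P.A t (pc r k))) :=
      (continuous_wt N).comp (by fun_prop)
    exact this.measurable.ennreal_ofReal
  have hWint : ∫⁻ y : 𝔼, ENNReal.ofReal (wt N (r⁻¹ • (x - y + P.A t (pc r k)))) = ρ * I := by
    have := lintegral_comp_smul_sub (volume : Measure 𝔼) (fun y => ENNReal.ofReal (wt N y))
      (x + P.A t (pc r k)) hr
    rw [finrank_euclideanSpace] at this
    rw [hρ, hI, ← this]
    refine lintegral_congr fun y => ?_
    rw [← wt_neg, ← smul_neg]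
    congr 3; abel
  have h1 : ‖P.ext (fun ξ => (packet r k ξ : ℂ) * b ξ) x t‖ₑ ≤ ENNReal.ofReal C * ρ⁻¹ *
      ∫⁻ y, ENNReal.ofReal (wt N (r⁻¹ • (x - y + P.A t (pc r k)))) * ‖h y‖ₑ := by
    rw [P.ext_packet_mul_eq hr k hh hb]
    refine (enorm_integral_le_lintegral_enorm _).trans ?_
    rw [← lintegral_const_mul' _ _ (by finiteness)]
    refine lintegral_mono fun y => ?_
    rw [enorm_mul, ← mul_assoc]
    gcongr
    rw [← ofReal_norm, hρ, ← ENNReal.ofReal_pow hr.le, ← ENNReal.ofReal_inv_of_pos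
      (by positivity), ← ENNReal.ofReal_mul hC, ← ENNReal.ofReal_mul (by positivity)]
    exact ENNReal.ofReal_le_ofReal (hK r hr k _ t ht)
  calc ‖P.ext (fun ξ => (packet r k ξ : ℂ) * b ξ) x t‖ₑ ^ 2
      ≤ (ENNReal.ofReal C * ρ⁻¹ *
        ∫⁻ y, ENNReal.ofReal (wt N (r⁻¹ • (x - y + P.A t (pc r k)))) * ‖h y‖ₑ) ^ 2 :=
        pow_le_pow_left' h1 2
    _ ≤ (ENNReal.ofReal C * ρ⁻¹) ^ 2 * ((ρ * I) *
        ∫⁻ y, ENNReal.ofReal (wt N (r⁻¹ • (x - y + P.A t (pc r k)))) * ‖h y‖ₑ ^ 2) := by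
        rw [mul_pow]
        gcongr
        rw [← hWint]
        exact lintegral_mul_sq_le_weight hWm.aemeasurable hh.1.enorm
    _ = (ENNReal.ofReal C ^ 2 * I) * ρ⁻¹ * (ρ⁻¹ * ρ) *
        ∫⁻ y, ENNReal.ofReal (wt N (r⁻¹ • (x - y + P.A t (pc r k)))) * ‖h y‖ₑ ^ 2 := by ring
    _ = _ := by
        rw [ENNReal.inv_mul_cancel hρ0 hρ1, mul_one]
        push_cast
        rw [ENNReal.coe_toNNReal hfin.ne]
        rfl

end QuadPhase

section Nice
open scoped FourierTransform ComplexConjugate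
variable {V : Type*} [NormedAddCommGroup V] [InnerProductSpace ℝ V] [FiniteDimensional ℝ V]
  [MeasurableSpace V] [BorelSpace V]

/-- The class of densities on which all manipulations are performed. -/
structure Nice (f : V → ℂ) : Prop where
  meas : Measurable f
  int : Integrable f
  mem : MemLp f 2 (volume : Measure V)

/-- The squared `L²` norm. -/
def E2 (f : V → ℂ) : ℝ≥0∞ := ∫⁻ x, ‖f x‖ₑ ^ 2

lemma lintegral_sq_lt_top {f : V → ℂ} (hf : MemLp f 2 (volume : Measure V)) :
    E2 f < ∞ := by
  unfold E2
  have := eLpNorm_nnreal_pow_eq_lintegral (f := f) (μ := volume) (p := 2) (by norm_num)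
  simp only [NNReal.coe_ofNat, ENNReal.coe_ofNat] at this
  have h2 : ∀ x : ℝ≥0∞, x ^ (2 : ℝ) = x ^ 2 := fun x => by
    rw [← ENNReal.rpow_natCast]; norm_num
  simp only [h2] at this
  rw [← this]
  exact ENNReal.pow_lt_top hf.2

lemma memLp_two_of_lintegral {f : V → ℂ} (hf : AEStronglyMeasurable f volume)
    (h : E2 f ≠ ∞) : MemLp f 2 (volume : Measure V) := by
  unfold E2 at h
  refine ⟨hf, ?_⟩
  have := eLpNorm_nnreal_pow_eq_lintegral (f := f) (μ := volume) (p := 2) (by norm_num)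
  simp only [NNReal.coe_ofNat, ENNReal.coe_ofNat] at this
  have h2 : ∀ x : ℝ≥0∞, x ^ (2 : ℝ) = x ^ 2 := fun x => by
    rw [← ENNReal.rpow_natCast]; norm_num
  simp only [h2] at this
  rw [← this] at h
  rw [lt_top_iff_ne_top]
  intro h'; rw [h'] at h; simp at h

lemma mul_le_sq_add_sq (a b : ℝ≥0∞) : a * b ≤ a ^ 2 + b ^ 2 := by
  rcases le_total a b with h | h
  · calc a * b ≤ b * b := by gcongr
      _ ≤ _ := by rw [sq b]; exact le_add_self
  · calc a * b ≤ a * a := by gcongr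
      _ ≤ _ := by rw [sq a]; exact le_self_add

lemma le_one_add_sq (a : ℝ≥0∞) : a ≤ 1 + a ^ 2 := by
  simpa [add_comm] using mul_le_sq_add_sq a 1

/-- A square integrable function with bounded support is nice. -/
lemma nice_of_bounded {f : V → ℂ} (hm : Measurable f) {T : Set V} (hT : Bornology.IsBounded T)
    (hs : Function.support f ⊆ T) (h2 : E2 f ≠ ∞) : Nice f := by
  refine ⟨hm, ⟨hm.aestronglyMeasurable, ?_⟩,
    memLp_two_of_lintegral hm.aestronglyMeasurable h2⟩
  obtain ⟨ρ, hρ⟩ := hT.subset_closedBall 0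
  rw [hasFiniteIntegral_iff_enorm]
  calc ∫⁻ x, ‖f x‖ₑ ≤ ∫⁻ x, ((Metric.closedBall (0 : V) ρ).indicator 1 x + ‖f x‖ₑ ^ 2) := by
        refine lintegral_mono fun x => ?_
        by_cases hx : f x = 0
        · simp [hx]
        · rw [Set.indicator_of_mem (hρ (hs hx))]
          exact le_one_add_sq _
    _ = volume (Metric.closedBall (0 : V) ρ) + E2 f := by
        rw [lintegral_add_left (measurable_one.indicator measurableSet_closedBall),
          lintegral_indicator_one measurableSet_closedBall, E2]
    _ < ∞ := ENNReal.add_lt_top.2 ⟨measure_closedBall_lt_top, lt_top_iff_ne_top.2 h2⟩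

lemma lintegral_enorm_conv_le {f g : V → ℂ} (hf : Nice f) (ζ : V) :
    ∫⁻ ξ, ‖f ξ‖ₑ * ‖g (ζ - ξ)‖ₑ ≤ E2 f + E2 g := by
  calc ∫⁻ ξ, ‖f ξ‖ₑ * ‖g (ζ - ξ)‖ₑ ≤ ∫⁻ ξ, (‖f ξ‖ₑ ^ 2 + ‖g (ζ - ξ)‖ₑ ^ 2) :=
        lintegral_mono fun ξ => mul_le_sq_add_sq _ _
    _ = _ := by
        rw [lintegral_add_left (hf.meas.enorm.pow_const _),
          lintegral_sub_left_eq_self (fun ξ => ‖g ξ‖ₑ ^ 2) ζ, E2, E2]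

lemma lintegral_lintegral_conv {f g : V → ℝ≥0∞} (hf : Measurable f) (hg : Measurable g) :
    ∫⁻ ζ, ∫⁻ ξ, f ξ * g (ζ - ξ) = (∫⁻ ξ, f ξ) * ∫⁻ ξ, g ξ := by
  rw [lintegral_lintegral_swap (by fun_prop), ← lintegral_mul_const _ hf]
  refine lintegral_congr fun ξ => ?_
  rw [lintegral_const_mul _ (by fun_prop), lintegral_sub_right_eq_self g ξ]

open scoped Convolution in
lemma nice_conv {f g : V → ℂ} (hf : Nice f) (hg : Nice g) :
    Integrable (fun ζ => ∫ ξ, f ξ * g (ζ - ξ)) ∧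
      MemLp (fun ζ => ∫ ξ, f ξ * g (ζ - ξ)) 2 (volume : Measure V) ∧
      ∀ x, 𝓕⁻ (fun ζ => ∫ ξ, f ξ * g (ζ - ξ)) x = 𝓕⁻ f x * 𝓕⁻ g x := by
  have e : (fun ζ => ∫ ξ, f ξ * g (ζ - ξ)) = f ⋆[ContinuousLinearMap.mul ℂ ℂ] g := by
    ext ζ; rfl
  have h_integ : Integrable (fun ζ => ∫ ξ, f ξ * g (ζ - ξ)) := by
    rw [e]; exact hf.int.integrable_convolution _ hg.int
  refine ⟨h_integ, ?_, fun x => ?_⟩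
  · refine memLp_two_of_lintegral h_integ.1 (ne_of_lt ?_)
    set M := E2 f + E2 g with hM
    have hMt : M < ∞ := ENNReal.add_lt_top.2
      ⟨lintegral_sq_lt_top hf.mem, lintegral_sq_lt_top hg.mem⟩
    calc ∫⁻ ζ, ‖∫ ξ, f ξ * g (ζ - ξ)‖ₑ ^ 2 ≤ ∫⁻ ζ, M * ‖∫ ξ, f ξ * g (ζ - ξ)‖ₑ := by
          refine lintegral_mono fun ζ => ?_
          rw [sq]
          gcongr
          refine (enorm_integral_le_lintegral_enorm _).trans ?_
          simp only [enorm_mul]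
          exact lintegral_enorm_conv_le hf ζ
      _ = M * ∫⁻ ζ, ‖∫ ξ, f ξ * g (ζ - ξ)‖ₑ := lintegral_const_mul' _ _ hMt.ne
      _ < ∞ := ENNReal.mul_lt_top hMt h_integ.2
  · rw [e, Real.fourierInv_eq_fourier_neg, Real.fourierInv_eq_fourier_neg,
      Real.fourierInv_eq_fourier_neg]
    exact Real.fourier_mul_convolution_eq hf.int hg.int _

end Nice

namespace QuadPhase
open scoped FourierTransform ComplexConjugate
open Real

variable {ι : Type*} [Fintype ι] (P : QuadPhase ι)

local notation "𝔼" => EuclideanSpace ℝ ι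

/-- The difference of the quadratic phases of two pairs of frequencies with the same sum. -/
def dQ (z : 𝔼 × 𝔼 × 𝔼) : ℂ :=
  (P.B z.2.1 z.2.1 + P.B (z.1 - z.2.1) (z.1 - z.2.1) - P.B z.2.2 z.2.2
    - P.B (z.1 - z.2.2) (z.1 - z.2.2)) / 2

lemma inner_dQ (t : ℂ) (z : 𝔼 × 𝔼 × 𝔼) : inner ℝ t (P.dQ z) =
    P.ph t z.2.1 + P.ph t (z.1 - z.2.1) - P.ph t z.2.2 - P.ph t (z.1 - z.2.2) := by
  rw [Complex.inner, dQ]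
  simp only [ph]
  rw [div_mul_eq_mul_div, Complex.div_ofNat_re, mul_comm]
  simp only [mul_add, mul_sub, Complex.add_re, Complex.sub_re]
  ring

lemma continuous_dQ : Continuous P.dQ := by
  unfold dQ
  fun_prop

lemma nice_modulate {f : 𝔼 → ℂ} (hf : Nice f) (t : ℂ) :
    Nice (fun ξ => (𝐞 (P.ph t ξ) : ℂ) * f ξ) := by
  have hc : Continuous fun ξ : 𝔼 => (𝐞 (P.ph t ξ) : ℂ) :=
    contDiff_fourierChar.continuous.comp
      (P.continuous_ph.comp (Continuous.prodMk_right t))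
  have hn : ∀ ξ, ‖(𝐞 (P.ph t ξ) : ℂ) * f ξ‖ = ‖f ξ‖ := fun ξ => by
    rw [norm_mul, Circle.norm_coe, one_mul]
  refine ⟨hc.measurable.mul hf.meas, ?_, ?_⟩
  · exact (integrable_norm_iff (hc.measurable.mul hf.meas).aestronglyMeasurable).1
      ((integrable_congr (Filter.Eventually.of_forall hn)).2 hf.int.norm)
  · exact (memLp_congr_norm (hc.measurable.mul hf.meas).aestronglyMeasurable hf.mem.1
      (Filter.Eventually.of_forall hn)).2 hf.mem

/-- The amplitude of the quadrilinear form. -/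
def quadAmp (a b a' b' : 𝔼 → ℂ) (z : 𝔼 × 𝔼 × 𝔼) : ℂ :=
  (a z.2.1 * b (z.1 - z.2.1)) * conj (a' z.2.2 * b' (z.1 - z.2.2))

lemma measurable_quadAmp {a b a' b' : 𝔼 → ℂ} (ha : Nice a) (hb : Nice b) (ha' : Nice a')
    (hb' : Nice b') : Measurable (quadAmp a b a' b') := by
  have := ha.meas; have := hb.meas; have := ha'.meas; have := hb'.meas
  have hc : Measurable (fun z : ℂ => conj z) := Complex.continuous_conj.measurable
  unfold quadAmp
  fun_prop

lemma lintegral_quadAmp_le {a b a' b' : 𝔼 → ℂ} (ha : Nice a) (hb : Nice b) (ha' : Nice a')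
    (hb' : Nice b') : ∫⁻ z, ‖quadAmp a b a' b' z‖ₑ ≤
      (∫⁻ ξ, ‖a ξ‖ₑ) * (∫⁻ ξ, ‖b ξ‖ₑ) * (E2 a' + E2 b') := by
  have m1 := ha.meas; have m2 := hb.meas; have m3 := ha'.meas; have m4 := hb'.meas
  have hm := (measurable_quadAmp ha hb ha' hb').enorm
  have e : ∀ ζ : 𝔼, ∫⁻ y : 𝔼 × 𝔼, ‖quadAmp a b a' b' (ζ, y)‖ₑ =
      (∫⁻ ξ, ‖a ξ‖ₑ * ‖b (ζ - ξ)‖ₑ) * ∫⁻ ξ, ‖a' ξ‖ₑ * ‖b' (ζ - ξ)‖ₑ := by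
    intro ζ
    rw [← lintegral_prod_mul (by fun_prop) (by fun_prop)]
    refine lintegral_congr fun y => ?_
    simp [quadAmp, enorm_mul]
  calc ∫⁻ z, ‖quadAmp a b a' b' z‖ₑ
      = ∫⁻ ζ, ∫⁻ y : 𝔼 × 𝔼, ‖quadAmp a b a' b' (ζ, y)‖ₑ := lintegral_prod _ hm.aemeasurable
    _ ≤ ∫⁻ ζ, (∫⁻ ξ, ‖a ξ‖ₑ * ‖b (ζ - ξ)‖ₑ) *
          (E2 a' + E2 b') := by
        refine lintegral_mono fun ζ => ?_
        simp only [e]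
        gcongr
        exact lintegral_enorm_conv_le ha' ζ
    _ = _ := by
        rw [lintegral_mul_const', lintegral_lintegral_conv m1.enorm m2.enorm]
        exact (ENNReal.add_lt_top.2
          ⟨lintegral_sq_lt_top ha'.mem, lintegral_sq_lt_top hb'.mem⟩).ne

lemma integrable_quadAmp {a b a' b' : 𝔼 → ℂ} (ha : Nice a) (hb : Nice b) (ha' : Nice a')
    (hb' : Nice b') : Integrable (quadAmp a b a' b') := by
  refine ⟨(measurable_quadAmp ha hb ha' hb').aestronglyMeasurable, ?_⟩
  refine (lintegral_quadAmp_le ha hb ha' hb').trans_lt ?_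
  exact ENNReal.mul_lt_top (ENNReal.mul_lt_top ha.int.2 hb.int.2) (ENNReal.add_lt_top.2
          ⟨lintegral_sq_lt_top ha'.mem, lintegral_sq_lt_top hb'.mem⟩)

lemma integrable_quadAmp_mod {a b a' b' : 𝔼 → ℂ} (ha : Nice a) (hb : Nice b) (ha' : Nice a')
    (hb' : Nice b') (t : ℂ) :
    Integrable (fun z => (𝐞 (inner ℝ t (P.dQ z)) : ℂ) * quadAmp a b a' b' z) := by
  have hc : Continuous fun z => (𝐞 (inner ℝ t (P.dQ z)) : ℂ) :=
    contDiff_fourierChar.continuous.comp (continuous_const.inner P.continuous_dQ)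
  refine (integrable_quadAmp ha hb ha' hb').bdd_mul (c := 1) hc.aestronglyMeasurable
    (Filter.Eventually.of_forall fun z => ?_)
  rw [Circle.norm_coe]

lemma ext_mul_ext {a b : 𝔼 → ℂ} (ha : Nice a) (hb : Nice b) (t : ℂ) (x : 𝔼) :
    P.ext a x t * P.ext b x t = 𝓕⁻ (fun ζ => ∫ ξ, ((𝐞 (P.ph t ξ) : ℂ) * a ξ) *
      ((𝐞 (P.ph t (ζ - ξ)) : ℂ) * b (ζ - ξ))) x := by
  rw [ext_eq_fourierInv, ext_eq_fourierInv]
  exact ((nice_conv (P.nice_modulate ha t) (P.nice_modulate hb t)).2.2 x).symm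

lemma memLp_ext_mul_ext {a b : 𝔼 → ℂ} (ha : Nice a) (hb : Nice b) (t : ℂ) :
    MemLp (fun x => P.ext a x t * P.ext b x t) 2 volume := by
  have h := nice_conv (P.nice_modulate ha t) (P.nice_modulate hb t)
  simp only [P.ext_mul_ext ha hb]
  exact memLp_fourierInv h.1 h.2.1

lemma integral_quadrilinear {a b a' b' : 𝔼 → ℂ} (ha : Nice a) (hb : Nice b) (ha' : Nice a')
    (hb' : Nice b') (t : ℂ) :
    ∫ x, (P.ext a x t * P.ext b x t) * conj (P.ext a' x t * P.ext b' x t) =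
      ∫ z, (𝐞 (inner ℝ t (P.dQ z)) : ℂ) * quadAmp a b a' b' z := by
  have h := nice_conv (P.nice_modulate ha t) (P.nice_modulate hb t)
  have h' := nice_conv (P.nice_modulate ha' t) (P.nice_modulate hb' t)
  simp only [P.ext_mul_ext ha hb, P.ext_mul_ext ha' hb']
  rw [integral_fourierInv_mul_conj h.1 h.2.1 h'.1 h'.2.1]
  have hI := P.integrable_quadAmp_mod ha hb ha' hb' t
  rw [show (volume : Measure (𝔼 × 𝔼 × 𝔼)) = volume.prod volume from rfl] at hI ⊢
  rw [integral_prod _ hI]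
  refine integral_congr_ae (Filter.Eventually.of_forall fun ζ => ?_)
  simp only
  rw [← integral_conj, ← integral_prod_mul]
  refine integral_congr_ae (Filter.Eventually.of_forall fun y => ?_)
  simp only [quadAmp, inner_dQ, map_mul]
  have hcj : ∀ s : ℝ, conj (𝐞 s : ℂ) = (𝐞 (-s) : ℂ) := fun s => by
    rw [AddChar.map_neg_eq_inv, Circle.coe_inv_eq_conj]
  have hs : ∀ s1 s2 s3 s4 : ℝ, (𝐞 (s1 + s2 - s3 - s4) : ℂ) =
      (𝐞 s1 : ℂ) * (𝐞 s2 : ℂ) * ((𝐞 (-s3) : ℂ) * (𝐞 (-s4) : ℂ)) := fun s1 s2 s3 s4 => by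
    rw [show s1 + s2 - s3 - s4 = s1 + s2 + (-s3 + -s4) by ring, AddChar.map_add_eq_mul,
      AddChar.map_add_eq_mul, AddChar.map_add_eq_mul]
    simp only [Circle.coe_mul]
  rw [hcj, hcj, hs]
  ring

lemma measurable_quadrilinear {a b a' b' : 𝔼 → ℂ} (ha : Nice a) (hb : Nice b) (ha' : Nice a')
    (hb' : Nice b') : StronglyMeasurable fun t : ℂ =>
      ∫ z, (𝐞 (inner ℝ t (P.dQ z)) : ℂ) * quadAmp a b a' b' z := by
  have hc : Continuous fun w : ℂ × (𝔼 × 𝔼 × 𝔼) => (𝐞 (inner ℝ w.1 (P.dQ w.2)) : ℂ) :=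
    contDiff_fourierChar.continuous.comp
      (continuous_fst.inner (P.continuous_dQ.comp continuous_snd))
  have : StronglyMeasurable fun w : ℂ × (𝔼 × 𝔼 × 𝔼) =>
      (𝐞 (inner ℝ w.1 (P.dQ w.2)) : ℂ) * quadAmp a b a' b' w.2 :=
    (hc.measurable.mul ((measurable_quadAmp ha hb ha' hb').comp measurable_snd)).stronglyMeasurable
  exact this.integral_prod_right

lemma integrable_chi_quadrilinear {χ : ℂ → ℝ} (hχ : Integrable χ) {a b a' b' : 𝔼 → ℂ}
    (ha : Nice a) (hb : Nice b) (ha' : Nice a') (hb' : Nice b') :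
    Integrable fun t : ℂ => (χ t : ℂ) *
      ∫ z, (𝐞 (inner ℝ t (P.dQ z)) : ℂ) * quadAmp a b a' b' z := by
  refine hχ.ofReal.mul_bdd (c := ∫ z, ‖quadAmp a b a' b' z‖)
    (P.measurable_quadrilinear ha hb ha' hb').aestronglyMeasurable
    (Filter.Eventually.of_forall fun t => ?_)
  refine (norm_integral_le_integral_norm _).trans (le_of_eq ?_)
  refine integral_congr_ae (Filter.Eventually.of_forall fun z => ?_)
  simp only [norm_mul, Circle.norm_coe, one_mul]

lemma integral_chi_quadrilinear {χ : ℂ → ℝ} (hχ : Integrable χ) {a b a' b' : 𝔼 → ℂ}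
    (ha : Nice a) (hb : Nice b) (ha' : Nice a') (hb' : Nice b') :
    ∫ t : ℂ, (χ t : ℂ) * ∫ z, (𝐞 (inner ℝ t (P.dQ z)) : ℂ) * quadAmp a b a' b' z =
      ∫ z, 𝓕⁻ (fun t => (χ t : ℂ)) (P.dQ z) * quadAmp a b a' b' z := by
  have hc : Continuous fun w : ℂ × (𝔼 × 𝔼 × 𝔼) => (𝐞 (inner ℝ w.1 (P.dQ w.2)) : ℂ) :=
    contDiff_fourierChar.continuous.comp
      (continuous_fst.inner (P.continuous_dQ.comp continuous_snd))
  have hI : Integrable (fun w : ℂ × (𝔼 × 𝔼 × 𝔼) => (𝐞 (inner ℝ w.1 (P.dQ w.2)) : ℂ) *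
      ((χ w.1 : ℂ) * quadAmp a b a' b' w.2)) (volume.prod volume) := by
    refine ((hχ.ofReal (𝕜 := ℂ)).mul_prod (integrable_quadAmp ha hb ha' hb')).bdd_mul (c := 1)
      hc.aestronglyMeasurable (Filter.Eventually.of_forall fun z => ?_)
    rw [Circle.norm_coe]
  simp only [← integral_const_mul]
  have := integral_integral_swap (f := fun t z => (𝐞 (inner ℝ t (P.dQ z)) : ℂ) *
    ((χ t : ℂ) * quadAmp a b a' b' z)) hI
  calc _ = ∫ t : ℂ, ∫ z, (𝐞 (inner ℝ t (P.dQ z)) : ℂ) * ((χ t : ℂ) * quadAmp a b a' b' z) := by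
        simp only [mul_left_comm]
    _ = _ := by
        rw [this]
        refine integral_congr_ae (Filter.Eventually.of_forall fun z => ?_)
        simp only [← mul_assoc]
        rw [integral_mul_const, Real.fourierInv_eq]
        simp only [Circle.smul_def, smul_eq_mul]

/-- Non-stationary quadruples contribute little. -/
lemma enorm_chi_quadrilinear_le {χ : ℂ → ℝ} (hχ : Integrable χ) {a b a' b' : 𝔼 → ℂ}
    (ha : Nice a) (hb : Nice b) (ha' : Nice a') (hb' : Nice b') (ε : ℝ≥0∞)
    (hε : ∀ z, quadAmp a b a' b' z ≠ 0 → ‖𝓕⁻ (fun t => (χ t : ℂ)) (P.dQ z)‖ₑ ≤ ε) :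
    ‖∫ t : ℂ, (χ t : ℂ) * ∫ z, (𝐞 (inner ℝ t (P.dQ z)) : ℂ) * quadAmp a b a' b' z‖ₑ ≤
      ε * ((∫⁻ ξ, ‖a ξ‖ₑ) * (∫⁻ ξ, ‖b ξ‖ₑ) * (E2 a' + E2 b')) := by
  rw [P.integral_chi_quadrilinear hχ ha hb ha' hb']
  refine (enorm_integral_le_lintegral_enorm _).trans ?_
  refine le_trans ?_ (mul_le_mul_right (lintegral_quadAmp_le ha hb ha' hb') ε)
  rw [← lintegral_const_mul _ (measurable_quadAmp ha hb ha' hb').enorm]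
  refine lintegral_mono fun z => ?_
  rw [enorm_mul]
  by_cases hz : quadAmp a b a' b' z = 0
  · simp [hz]
  · gcongr
    exact hε z hz

lemma enorm_chi_quadrilinear_le_lintegral {χ : ℂ → ℝ} {a b a' b' : 𝔼 → ℂ}
    (ha : Nice a) (hb : Nice b) (ha' : Nice a') (hb' : Nice b') :
    ‖∫ t : ℂ, (χ t : ℂ) * ∫ z, (𝐞 (inner ℝ t (P.dQ z)) : ℂ) * quadAmp a b a' b' z‖ₑ ≤
      ∫⁻ t : ℂ, ‖χ t‖ₑ * ∫⁻ x, ‖P.ext a x t‖ₑ * ‖P.ext b x t‖ₑ *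
        (‖P.ext a' x t‖ₑ * ‖P.ext b' x t‖ₑ) := by
  refine (enorm_integral_le_lintegral_enorm _).trans (lintegral_mono fun t => ?_)
  rw [enorm_mul, ← P.integral_quadrilinear ha hb ha' hb']
  have : ‖(χ t : ℂ)‖ₑ = ‖χ t‖ₑ := by rw [← ofReal_norm, ← ofReal_norm]; simp
  rw [this]
  gcongr
  refine (enorm_integral_le_lintegral_enorm _).trans (le_of_eq (lintegral_congr fun x => ?_))
  have hcj : ∀ z : ℂ, ‖conj z‖ₑ = ‖z‖ₑ := fun z => by
    rw [← ofReal_norm, ← ofReal_norm, RCLike.norm_conj]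
  rw [enorm_mul, enorm_mul, map_mul, enorm_mul, hcj, hcj]

/-- Expanding the square: only the stationary pairs matter. -/
lemma lintegral_sq_sum_le {J : Type*} (S : Finset J) (a b : J → 𝔼 → ℂ)
    (ha : ∀ j ∈ S, Nice (a j)) (hb : ∀ j ∈ S, Nice (b j)) {χ : ℂ → ℝ} (hχ : Integrable χ)
    (hχ0 : ∀ t, 0 ≤ χ t) (res : J → J → Prop) [∀ j j', Decidable (res j j')] (δ : ℝ≥0∞)
    (hδ : ∀ j ∈ S, ∀ j' ∈ S, ¬ res j j' → ‖∫ t : ℂ, (χ t : ℂ) *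
      ∫ z, (𝐞 (inner ℝ t (P.dQ z)) : ℂ) * quadAmp (a j) (b j) (a j') (b j') z‖ₑ ≤ δ) :
    ∫⁻ t : ℂ, ‖χ t‖ₑ * ∫⁻ x, ‖∑ j ∈ S, P.ext (a j) x t * P.ext (b j) x t‖ₑ ^ 2 ≤
      (∑ j ∈ S, ∑ j' ∈ S with res j j', ∫⁻ t : ℂ, ‖χ t‖ₑ *
        ∫⁻ x, ‖P.ext (a j) x t‖ₑ * ‖P.ext (b j) x t‖ₑ *
        (‖P.ext (a j') x t‖ₑ * ‖P.ext (b j') x t‖ₑ)) + (S.card : ℝ≥0∞) ^ 2 * δ := by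
  set I : J → J → ℂ → ℂ := fun j j' t =>
    ∫ z, (𝐞 (inner ℝ t (P.dQ z)) : ℂ) * quadAmp (a j) (b j) (a j') (b j') z with hI
  have hmem : ∀ t, MemLp (fun x => ∑ j ∈ S, P.ext (a j) x t * P.ext (b j) x t) 2 volume :=
    fun t => memLp_finsetSum _ fun j hj => P.memLp_ext_mul_ext (ha j hj) (hb j hj) t
  have h1 : ∀ t, ∑ j ∈ S, ∑ j' ∈ S, I j j' t =
      ((∫ x, ‖∑ j ∈ S, P.ext (a j) x t * P.ext (b j) x t‖ ^ 2 : ℝ) : ℂ) := by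
    intro t
    have h_integ : ∀ j ∈ S, ∀ j' ∈ S, Integrable fun x => (P.ext (a j) x t * P.ext (b j) x t) *
        conj (P.ext (a j') x t * P.ext (b j') x t) := fun j hj j' hj' =>
      (P.memLp_ext_mul_ext (ha j hj) (hb j hj) t).integrable_mul
        (P.memLp_ext_mul_ext (ha j' hj') (hb j' hj') t).star
    rw [← integral_complex_ofReal]
    calc _ = ∑ j ∈ S, ∑ j' ∈ S, ∫ x, (P.ext (a j) x t * P.ext (b j) x t) *
        conj (P.ext (a j') x t * P.ext (b j') x t) :=
          Finset.sum_congr rfl fun j hj => Finset.sum_congr rfl fun j' hj' =>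
            (P.integral_quadrilinear (ha j hj) (hb j hj) (ha j' hj') (hb j' hj') t).symm
      _ = ∫ x, ∑ j ∈ S, ∑ j' ∈ S, (P.ext (a j) x t * P.ext (b j) x t) *
        conj (P.ext (a j') x t * P.ext (b j') x t) := by
          rw [integral_finsetSum _ fun j hj => integrable_finsetSum _ fun j' hj' =>
            h_integ j hj j' hj']
          exact Finset.sum_congr rfl fun j hj => (integral_finsetSum _ fun j' hj' =>
            h_integ j hj j' hj').symm
      _ = _ := by
          refine integral_congr_ae (Filter.Eventually.of_forall fun x => ?_)
          simp only
          rw [← Finset.sum_mul_sum, ← map_sum, Complex.mul_conj, Complex.normSq_eq_norm_sq]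
  have h2 : ∀ t, ∫⁻ x, ‖∑ j ∈ S, P.ext (a j) x t * P.ext (b j) x t‖ₑ ^ 2 =
      ENNReal.ofReal (∫ x, ‖∑ j ∈ S, P.ext (a j) x t * P.ext (b j) x t‖ ^ 2) := by
    intro t
    rw [ofReal_integral_eq_lintegral_ofReal
      ((memLp_two_iff_integrable_sq_norm (hmem t).1).1 (hmem t))
      (Filter.Eventually.of_forall fun x => by positivity)]
    refine lintegral_congr fun x => ?_
    rw [ENNReal.ofReal_pow (norm_nonneg _), ofReal_norm]
  have hintI : ∀ j ∈ S, ∀ j' ∈ S, Integrable fun t : ℂ => (χ t : ℂ) * I j j' t :=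
    fun j hj j' hj' => P.integrable_chi_quadrilinear hχ (ha j hj) (hb j hj) (ha j' hj') (hb j' hj')
  have hsum : Integrable fun t : ℂ => ∑ j ∈ S, ∑ j' ∈ S, (χ t : ℂ) * I j j' t :=
    integrable_finsetSum _ fun j hj => integrable_finsetSum _ fun j' hj' => hintI j hj j' hj'
  have e3 : ∀ t, ∑ j ∈ S, ∑ j' ∈ S, (χ t : ℂ) * I j j' t =
      ((χ t * ∫ x, ‖∑ j ∈ S, P.ext (a j) x t * P.ext (b j) x t‖ ^ 2 : ℝ) : ℂ) := by
    intro t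
    simp only [← Finset.mul_sum]
    rw [h1]; push_cast; rfl
  have h4 : ∫⁻ t : ℂ, ‖χ t‖ₑ * ∫⁻ x, ‖∑ j ∈ S, P.ext (a j) x t * P.ext (b j) x t‖ₑ ^ 2 =
      ‖∫ t : ℂ, ∑ j ∈ S, ∑ j' ∈ S, (χ t : ℂ) * I j j' t‖ₑ := by
    have hpos : ∀ t, 0 ≤ χ t * ∫ x, ‖∑ j ∈ S, P.ext (a j) x t * P.ext (b j) x t‖ ^ 2 :=
      fun t => mul_nonneg (hχ0 t) (integral_nonneg fun x => by positivity)
    have hre : Integrable fun t : ℂ =>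
        χ t * ∫ x, ‖∑ j ∈ S, P.ext (a j) x t * P.ext (b j) x t‖ ^ 2 := by
      have := hsum.re
      simp only [e3] at this
      simpa only [RCLike.re_to_complex, Complex.ofReal_re] using this
    simp only [e3]
    rw [integral_complex_ofReal, ← ofReal_norm, Complex.norm_real, Real.norm_of_nonneg
      (integral_nonneg hpos), ofReal_integral_eq_lintegral_ofReal hre
      (Filter.Eventually.of_forall hpos)]
    refine lintegral_congr fun t => ?_
    rw [h2, ENNReal.ofReal_mul (hχ0 t), Real.enorm_of_nonneg (hχ0 t)]
  rw [h4, integral_finsetSum _ fun j hj => integrable_finsetSum _ fun j' hj' => hintI j hj j' hj']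
  have h5 : ∀ j ∈ S, ‖∫ t : ℂ, ∑ j' ∈ S, (χ t : ℂ) * I j j' t‖ₑ ≤
      (∑ j' ∈ S with res j j', ∫⁻ t : ℂ, ‖χ t‖ₑ *
        ∫⁻ x, ‖P.ext (a j) x t‖ₑ * ‖P.ext (b j) x t‖ₑ *
        (‖P.ext (a j') x t‖ₑ * ‖P.ext (b j') x t‖ₑ)) + (S.card : ℝ≥0∞) * δ := by
    intro j hj
    rw [integral_finsetSum _ fun j' hj' => hintI j hj j' hj']
    refine (enorm_sum_le _ _).trans ?_
    rw [← Finset.sum_filter_add_sum_filter_not S (fun j' => res j j')]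
    gcongr with j' hj'
    · rw [Finset.mem_filter] at hj'
      exact P.enorm_chi_quadrilinear_le_lintegral (ha j hj) (hb j hj) (ha j' hj'.1) (hb j' hj'.1)
    · refine (Finset.sum_le_card_nsmul _ _ δ fun j' hj' => ?_).trans ?_
      · rw [Finset.mem_filter] at hj'
        exact hδ j hj j' hj'.1 hj'.2
      · rw [nsmul_eq_mul]
        gcongr
        exact Finset.filter_subset _ _
  refine (enorm_sum_le _ _).trans ((Finset.sum_le_sum h5).trans (le_of_eq ?_))
  rw [Finset.sum_add_distrib, Finset.sum_const, nsmul_eq_mul]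
  ring

end QuadPhase

section TimeCutoff
open scoped FourierTransform ComplexConjugate ContDiff
open Real

/-- A fixed smooth bump in time. -/
def timeBump : ContDiffBump (0 : ℂ) := ⟨1 / 2, 1, by norm_num, by norm_num⟩

/-- The bump localized to the ball of radius `h` about `t₀`. -/
def tcut (t₀ : ℂ) (h : ℝ) (t : ℂ) : ℝ := timeBump (h⁻¹ • (t - t₀))

lemma tcut_nonneg (t₀ : ℂ) (h : ℝ) (t : ℂ) : 0 ≤ tcut t₀ h t := timeBump.nonneg

lemma tcut_le_one (t₀ : ℂ) (h : ℝ) (t : ℂ) : tcut t₀ h t ≤ 1 := timeBump.le_one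

lemma tcut_eq_one {t₀ t : ℂ} {h : ℝ} (hh : 0 < h) (ht : ‖t - t₀‖ ≤ h / 2) : tcut t₀ h t = 1 := by
  refine timeBump.one_of_mem_closedBall ?_
  rw [mem_closedBall_zero_iff, norm_smul, norm_inv, Real.norm_of_nonneg hh.le,
    inv_mul_le_iff₀ hh]
  simpa [timeBump, div_eq_mul_inv] using ht

lemma tcut_eq_zero {t₀ t : ℂ} {h : ℝ} (hh : 0 < h) (ht : h ≤ ‖t - t₀‖) : tcut t₀ h t = 0 := by
  refine timeBump.zero_of_le_dist ?_
  rw [dist_zero_right, norm_smul, norm_inv, Real.norm_of_nonneg hh.le, le_inv_mul_iff₀ hh]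
  simpa [timeBump] using ht

lemma continuous_tcut (t₀ : ℂ) (h : ℝ) : Continuous (tcut t₀ h) :=
  timeBump.continuous.comp (by fun_prop)

lemma integrable_tcut (t₀ : ℂ) {h : ℝ} (hh : 0 < h) : Integrable (tcut t₀ h) := by
  refine (continuous_tcut t₀ h).integrable_of_hasCompactSupport ?_
  refine HasCompactSupport.intro (isCompact_closedBall t₀ h) fun t ht => ?_
  exact tcut_eq_zero hh
    (by simpa [dist_eq_norm] using (not_le.1 (mt Metric.mem_closedBall.2 ht)).le)

lemma exists_tcut_decay (N : ℕ) : ∃ C : ℝ, 0 ≤ C ∧ ∀ (t₀ : ℂ) (h : ℝ), 0 < h → ∀ w : ℂ,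
    ‖𝓕⁻ (fun t => (tcut t₀ h t : ℂ)) w‖ ≤ C * h ^ 2 * wt N (h • w) := by
  obtain ⟨C, hC, H⟩ := exists_fourierInv_family_decay (V := ℂ) (E := ℂ)
    (fun z => ((timeBump z.2 : ℝ) : ℂ))
    (Complex.ofRealCLM.contDiff.comp (timeBump.contDiff.comp contDiff_snd))
    (Metric.closedBall 0 1) (isCompact_closedBall _ _)
    (fun s u hu => by
      have : timeBump u = 0 := timeBump.zero_of_le_dist (by
        simpa [timeBump] using (not_le.1 (mt Metric.mem_closedBall.2 hu)).le)
      simp [this]) 0 N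
  refine ⟨C, hC, fun t₀ h hh w => ?_⟩
  have key : 𝓕⁻ (fun t => (tcut t₀ h t : ℂ)) w = (h ^ 2 : ℝ) • ((𝐞 (inner ℝ t₀ w) : ℂ) *
      𝓕⁻ (fun u => ((timeBump u : ℝ) : ℂ)) (h • w)) := by
    have h1 := Measure.integral_comp_smul (volume : Measure ℂ)
      (fun t => (𝐞 (inner ℝ (t + t₀) w) : ℂ) * (tcut t₀ h (t + t₀) : ℂ)) h
    have h2 := integral_add_right_eq_self (μ := (volume : Measure ℂ))
      (fun t => (𝐞 (inner ℝ t w) : ℂ) * (tcut t₀ h t : ℂ)) t₀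
    rw [Real.fourierInv_eq, Real.fourierInv_eq]
    simp only [Circle.smul_def, smul_eq_mul]
    rw [← h2]
    rw [Complex.finrank_real_complex, abs_of_pos (by positivity)] at h1
    rw [eq_comm, inv_smul_eq_iff₀ (by positivity)] at h1
    rw [h1, ← integral_const_mul]
    congr 1
    refine integral_congr_ae (Filter.Eventually.of_forall fun t => ?_)
    simp only [tcut, add_sub_cancel_right, inv_smul_smul₀ hh.ne']
    rw [inner_add_left, inner_smul_left, inner_smul_right, conj_trivial, add_comm,
      AddChar.map_add_eq_mul, Circle.coe_mul, mul_assoc]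
  rw [key, norm_smul, norm_mul, Circle.norm_coe, one_mul, Real.norm_of_nonneg (by positivity),
    mul_comm C, mul_assoc]
  gcongr
  exact H 0 (by simp) _

end TimeCutoff

namespace QuadPhase
open scoped FourierTransform ComplexConjugate
open Real

variable {ι : Type*} [Fintype ι] (P : QuadPhase ι)

local notation "𝔼" => EuclideanSpace ℝ ι

lemma measurable_ext {f : 𝔼 → ℂ} (hf : Measurable f) :
    Measurable fun w : 𝔼 × ℂ => P.ext f w.1 w.2 := by
  have hc : Continuous fun w : (𝔼 × ℂ) × 𝔼 => (𝐞 (inner ℝ w.2 w.1.1 + P.ph w.1.2 w.2) : ℂ) := by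
    refine contDiff_fourierChar.continuous.comp (Continuous.add ?_ ?_)
    · exact continuous_snd.inner (continuous_fst.comp continuous_fst)
    · exact P.continuous_ph.comp ((continuous_snd.comp continuous_fst).prodMk continuous_snd)
  have : StronglyMeasurable fun w : (𝔼 × ℂ) × 𝔼 =>
      (𝐞 (inner ℝ w.2 w.1.1 + P.ph w.1.2 w.2) : ℂ) * f w.2 :=
    (hc.measurable.mul (hf.comp measurable_snd)).stronglyMeasurable
  exact this.integral_prod_right.measurable

lemma dQ_eq (z : 𝔼 × 𝔼 × 𝔼) : P.dQ z = P.B (z.2.2 - z.2.1) (z.1 - z.2.2 - z.2.1) := by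
  simp only [dQ, map_sub, _root_.sub_apply]
  rw [P.symm z.2.2 z.2.1, P.symm z.2.2 z.1, P.symm z.2.1 z.1]
  ring

/-- Two pairs of packets are resonant if they contain frequencies with equal sums and nearly equal
phases. -/
def Res (r : ℝ) (j j' : (ι → ℤ) × (ι → ℤ)) : Prop :=
  ∃ z : 𝔼 × 𝔼 × 𝔼, packet r j.1 z.2.1 ≠ 0 ∧ packet r j.2 (z.1 - z.2.1) ≠ 0 ∧
    packet r j'.1 z.2.2 ≠ 0 ∧ packet r j'.2 (z.1 - z.2.2) ≠ 0 ∧ ‖P.dQ z‖ ≤ 1 / r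

lemma Res.symm {r : ℝ} {j j' : (ι → ℤ) × (ι → ℤ)} (h : P.Res r j j') : P.Res r j' j := by
  obtain ⟨z, h1, h2, h3, h4, h5⟩ := h
  refine ⟨(z.1, z.2.2, z.2.1), h3, h4, h1, h2, ?_⟩
  have : P.dQ (z.1, z.2.2, z.2.1) = - P.dQ z := by simp only [dQ]; ring
  rwa [this, norm_neg]

lemma Res.abs_sub_le {r : ℝ} {j j' : (ι → ℤ) × (ι → ℤ)} (h : P.Res r j j') (i : ι) :
    |j.2 i - (j'.1 i + j'.2 i - j.1 i)| ≤ 4 * (Fintype.card ι : ℤ) := by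
  obtain ⟨z, h1, h2, h3, h4, -⟩ := h
  have key : ∀ (k : ι → ℤ) (ξ : 𝔼), packet r k ξ ≠ 0 → |r * ξ i - k i| ≤ Fintype.card ι := by
    intro k ξ hk
    have := (PiLp.norm_apply_le (r • ξ - lat k) i).trans (norm_le_card_of_bump_ne hk)
    simpa using this
  have e1 := key _ _ h1
  have e2 := key _ _ h2
  have e3 := key _ _ h3
  have e4 := key _ _ h4
  simp only [PiLp.sub_apply] at e2 e4
  rw [abs_le] at e1 e2 e3 e4
  have : |((j.2 i - (j'.1 i + j'.2 i - j.1 i) : ℤ) : ℝ)| ≤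
      ((4 * (Fintype.card ι : ℤ) : ℤ) : ℝ) := by
    push_cast
    rw [abs_le]
    constructor <;> linarith [e1.1, e1.2, e2.1, e2.2, e3.1, e3.2, e4.1, e4.2]
  exact_mod_cast this

lemma card_res_le {r : ℝ} (L : Finset (ι → ℤ)) (k k' l' : ι → ℤ)
    [∀ l, Decidable (P.Res r (k, l) (k', l'))] :
    (L.filter fun l => P.Res r (k, l) (k', l')).card ≤
      (8 * Fintype.card ι + 1) ^ Fintype.card ι := by
  classical
  have : (L.filter fun l => P.Res r (k, l) (k', l')) ⊆ Fintype.piFinset fun i =>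
      Finset.Icc (k' i + l' i - k i - 4 * (Fintype.card ι : ℤ))
        (k' i + l' i - k i + 4 * (Fintype.card ι : ℤ)) := by
    intro l hl
    rw [Finset.mem_filter] at hl
    rw [Fintype.mem_piFinset]
    intro i
    have := hl.2.abs_sub_le P i
    rw [abs_le] at this
    simp only at this
    rw [Finset.mem_Icc]
    constructor <;> linarith [this.1, this.2]
  refine (Finset.card_le_card this).trans (le_of_eq ?_)
  rw [Fintype.card_piFinset]
  simp only [Int.card_Icc]
  rw [← Finset.card_univ, ← Finset.prod_const]
  refine Finset.prod_congr rfl fun i _ => ?_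
  rw [Finset.card_univ]; omega

/-- Resonance forces the packet centres to be almost orthogonal for `B`. -/
lemma Res.norm_B_le {r ρ : ℝ} (hr : 1 ≤ r) {j j' : (ι → ℤ) × (ι → ℤ)} (h : P.Res r j j')
    (h1 : ‖(pc r j.1 : 𝔼)‖ ≤ ρ) (h1' : ‖(pc r j'.1 : 𝔼)‖ ≤ ρ) (h2' : ‖(pc r j'.2 : 𝔼)‖ ≤ ρ) :
    ‖P.B (pc r j'.1 - pc r j.1) (pc r j'.2 - pc r j.1)‖ ≤
      (1 + ‖P.B‖ * (2 * Fintype.card ι) * (4 * ρ + 2 * Fintype.card ι)) / r := by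
  have hρ : 0 ≤ ρ := (norm_nonneg _).trans h1
  have hr0 : 0 < r := by linarith
  obtain ⟨z, e1, -, e3, e4, e5⟩ := h
  have n1 := norm_sub_pc_le hr0 e1
  have n3 := norm_sub_pc_le hr0 e3
  have n4 := norm_sub_pc_le hr0 e4
  rw [dQ_eq] at e5
  set u := z.2.2 - z.2.1
  set v := z.1 - z.2.2 - z.2.1
  set u' : 𝔼 := pc r j'.1 - pc r j.1
  set v' : 𝔼 := pc r j'.2 - pc r j.1
  set D : ℝ := (Fintype.card ι : ℝ)
  have hD : (0 : ℝ) ≤ D := Nat.cast_nonneg _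
  have hu : ‖u' - u‖ ≤ 2 * D / r := by
    calc ‖u' - u‖ = ‖(z.2.1 - pc r j.1) - (z.2.2 - pc r j'.1)‖ := by
          congr 1; simp only [u, u']; abel
      _ ≤ _ := (norm_sub_le _ _).trans (by rw [two_mul, add_div]; exact add_le_add n1 n3)
  have hv : ‖v' - v‖ ≤ 2 * D / r := by
    calc ‖v' - v‖ = ‖(z.2.1 - pc r j.1) - (z.1 - z.2.2 - pc r j'.2)‖ := by
          congr 1; simp only [v, v']; abel
      _ ≤ _ := (norm_sub_le _ _).trans (by rw [two_mul, add_div]; exact add_le_add n1 n4)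
  have hu' : ‖u'‖ ≤ 2 * ρ := (norm_sub_le _ _).trans (by linarith)
  have hv' : ‖v'‖ ≤ 2 * ρ := (norm_sub_le _ _).trans (by linarith)
  have hDr : 2 * D / r ≤ 2 * D := div_le_self (by positivity) hr
  have hvn : ‖v‖ ≤ 2 * ρ + 2 * D := by
    have := norm_add_le v' (v - v')
    rw [add_sub_cancel, norm_sub_rev v v'] at this
    linarith
  have e : P.B u' v' = P.B u v + P.B (u' - u) v + P.B u' (v' - v) := by
    simp only [map_sub, _root_.sub_apply]; ring
  have b1 : ‖P.B (u' - u) v‖ ≤ ‖P.B‖ * (2 * D / r) * (2 * ρ + 2 * D) :=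
    (P.B.le_opNorm₂ _ _).trans (by gcongr)
  have b2 : ‖P.B u' (v' - v)‖ ≤ ‖P.B‖ * (2 * ρ) * (2 * D / r) :=
    (P.B.le_opNorm₂ _ _).trans (by gcongr)
  rw [e]
  refine (norm_add₃_le).trans ((add_le_add (add_le_add e5 b1) b2).trans (le_of_eq ?_))
  field_simp
  ring

end QuadPhase

/-- A weighted Schur test for symmetric quadruple sums. -/
lemma sum_quad_le {X Y : Type*} (K : Finset X) (L : Finset Y) (res : X × Y → X × Y → Prop)
    [∀ j j', Decidable (res j j')] (hsymm : ∀ j j', res j j' → res j' j) (p μ : X → ℝ≥0∞)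
    (s : Y → ℝ≥0∞) (hμ0 : ∀ k ∈ K, μ k ≠ 0) (hμ : ∀ k ∈ K, μ k ≠ ∞) (cnt : ℕ)
    (hcnt : ∀ k ∈ K, ∀ k' ∈ K, ∀ l' ∈ L, (L.filter fun l => res (k, l) (k', l')).card ≤ cnt)
    (π : X → Y → X → Prop) [∀ k l k', Decidable (π k l k')]
    (hπ : ∀ k ∈ K, ∀ k' ∈ K, ∀ l ∈ L, ∀ l' ∈ L, res (k, l) (k', l') → π k l' k') :
    ∑ j ∈ K ×ˢ L, ∑ j' ∈ K ×ˢ L with res j j', p j.1 * s j.2 * (p j'.1 * s j'.2) ≤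
      2 * cnt * ∑ k ∈ K, ∑ l' ∈ L, p k ^ 2 * s l' ^ 2 * (μ k)⁻¹ *
        ∑ k' ∈ K with π k l' k', μ k' := by
  have amgm : ∀ x y a b : ℝ≥0∞, a ≠ 0 → a ≠ ∞ → b ≠ 0 → b ≠ ∞ →
      x * y ≤ x ^ 2 * (b * a⁻¹) + y ^ 2 * (a * b⁻¹) := by
    intro x y a b ha ha' hb hb'
    rcases le_total (x * b) (y * a) with h | h
    · calc x * y = x * y * (b * b⁻¹) := by rw [ENNReal.mul_inv_cancel hb hb', mul_one]
        _ = (x * b) * y * b⁻¹ := by ring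
        _ ≤ (y * a) * y * b⁻¹ := by gcongr
        _ = y ^ 2 * (a * b⁻¹) := by ring
        _ ≤ _ := le_add_self
    · calc x * y = x * y * (a * a⁻¹) := by rw [ENNReal.mul_inv_cancel ha ha', mul_one]
        _ = (y * a) * x * a⁻¹ := by ring
        _ ≤ (x * b) * x * a⁻¹ := by gcongr
        _ = x ^ 2 * (b * a⁻¹) := by ring
        _ ≤ _ := le_self_add
  set F : X × Y → X × Y → ℝ≥0∞ := fun j j' => p j.1 ^ 2 * s j'.2 ^ 2 * (μ j'.1 * (μ j.1)⁻¹) with hF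
  have hsw : ∑ j ∈ K ×ˢ L, ∑ j' ∈ K ×ˢ L with res j j', F j' j =
      ∑ j ∈ K ×ˢ L, ∑ j' ∈ K ×ˢ L with res j j', F j j' := by
    simp only [Finset.sum_filter]
    rw [Finset.sum_comm]
    refine Finset.sum_congr rfl fun j _ => Finset.sum_congr rfl fun j' _ => ?_
    by_cases h : res j j'
    · rw [if_pos h, if_pos (hsymm _ _ h)]
    · rw [if_neg h, if_neg fun h' => h (hsymm _ _ h')]
  calc ∑ j ∈ K ×ˢ L, ∑ j' ∈ K ×ˢ L with res j j', p j.1 * s j.2 * (p j'.1 * s j'.2)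
      ≤ ∑ j ∈ K ×ˢ L, ∑ j' ∈ K ×ˢ L with res j j', (F j j' + F j' j) := by
        refine Finset.sum_le_sum fun j hj => Finset.sum_le_sum fun j' hj' => ?_
        rw [Finset.mem_filter] at hj'
        have m := (Finset.mem_product.1 hj).1
        have m' := (Finset.mem_product.1 hj'.1).1
        have := amgm (p j.1 * s j'.2) (p j'.1 * s j.2) (μ j.1) (μ j'.1) (hμ0 _ m) (hμ _ m)
          (hμ0 _ m') (hμ _ m')
        calc _ = p j.1 * s j'.2 * (p j'.1 * s j.2) := by ring
          _ ≤ _ := this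
          _ = _ := by simp only [hF, mul_pow]
    _ = 2 * ∑ j ∈ K ×ˢ L, ∑ j' ∈ K ×ˢ L with res j j', F j j' := by
        simp only [Finset.sum_add_distrib]
        rw [hsw, two_mul]
    _ = 2 * ∑ k ∈ K, ∑ l' ∈ L, ∑ k' ∈ K, ∑ l ∈ L with res (k, l) (k', l'),
          p k ^ 2 * s l' ^ 2 * (μ k' * (μ k)⁻¹) := by
        simp only [Finset.sum_filter]
        simp only [Finset.sum_product, hF]
        congr 1
        refine Finset.sum_congr rfl fun k _ => ?_
        rw [Finset.sum_comm]
        rw [Finset.sum_comm (s := L) (t := K)]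
        refine Finset.sum_congr rfl fun k' _ => ?_
        rw [Finset.sum_comm]
    _ ≤ 2 * ∑ k ∈ K, ∑ l' ∈ L, ∑ k' ∈ K with π k l' k',
          (cnt : ℝ≥0∞) * (p k ^ 2 * s l' ^ 2 * (μ k' * (μ k)⁻¹)) := by
        gcongr with k hk l' hl'
        rw [Finset.sum_filter]
        refine Finset.sum_le_sum fun k' hk' => ?_
        split_ifs with h
        · rw [Finset.sum_const, nsmul_eq_mul]
          gcongr
          exact hcnt k hk k' hk' l' hl'
        · refine le_of_eq (Finset.sum_eq_zero fun l hl => ?_)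
          rw [Finset.mem_filter] at hl
          exact absurd (hπ k hk k' hk' l hl.1 l' hl' hl.2) h
    _ = _ := by
        simp only [← Finset.mul_sum]
        rw [← mul_assoc]
        congr 1
        refine Finset.sum_congr rfl fun k _ => Finset.sum_congr rfl fun l' _ => ?_
        rw [mul_assoc (p k ^ 2 * s l' ^ 2), ← Finset.sum_mul, mul_comm (∑ _ ∈ _, _)]

lemma sum_lintegral_le {α J : Type*} [MeasurableSpace α] {μ : Measure α} (S : Finset J)
    (f : J → α → ℝ≥0∞) : ∑ j ∈ S, ∫⁻ x, f j x ∂μ ≤ ∫⁻ x, ∑ j ∈ S, f j x ∂μ := by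
  classical
  induction S using Finset.induction_on with
  | empty => simp
  | insert a s ha ih =>
    simp only [Finset.sum_insert ha]
    exact (add_le_add le_rfl ih).trans (le_lintegral_add _ _)

lemma wt_le_inv_pow {E : Type*} [NormedAddCommGroup E] (N : ℕ) {x : E} {a : ℝ} (ha : 0 < a)
    (h : a ≤ ‖x‖) : wt N x ≤ (a ^ N)⁻¹ := by
  unfold wt
  gcongr
  linarith

namespace QuadPhase
open scoped FourierTransform ComplexConjugate
open Real

variable {ι : Type*} [Fintype ι] (P : QuadPhase ι)

local notation "𝔼" => EuclideanSpace ℝ ι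

/-- The packets `k'` which can interact with the pair `(k, l')`. -/
def Near (c r : ℝ) (k l' k' : ι → ℤ) : Prop :=
  ‖P.B (pc r k' - pc r k) (pc r l' - pc r k)‖ ≤ c / r

open Classical in
/-- The localized square function estimate for products of wave packet sums. -/
lemma exists_bilinear_sq_bound (ρ : ℝ) (N : ℕ) : ∃ (c : ℝ) (C : NNReal), 0 ≤ c ∧
    ∀ (r h : ℝ), 1 ≤ r → 0 < h → ∀ (t₀ : ℂ) (K L : Finset (ι → ℤ)) (α β : (ι → ℤ) → 𝔼 → ℂ),
    (∀ k ∈ K, Nice (α k) ∧ E2 (α k) ≤ 1 ∧ (∀ ξ, α k ξ ≠ 0 → packet r k ξ ≠ 0) ∧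
      ‖(pc r k : 𝔼)‖ ≤ ρ) →
    (∀ k ∈ L, Nice (β k) ∧ E2 (β k) ≤ 1 ∧ (∀ ξ, β k ξ ≠ 0 → packet r k ξ ≠ 0) ∧
      ‖(pc r k : 𝔼)‖ ≤ ρ) →
    ∀ μ : (ι → ℤ) → 𝔼 → ℂ → ℝ≥0∞, (∀ k x t, μ k x t ≠ 0) → (∀ k x t, μ k x t ≠ ∞) →
    ∫⁻ t : ℂ, ‖tcut t₀ h t‖ₑ * ∫⁻ x, ‖(∑ k ∈ K, P.ext (α k) x t) * ∑ l ∈ L, P.ext (β l) x t‖ₑ ^ 2 ≤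
      C * (∫⁻ t : ℂ, ‖tcut t₀ h t‖ₑ * ∫⁻ x, ∑ k ∈ K, ∑ l' ∈ L,
        ‖P.ext (α k) x t‖ₑ ^ 2 * ‖P.ext (β l') x t‖ₑ ^ 2 * (μ k x t)⁻¹ *
          ∑ k' ∈ K with P.Near c r k l' k', μ k' x t) +
      C * ((K.card : ℝ≥0∞) * L.card) ^ 2 * ENNReal.ofReal (h ^ 2 * (r / h) ^ N) := by
  obtain ⟨Cχ, hCχ, Hχ⟩ := exists_tcut_decay N
  set ρ' : ℝ := max ρ 0 with hρ'
  set d : ℝ := (Fintype.card ι : ℝ) with hd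
  set c : ℝ := 1 + ‖P.B‖ * (2 * d) * (4 * ρ' + 2 * d) with hc
  set V : NNReal := (volume (Metric.closedBall (0 : 𝔼) (ρ + d)) + 1).toNNReal with hV
  have hVe : (V : ℝ≥0∞) = volume (Metric.closedBall (0 : 𝔼) (ρ + d)) + 1 := by
    rw [hV, ENNReal.coe_toNNReal]
    exact (ENNReal.add_lt_top.2 ⟨measure_closedBall_lt_top, one_lt_top⟩).ne
  set cnt : ℕ := (8 * Fintype.card ι + 1) ^ Fintype.card ι
  refine ⟨c, 2 * cnt + Cχ.toNNReal * (V * V * 2), by positivity, ?_⟩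
  intro r h hr hh t₀ K L α β hα hβ μ hμ0 hμt
  have hr0 : 0 < r := by linarith
  have hL1 : ∀ (S : Finset (ι → ℤ)) (γ : (ι → ℤ) → 𝔼 → ℂ), (∀ k ∈ S, Nice (γ k) ∧ E2 (γ k) ≤ 1 ∧
      (∀ ξ, γ k ξ ≠ 0 → packet r k ξ ≠ 0) ∧ ‖(pc r k : 𝔼)‖ ≤ ρ) →
      ∀ k ∈ S, ∫⁻ ξ, ‖γ k ξ‖ₑ ≤ V := by
    intro S γ hγ k hk
    obtain ⟨h1, h2, h3, h4⟩ := hγ k hk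
    calc ∫⁻ x, ‖γ k x‖ₑ
        ≤ ∫⁻ x, ((Metric.closedBall (0 : 𝔼) (ρ + d)).indicator 1 x + ‖γ k x‖ₑ ^ 2) := by
          refine lintegral_mono fun x => ?_
          by_cases hx : γ k x = 0
          · simp [hx]
          · rw [Set.indicator_of_mem]
            · exact le_one_add_sq _
            · rw [mem_closedBall_zero_iff]
              have e1 := norm_sub_pc_le hr0 (h3 x hx)
              have e2 : d / r ≤ d := div_le_self (by positivity) hr
              have e3 := norm_sub_norm_le x (pc r k)
              linarith
      _ = volume (Metric.closedBall (0 : 𝔼) (ρ + d)) + E2 (γ k) := by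
          rw [lintegral_add_left (measurable_one.indicator measurableSet_closedBall),
            lintegral_indicator_one measurableSet_closedBall, E2]
      _ ≤ V := by rw [hVe]; gcongr
  set ε : ℝ≥0∞ := ENNReal.ofReal (Cχ * h ^ 2 * (r / h) ^ N) with hε
  have main := P.lintegral_sq_sum_le (K ×ˢ L) (fun j => α j.1) (fun j => β j.2)
    (fun j hj => (hα _ (Finset.mem_product.1 hj).1).1)
    (fun j hj => (hβ _ (Finset.mem_product.1 hj).2).1) (integrable_tcut t₀ hh) (tcut_nonneg t₀ h)
    (P.Res r) (ε * (V * V * 2)) (by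
      intro j hj j' hj' hres
      have mj := Finset.mem_product.1 hj
      have mj' := Finset.mem_product.1 hj'
      refine (P.enorm_chi_quadrilinear_le (integrable_tcut t₀ hh) (hα _ mj.1).1 (hβ _ mj.2).1
        (hα _ mj'.1).1 (hβ _ mj'.2).1 ε fun z hz => ?_).trans ?_
      · have hz' : 1 / r < ‖P.dQ z‖ := by
          by_contra! hle
          have hz1 := hz
          simp only [quadAmp, ne_eq, mul_eq_zero, map_eq_zero, not_or] at hz1
          exact hres ⟨z, (hα _ mj.1).2.2.1 _ hz1.1.1, (hβ _ mj.2).2.2.1 _ hz1.1.2,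
            (hα _ mj'.1).2.2.1 _ hz1.2.1, (hβ _ mj'.2).2.2.1 _ hz1.2.2, hle⟩
        rw [hε, ← ofReal_norm]
        refine ENNReal.ofReal_le_ofReal ((Hχ t₀ h hh _).trans ?_)
        gcongr
        refine (wt_le_inv_pow N (a := h / r) (by positivity) ?_).trans (le_of_eq ?_)
        · rw [norm_smul, Real.norm_of_nonneg hh.le, div_eq_mul_one_div]
          gcongr
        · rw [← inv_pow, inv_div]
      · gcongr
        · exact hL1 K α hα _ mj.1
        · exact hL1 L β hβ _ mj.2
        · calc _ ≤ (1 : ℝ≥0∞) + 1 := add_le_add (hα _ mj'.1).2.1 (hβ _ mj'.2).2.1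
            _ = 2 := by norm_num)
  have e1 : ∀ x t, (∑ k ∈ K, P.ext (α k) x t) * ∑ l ∈ L, P.ext (β l) x t =
      ∑ j ∈ K ×ˢ L, P.ext (α j.1) x t * P.ext (β j.2) x t := by
    intro x t
    rw [Finset.sum_mul_sum, Finset.sum_product]
  simp only [e1]
  refine main.trans (add_le_add ?_ (le_of_eq_of_le ?_ (?_ : (Cχ.toNNReal : ℝ≥0∞) * (V * V * 2) *
    ((K.card : ℝ≥0∞) * L.card) ^ 2 * ENNReal.ofReal (h ^ 2 * (r / h) ^ N) ≤ _)))
  · calc _ ≤ ∫⁻ t : ℂ, ∑ j ∈ K ×ˢ L, ∑ j' ∈ K ×ˢ L with P.Res r j j', ‖tcut t₀ h t‖ₑ *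
        ∫⁻ x, ‖P.ext (α j.1) x t‖ₑ * ‖P.ext (β j.2) x t‖ₑ *
        (‖P.ext (α j'.1) x t‖ₑ * ‖P.ext (β j'.2) x t‖ₑ) :=
          (Finset.sum_le_sum fun j _ => sum_lintegral_le _ _).trans (sum_lintegral_le _ _)
      _ ≤ ∫⁻ t : ℂ, ‖tcut t₀ h t‖ₑ * ∫⁻ x, ∑ j ∈ K ×ˢ L, ∑ j' ∈ K ×ˢ L with P.Res r j j',
        ‖P.ext (α j.1) x t‖ₑ * ‖P.ext (β j.2) x t‖ₑ *
        (‖P.ext (α j'.1) x t‖ₑ * ‖P.ext (β j'.2) x t‖ₑ) := by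
          refine lintegral_mono fun t => ?_
          refine le_trans (le_of_eq ?_) (mul_le_mul_right
            ((Finset.sum_le_sum fun j _ => sum_lintegral_le _ _).trans (sum_lintegral_le _ _)) _)
          rw [Finset.mul_sum]
          exact Finset.sum_congr rfl fun j _ => by rw [Finset.mul_sum]
      _ ≤ ∫⁻ t : ℂ, ‖tcut t₀ h t‖ₑ * ∫⁻ x, (2 * cnt : ℝ≥0∞) * ∑ k ∈ K, ∑ l' ∈ L,
          ‖P.ext (α k) x t‖ₑ ^ 2 * ‖P.ext (β l') x t‖ₑ ^ 2 * (μ k x t)⁻¹ *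
          ∑ k' ∈ K with P.Near c r k l' k', μ k' x t := by
          gcongr with t x
          refine sum_quad_le K L (P.Res r) (fun j j' h => h.symm P) (fun k => ‖P.ext (α k) x t‖ₑ)
            (fun k => μ k x t) (fun l => ‖P.ext (β l) x t‖ₑ) (fun k _ => hμ0 k x t)
            (fun k _ => hμt k x t) cnt (fun k _ k' _ l' _ => P.card_res_le L k k' l')
            (fun k l' k' => P.Near c r k l' k') fun k hk k' hk' l hl l' hl' hres => ?_
          exact hres.norm_B_le P hr ((hα k hk).2.2.2.trans (le_max_left _ _))
            ((hα k' hk').2.2.2.trans (le_max_left _ _)) ((hβ l' hl').2.2.2.trans (le_max_left _ _))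
      _ = (2 * cnt : ℝ≥0∞) * ∫⁻ t : ℂ, ‖tcut t₀ h t‖ₑ * ∫⁻ x, ∑ k ∈ K, ∑ l' ∈ L,
          ‖P.ext (α k) x t‖ₑ ^ 2 * ‖P.ext (β l') x t‖ₑ ^ 2 * (μ k x t)⁻¹ *
          ∑ k' ∈ K with P.Near c r k l' k', μ k' x t := by
          rw [← lintegral_const_mul' _ _ (by finiteness)]
          refine lintegral_congr fun t => ?_
          rw [lintegral_const_mul' _ _ (by finiteness)]
          ring
      _ ≤ _ := by
          gcongr
          push_cast
          exact le_self_add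
  · rw [hε, Finset.card_product, mul_assoc Cχ, ENNReal.ofReal_mul hCχ]
    push_cast
    rw [ENNReal.ofReal]
    ring
  · gcongr
    push_cast
    exact le_add_self

end QuadPhase

section LatticeSum
variable {ι : Type*} [Fintype ι]

lemma sum_int_sq_le (M : ℕ) : ∑ a ∈ Finset.Icc (-(M : ℤ)) M, ((1 + |(a : ℝ)|) ^ 2)⁻¹ ≤ 4 := by
  have h1 : ∀ M : ℕ, ∑ a ∈ Finset.Icc (-(M : ℤ)) M, ((1 + |(a : ℝ)|) ^ 2)⁻¹ ≤
      (4 : ℝ) - 2 / (1 + (M : ℝ)) := by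
    intro M
    induction M with
    | zero => norm_num
    | succ M ih =>
      have e : Finset.Icc (-((M + 1 : ℕ) : ℤ)) ((M + 1 : ℕ) : ℤ) =
          insert (-((M : ℤ) + 1)) (insert ((M : ℤ) + 1) (Finset.Icc (-(M : ℤ)) M)) := by
        ext a; simp only [Finset.mem_insert, Finset.mem_Icc]; push_cast; omega
      rw [e, Finset.sum_insert, Finset.sum_insert]
      · have ha : |(((M : ℤ) + 1 : ℤ) : ℝ)| = M + 1 := by
          push_cast; exact abs_of_nonneg (by positivity)
        have hb : |((-((M : ℤ) + 1) : ℤ) : ℝ)| = M + 1 := by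
          push_cast; rw [abs_neg]; exact abs_of_nonneg (by positivity)
        rw [ha, hb]
        have : 2 * ((1 + ((M : ℝ) + 1)) ^ 2)⁻¹ ≤ 2 / (1 + (M : ℝ)) - 2 / (1 + ((M : ℝ) + 1)) := by
          rw [div_sub_div _ _ (by positivity) (by positivity), ← div_eq_mul_inv,
            div_le_div_iff₀ (by positivity) (by positivity)]
          nlinarith [(Nat.cast_nonneg M : (0 : ℝ) ≤ M)]
        push_cast
        linarith
      · simp
      · simp only [Finset.mem_insert, Finset.mem_Icc]; omega
  exact (h1 M).trans (by linarith [show (0 : ℝ) ≤ 2 / (1 + (M : ℝ)) by positivity])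

/-- The decaying weight is summable over the lattice. -/
lemma sum_wt_lat_le (K : Finset (ι → ℤ)) :
    ∑ k ∈ K, wt (2 * Fintype.card ι) (lat k : EuclideanSpace ℝ ι) ≤ 4 ^ Fintype.card ι := by
  classical
  set M : ℕ := ∑ k ∈ K, ∑ i, (k i).natAbs with hM
  have hsub : K ⊆ latBox ι M := by
    intro k hk
    simp only [latBox, Fintype.mem_piFinset, Finset.mem_Icc]
    intro i
    have h1 : (k i).natAbs ≤ ∑ i, (k i).natAbs :=
      Finset.single_le_sum (f := fun i => (k i).natAbs) (fun _ _ => Nat.zero_le _)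
        (Finset.mem_univ i)
    have h2 : ∑ i, (k i).natAbs ≤ M :=
      Finset.single_le_sum (f := fun k : ι → ℤ => ∑ i, (k i).natAbs) (fun _ _ => Nat.zero_le _) hk
    omega
  have hpt : ∀ k : ι → ℤ, wt (2 * Fintype.card ι) (lat k : EuclideanSpace ℝ ι) ≤
      ∏ i, ((1 + |(k i : ℝ)|) ^ 2)⁻¹ := by
    intro k
    unfold wt
    rw [pow_mul, Finset.prod_inv_distrib]
    refine inv_anti₀ (Finset.prod_pos fun i _ => by positivity) ?_
    rw [← Finset.card_univ, ← Finset.prod_const]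
    refine Finset.prod_le_prod (fun i _ => by positivity) fun i _ => ?_
    have := PiLp.norm_apply_le (lat k : EuclideanSpace ℝ ι) i
    rw [lat_apply, Real.norm_eq_abs] at this
    gcongr
  calc _ ≤ ∑ k ∈ latBox ι M, ∏ i, ((1 + |(k i : ℝ)|) ^ 2)⁻¹ :=
        (Finset.sum_le_sum fun k _ => hpt k).trans (Finset.sum_le_sum_of_subset_of_nonneg hsub
          fun k _ _ => Finset.prod_nonneg fun i _ => by positivity)
    _ = ∏ _i : ι, ∑ a ∈ Finset.Icc (-(M : ℤ)) M, ((1 + |(a : ℝ)|) ^ 2)⁻¹ := by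
        rw [latBox, Finset.prod_univ_sum]
    _ ≤ ∏ _i : ι, (4 : ℝ) := Finset.prod_le_prod
        (fun i _ => Finset.sum_nonneg fun a _ => by positivity) fun i _ => sum_int_sq_le M
    _ = _ := by simp

end LatticeSum

namespace QuadPhase
variable {ι : Type*} [Fintype ι] (P : QuadPhase ι)

local notation "𝔼" => EuclideanSpace ℝ ι

lemma measurable_ext_swap {f : 𝔼 → ℂ} (hf : Measurable f) :
    Measurable fun w : ℂ × 𝔼 => P.ext f w.2 w.1 := by
  have h1 := P.measurable_ext hf
  have h2 : Measurable fun w : ℂ × 𝔼 => (w.2, w.1) := measurable_snd.prodMk measurable_fst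
  have h3 := h1.comp h2
  exact h3

/-- Tubes through a common region with separated directions overlap boundedly at distance
`≥ h`. -/
lemma exists_sum_wt_tube_le : ∃ C : ℝ, 0 ≤ C ∧ ∀ (r h : ℝ), 0 < r → 0 < h → h ≤ r ^ 2 →
    ∀ (K : Finset (ι → ℤ)) (z : 𝔼) (τ : ℂ), h ≤ ‖τ‖ →
    ∑ k ∈ K, wt (2 * Fintype.card ι) (r⁻¹ • (z + P.A τ (pc r k))) ≤
      C * (r ^ 2 / h) ^ (2 * Fintype.card ι) := by
  set D := 2 * Fintype.card ι
  have hc := P.c_pos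
  refine ⟨(1 + 2 / P.c) ^ D * 4 ^ Fintype.card ι, by positivity,
    fun r h hr hh hhr K z τ hτ => ?_⟩
  rcases K.eq_empty_or_nonempty with rfl | hK
  · simp; positivity
  set v : (ι → ℤ) → 𝔼 := fun k => r⁻¹ • (z + P.A τ (pc r k)) with hv
  obtain ⟨k0, hk0, hmin⟩ := K.exists_min_image (fun k => ‖v k‖) hK
  have hle : ∀ k ∈ K, wt D (v k) ≤
      ((1 + 2 / P.c) * (r ^ 2 / h)) ^ D * wt D (lat (k - k0) : 𝔼) := by
    intro k hk
    refine wt_le_of_norm_le D ?_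
    have h1 : P.c * (h / r ^ 2) * ‖(lat (k - k0) : 𝔼)‖ ≤ ‖v k - v k0‖ := by
      have e : v k - v k0 = (r⁻¹ ^ 2 : ℝ) • P.A τ (lat (k - k0)) := by
        have : (lat (k - k0) : 𝔼) = lat k - lat k0 := by ext i; simp
        rw [this, hv]
        simp only [pc, map_smul, map_sub, smul_add, smul_smul, smul_sub]
        rw [← sq]; abel
      rw [e, norm_smul, Real.norm_of_nonneg (by positivity)]
      have := P.lower τ (lat (k - k0) : 𝔼)
      calc _ ≤ P.c * (‖τ‖ / r ^ 2) * ‖(lat (k - k0) : 𝔼)‖ := by gcongr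
        _ = r⁻¹ ^ 2 * (P.c * ‖τ‖ * ‖(lat (k - k0) : 𝔼)‖) := by field_simp
        _ ≤ _ := by gcongr
    have h2 : ‖v k - v k0‖ ≤ 2 * ‖v k‖ := by
      have := norm_sub_le (v k) (v k0)
      linarith [hmin k hk]
    have h3 : ‖(lat (k - k0) : 𝔼)‖ ≤ (2 / P.c) * (r ^ 2 / h) * ‖v k‖ := by
      have := h1.trans h2
      rw [← le_div_iff₀' (by positivity)] at this
      refine this.trans (le_of_eq ?_)
      field_simp
    have h4 : 1 ≤ r ^ 2 / h := (one_le_div hh).2 hhr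
    have h5 : 0 ≤ 2 / P.c := by positivity
    have h6 : 0 ≤ 2 / P.c * (r ^ 2 / h) := by positivity
    nlinarith [norm_nonneg (v k), mul_nonneg (zero_le_one.trans h4) (norm_nonneg (v k))]
  calc ∑ k ∈ K, wt D (v k)
      ≤ ∑ k ∈ K, ((1 + 2 / P.c) * (r ^ 2 / h)) ^ D * wt D (lat (k - k0) : 𝔼) :=
        Finset.sum_le_sum hle
    _ = ((1 + 2 / P.c) * (r ^ 2 / h)) ^ D * ∑ k ∈ K, wt D (lat (k - k0) : 𝔼) := by
        rw [Finset.mul_sum]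
    _ ≤ ((1 + 2 / P.c) * (r ^ 2 / h)) ^ D * 4 ^ Fintype.card ι := by
        gcongr
        classical
        have := sum_wt_lat_le (K.image fun k => k - k0)
        rwa [Finset.sum_image (fun a _ b _ hab => sub_left_injective hab)] at this
    _ = _ := by rw [mul_pow]; ring

/-- The density of the wave packet piece of `g` at frequency `l`. -/
def piece (r : ℝ) (g : 𝔼 → ℂ) (l : ι → ℤ) (ξ : 𝔼) : ℂ := packet r l ξ * (packet r l ξ * g ξ)

lemma memLp_packet_mul {r : ℝ} (l : ι → ℤ) {g : 𝔼 → ℂ} (hg : MemLp g 2 volume) :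
    MemLp (fun ξ => (packet r l ξ : ℂ) * g ξ) 2 volume := by
  refine MemLp.of_le hg ?_ (Filter.Eventually.of_forall fun ξ => ?_)
  · exact (Complex.continuous_ofReal.comp (continuous_packet r l)).aestronglyMeasurable.mul hg.1
  · rw [norm_mul, Complex.norm_real, Real.norm_eq_abs]
    exact mul_le_of_le_one_left (norm_nonneg _) (abs_packet_le r l ξ)

lemma nice_packet_mul {r : ℝ} (l : ι → ℤ) {g : 𝔼 → ℂ} (hg : Nice g) :
    Nice (fun ξ => (packet r l ξ : ℂ) * g ξ) := by
  have hm : Measurable fun ξ => (packet r l ξ : ℂ) * g ξ :=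
    (Complex.continuous_ofReal.comp (continuous_packet r l)).measurable.mul hg.meas
  refine ⟨hm, ?_, memLp_packet_mul l hg.mem⟩
  refine hg.int.mono hm.aestronglyMeasurable (Filter.Eventually.of_forall fun ξ => ?_)
  rw [norm_mul, Complex.norm_real, Real.norm_eq_abs]
  exact mul_le_of_le_one_left (norm_nonneg _) (abs_packet_le r l ξ)

lemma nice_piece {r : ℝ} (l : ι → ℤ) {g : 𝔼 → ℂ} (hg : Nice g) : Nice (piece r g l) :=
  nice_packet_mul l (nice_packet_mul l hg)

/-- The packets of `g` share its mass. -/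
lemma sum_E2_packet_le (r : ℝ) (L : Finset (ι → ℤ)) (g : 𝔼 → ℂ) :
    ∑ l ∈ L, E2 (fun ξ => (packet r l ξ : ℂ) * g ξ) ≤ E2 g := by
  unfold E2
  refine (sum_lintegral_le _ _).trans (lintegral_mono fun ξ => ?_)
  have e : ∀ l, ‖(packet r l ξ : ℂ) * g ξ‖ₑ ^ 2 =
      ENNReal.ofReal (packet r l ξ ^ 2) * ‖g ξ‖ₑ ^ 2 := by
    intro l
    rw [enorm_mul, mul_pow, ← ofReal_norm, Complex.norm_real, ← ENNReal.ofReal_pow (norm_nonneg _),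
      Real.norm_eq_abs, sq_abs]
  simp only [e]
  rw [← Finset.sum_mul, ← ENNReal.ofReal_sum_of_nonneg fun l _ => sq_nonneg _]
  refine mul_le_of_le_one_left' ?_
  rw [← ENNReal.ofReal_one]
  exact ENNReal.ofReal_le_ofReal (sum_packet_le L r ξ)

lemma E2_l2FourierInv {h : 𝔼 → ℂ} (hh : MemLp h 2 volume) : E2 (l2FourierInv h) = E2 h := by
  have e : ∀ F : 𝔼 → ℂ, (eLpNorm F 2 volume) ^ 2 = E2 F := by
    intro F
    have := eLpNorm_nnreal_pow_eq_lintegral (f := F) (μ := volume) (p := 2) (by norm_num)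
    simp only [NNReal.coe_ofNat, ENNReal.coe_ofNat] at this
    have h2 : ∀ x : ℝ≥0∞, x ^ (2 : ℝ) = x ^ 2 := fun x => by
      rw [← ENNReal.rpow_natCast]; norm_num
    simp only [h2] at this
    exact this
  rw [← e, ← e, eLpNorm_l2FourierInv hh]

lemma E2_l2Fourier {h : 𝔼 → ℂ} (hh : MemLp h 2 volume) : E2 (l2Fourier h) = E2 h := by
  have e : ∀ F : 𝔼 → ℂ, (eLpNorm F 2 volume) ^ 2 = E2 F := by
    intro F
    have := eLpNorm_nnreal_pow_eq_lintegral (f := F) (μ := volume) (p := 2) (by norm_num)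
    simp only [NNReal.coe_ofNat, ENNReal.coe_ofNat] at this
    have h2 : ∀ x : ℝ≥0∞, x ^ (2 : ℝ) = x ^ 2 := fun x => by
      rw [← ENNReal.rpow_natCast]; norm_num
    simp only [h2] at this
    exact this
  rw [← e, ← e, eLpNorm_l2Fourier hh]

/-- The weight of a tube dominates the weight of a strip at its footpoint. -/
lemma wt_mul_strip_le {r ρ : ℝ} (a b v₀ δ : 𝔼) (hδ : ‖δ‖ ≤ ρ) (t : ℂ) (x y : 𝔼) :
    wt (Fintype.card ι + 4) (r⁻¹ • (x - y + P.A t b)) * wt 3 (r⁻¹ • P.H (x - v₀ + P.A t a) δ) ≤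
      (1 + ‖P.H‖ * ρ) ^ 3 * wt (Fintype.card ι + 1) (r⁻¹ • (x - (y - P.A t b))) *
        wt 3 (r⁻¹ • (P.H (y - v₀) δ + t * starRingEnd ℂ (P.B (a - b) δ))) := by
  have hρ : 0 ≤ ρ := (norm_nonneg _).trans hδ
  set CH : ℝ := (1 + ‖P.H‖ * ρ) ^ 3 with hCH
  have hCH0 : 0 ≤ CH := by positivity
  set v := r⁻¹ • (x - y + P.A t b) with hv
  have ev : r⁻¹ • (x - (y - P.A t b)) = v := by rw [hv]; congr 1; abel
  have ew : r⁻¹ • (P.H (y - v₀) δ + t * starRingEnd ℂ (P.B (a - b) δ)) =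
      r⁻¹ • P.H (x - v₀ + P.A t a) δ + -P.H v δ := by
    rw [← P.H_A, ← _root_.add_apply, ← map_add, hv, map_smul, _root_.smul_apply, ← sub_eq_add_neg,
      ← smul_sub, ← _root_.sub_apply, ← map_sub]
    congr 3
    rw [map_sub]; abel
  have h1 : wt 3 v ≤ CH * wt 3 (P.H v δ) := by
    refine wt_le_of_norm_le 3 ?_
    have : ‖P.H v δ‖ ≤ ‖P.H‖ * ‖v‖ * ρ := (P.H.le_opNorm₂ _ _).trans (by gcongr)
    have h0 : 0 ≤ ‖P.H‖ * ρ := by positivity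
    nlinarith [norm_nonneg v]
  rw [ev, ew, show Fintype.card ι + 4 = (Fintype.card ι + 1) + 3 from rfl, wt_add]
  calc wt (Fintype.card ι + 1) v * wt 3 v * wt 3 (r⁻¹ • P.H (x - v₀ + P.A t a) δ)
      ≤ wt (Fintype.card ι + 1) v * (CH * wt 3 (P.H v δ)) *
          wt 3 (r⁻¹ • P.H (x - v₀ + P.A t a) δ) := by
        gcongr
        · exact wt_nonneg _ _
        · exact wt_nonneg _ _
    _ = CH * wt (Fintype.card ι + 1) v * (wt 3 (r⁻¹ • P.H (x - v₀ + P.A t a) δ) *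
          wt 3 (-P.H v δ)) := by rw [wt_neg]; ring
    _ ≤ _ := by
        gcongr
        · exact mul_nonneg hCH0 (wt_nonneg _ _)
        · exact wt_mul_wt_le _ _ _

lemma lintegral_strip_time_le {c₀ r : ℝ} (hc₀ : 0 < c₀) (hr : 0 < r) (u b : ℂ) (hbn : c₀ ≤ ‖b‖) :
    ∫⁻ t : ℂ, ENNReal.ofReal (wt 3 (r⁻¹ • (u + t * b))) ≤
      ENNReal.ofReal c₀⁻¹ ^ 2 * (∫⁻ x : ℂ, ENNReal.ofReal (wt 3 x)) * ENNReal.ofReal r ^ 2 := by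
  have hb1 : b ≠ 0 := norm_pos_iff.1 (hc₀.trans_le hbn)
  have := lintegral_comp_smul_sub (volume : Measure ℂ) (fun t => ENNReal.ofReal (wt 3 t))
    (-(u / b)) (r := c₀⁻¹ * r) (by positivity)
  rw [Complex.finrank_real_complex, ENNReal.ofReal_mul (by positivity), mul_pow] at this
  calc _ ≤ ∫⁻ t : ℂ, ENNReal.ofReal (wt 3 ((c₀⁻¹ * r)⁻¹ • (t - -(u / b)))) := by
        refine lintegral_mono fun t => ENNReal.ofReal_le_ofReal ?_
        have := wt_le_of_norm_le 3 (C := 1) (x := r⁻¹ • (u + t * b))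
          (y := (c₀⁻¹ * r)⁻¹ • (t - -(u / b))) ?_
        · simpa using this
        · have e : u + t * b = b * (t - -(u / b)) := by
            field_simp; ring
          rw [one_mul, e, norm_smul, norm_smul, norm_mul, norm_inv, norm_inv,
            Real.norm_of_nonneg hr.le, Real.norm_of_nonneg (by positivity), mul_inv, inv_inv,
            mul_comm c₀, mul_assoc]
          gcongr
    _ = _ := by rw [this]; ring
set_option maxHeartbeats 1000000 in
lemma exists_strip_bound_single {c₀ : ℝ} (hc₀ : 0 < c₀) (ρ : ℝ) : ∃ C : NNReal, ∀ r : ℝ, 0 < r →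
    ∀ (l : ι → ℤ) (g : 𝔼 → ℂ), Nice g → ∀ (a v₀ δ : 𝔼), ‖δ‖ ≤ ρ → c₀ ≤ ‖P.B (a - pc r l) δ‖ →
    ∫⁻ t : ℂ in Metric.closedBall 0 (4 * r ^ 2), ∫⁻ x, ‖P.ext (piece r g l) x t‖ₑ ^ 2 *
      ENNReal.ofReal (wt 3 (r⁻¹ • P.H (x - v₀ + P.A t a) δ)) ≤
      C * ENNReal.ofReal r ^ 2 * E2 (fun ξ => (packet r l ξ : ℂ) * g ξ) := by
  set N := Fintype.card ι + 4 with hN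
  obtain ⟨C₁, hC₁⟩ := P.exists_packet_bound (N := N) (by omega)
  have hI := lintegral_wt_lt_top (volume : Measure 𝔼) (N := Fintype.card ι + 1) (by simp)
  have hJ := lintegral_wt_lt_top (volume : Measure ℂ) (N := 3) (by simp)
  set I := ∫⁻ x : 𝔼, ENNReal.ofReal (wt (Fintype.card ι + 1) x)
  set J := ∫⁻ x : ℂ, ENNReal.ofReal (wt 3 x)
  set CH : ℝ := (1 + ‖P.H‖ * ρ) ^ 3 with hCH
  refine ⟨C₁ * CH.toNNReal * I.toNNReal * (c₀⁻¹.toNNReal ^ 2 * J.toNNReal), ?_⟩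
  intro r hr l g hg a v₀ δ hδ hb
  have hρ : 0 ≤ ρ := (norm_nonneg _).trans hδ
  have hCH0 : 0 ≤ CH := by positivity
  set ρd := ENNReal.ofReal r ^ Fintype.card ι with hρd
  have hρ0 : ρd ≠ 0 := by simp [hρd, hr]
  have hρ1 : ρd ≠ ∞ := by finiteness
  have hmem := memLp_packet_mul (r := r) l hg.mem
  set hh := l2FourierInv (fun ξ => (packet r l ξ : ℂ) * g ξ) with hhh
  have hhm : Measurable hh := l2FourierInv_measurable _
  have hhm2 : MemLp hh 2 volume := l2FourierInv_memLp hmem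
  have hpt := fun (t : ℂ) (x y : 𝔼) => P.wt_mul_strip_le (r := r) a (pc r l) v₀ δ hδ t x y
  rw [← hN, ← hCH] at hpt
  have htime := fun y : 𝔼 => lintegral_strip_time_le hc₀ hr (P.H (y - v₀) δ)
    (starRingEnd ℂ (P.B (a - pc r l) δ)) (by rwa [RCLike.norm_conj])
  have mA : Continuous fun w : 𝔼 × ℂ => P.A w.2 (pc r l) := by fun_prop
  have cw1 : Continuous fun w : (𝔼 × ℂ) × 𝔼 =>
      wt N (r⁻¹ • (w.1.1 - w.2 + P.A w.1.2 (pc r l))) :=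
    (continuous_wt N).comp (by fun_prop)
  have cw2 : Continuous fun w : 𝔼 × ℂ => wt 3 (r⁻¹ • P.H (w.1 - v₀ + P.A w.2 a) δ) :=
    (continuous_wt 3).comp (by fun_prop)
  have mh : Measurable fun w : (𝔼 × ℂ) × 𝔼 => ‖hh w.2‖ₑ ^ 2 :=
    (hhm.comp measurable_snd).enorm.pow_const 2
  calc ∫⁻ t : ℂ in Metric.closedBall 0 (4 * r ^ 2), ∫⁻ x, ‖P.ext (piece r g l) x t‖ₑ ^ 2 *
        ENNReal.ofReal (wt 3 (r⁻¹ • P.H (x - v₀ + P.A t a) δ))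
      ≤ ∫⁻ t : ℂ in Metric.closedBall 0 (4 * r ^ 2), ∫⁻ x, ∫⁻ y, C₁ * ρd⁻¹ *
        (ENNReal.ofReal (wt N (r⁻¹ • (x - y + P.A t (pc r l)))) * ‖hh y‖ₑ ^ 2 *
        ENNReal.ofReal (wt 3 (r⁻¹ • P.H (x - v₀ + P.A t a) δ))) := by
        refine setLIntegral_mono' measurableSet_closedBall fun t ht => lintegral_mono fun x => ?_
        have := hC₁ r hr l hh (fun ξ => (packet r l ξ : ℂ) * g ξ) hhm2
          (l2Fourier_l2FourierInv hmem).symm x t (by simpa using ht)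
        rw [lintegral_const_mul' _ _ (by finiteness), lintegral_mul_const' _ _ (by finiteness),
          ← mul_assoc]
        exact mul_le_mul_left this _
    _ ≤ ∫⁻ t : ℂ, ∫⁻ x, ∫⁻ y, C₁ * ρd⁻¹ *
        (ENNReal.ofReal (wt N (r⁻¹ • (x - y + P.A t (pc r l)))) * ‖hh y‖ₑ ^ 2 *
        ENNReal.ofReal (wt 3 (r⁻¹ • P.H (x - v₀ + P.A t a) δ))) := setLIntegral_le_lintegral _ _
    _ = ∫⁻ t : ℂ, ∫⁻ y, ∫⁻ x, C₁ * ρd⁻¹ *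
        (ENNReal.ofReal (wt N (r⁻¹ • (x - y + P.A t (pc r l)))) * ‖hh y‖ₑ ^ 2 *
        ENNReal.ofReal (wt 3 (r⁻¹ • P.H (x - v₀ + P.A t a) δ))) := by
        refine lintegral_congr fun t => ?_
        refine lintegral_lintegral_swap (Measurable.aemeasurable ?_)
        have m1 : Measurable fun w : 𝔼 × 𝔼 =>
            ENNReal.ofReal (wt N (r⁻¹ • (w.1 - w.2 + P.A t (pc r l)))) :=
          ((continuous_wt N).comp (by fun_prop)).measurable.ennreal_ofReal
        have m2 : Measurable fun w : 𝔼 × 𝔼 =>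
            ENNReal.ofReal (wt 3 (r⁻¹ • P.H (w.1 - v₀ + P.A t a) δ)) :=
          ((continuous_wt 3).comp (by fun_prop)).measurable.ennreal_ofReal
        exact ((m1.mul ((hhm.comp measurable_snd).enorm.pow_const 2)).mul m2).const_mul _
    _ ≤ ∫⁻ t : ℂ, ∫⁻ y, (C₁ * CH.toNNReal * I) * (‖hh y‖ₑ ^ 2 *
          ENNReal.ofReal (wt 3 (r⁻¹ • (P.H (y - v₀) δ +
            t * starRingEnd ℂ (P.B (a - pc r l) δ))))) := by
        refine lintegral_mono fun t => lintegral_mono fun y => ?_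
        have hx := lintegral_comp_smul_sub (volume : Measure 𝔼)
          (fun x => ENNReal.ofReal (wt (Fintype.card ι + 1) x)) (y - P.A t (pc r l)) hr
        rw [finrank_euclideanSpace] at hx
        calc _ ≤ ∫⁻ x, (C₁ * ρd⁻¹ * ‖hh y‖ₑ ^ 2 * CH.toNNReal *
              ENNReal.ofReal (wt 3 (r⁻¹ • (P.H (y - v₀) δ +
                t * starRingEnd ℂ (P.B (a - pc r l) δ))))) *
              ENNReal.ofReal (wt (Fintype.card ι + 1) (r⁻¹ • (x - (y - P.A t (pc r l))))) := by
              refine lintegral_mono fun x => ?_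
              have := ENNReal.ofReal_le_ofReal (hpt t x y)
              rw [ENNReal.ofReal_mul (wt_nonneg _ _), ENNReal.ofReal_mul
                (mul_nonneg hCH0 (wt_nonneg _ _)), ENNReal.ofReal_mul hCH0] at this
              calc _ = C₁ * ρd⁻¹ * ‖hh y‖ₑ ^ 2 *
                    (ENNReal.ofReal (wt N (r⁻¹ • (x - y + P.A t (pc r l)))) *
                    ENNReal.ofReal (wt 3 (r⁻¹ • P.H (x - v₀ + P.A t a) δ))) := by ring
                _ ≤ _ := mul_le_mul_right this _
                _ = _ := by rw [ENNReal.ofReal]; ring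
          _ = (C₁ * ρd⁻¹ * ‖hh y‖ₑ ^ 2 * CH.toNNReal *
              ENNReal.ofReal (wt 3 (r⁻¹ • (P.H (y - v₀) δ +
                t * starRingEnd ℂ (P.B (a - pc r l) δ))))) * (ρd * I) := by
              rw [lintegral_const_mul' _ _ (by finiteness), hx]
          _ = (C₁ * CH.toNNReal * I) * (‖hh y‖ₑ ^ 2 *
          ENNReal.ofReal (wt 3 (r⁻¹ • (P.H (y - v₀) δ +
            t * starRingEnd ℂ (P.B (a - pc r l) δ))))) * (ρd⁻¹ * ρd) := by ring
          _ = _ := by rw [ENNReal.inv_mul_cancel hρ0 hρ1, mul_one]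
    _ = ∫⁻ y, ∫⁻ t : ℂ, (C₁ * CH.toNNReal * I) * (‖hh y‖ₑ ^ 2 *
          ENNReal.ofReal (wt 3 (r⁻¹ • (P.H (y - v₀) δ +
            t * starRingEnd ℂ (P.B (a - pc r l) δ))))) := by
        refine lintegral_lintegral_swap (Measurable.aemeasurable ?_)
        have m2 : Measurable fun w : ℂ × 𝔼 => ENNReal.ofReal (wt 3 (r⁻¹ • (P.H (w.2 - v₀) δ +
            w.1 * starRingEnd ℂ (P.B (a - pc r l) δ)))) :=
          ((continuous_wt 3).comp (by fun_prop)).measurable.ennreal_ofReal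
        exact (((hhm.comp measurable_snd).enorm.pow_const 2).mul m2).const_mul _
    _ ≤ ∫⁻ y, (C₁ * CH.toNNReal * I * (ENNReal.ofReal c₀⁻¹ ^ 2 * J)) * ENNReal.ofReal r ^ 2 *
          ‖hh y‖ₑ ^ 2 := by
        refine lintegral_mono fun y => ?_
        rw [lintegral_const_mul' _ _ (by finiteness), lintegral_const_mul' _ _ (by finiteness)]
        calc _ ≤ (C₁ * CH.toNNReal * I) * (‖hh y‖ₑ ^ 2 *
              (ENNReal.ofReal c₀⁻¹ ^ 2 * J * ENNReal.ofReal r ^ 2)) := by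
              gcongr; exact htime y
          _ = _ := by ring
    _ = (C₁ * CH.toNNReal * I * (ENNReal.ofReal c₀⁻¹ ^ 2 * J)) * ENNReal.ofReal r ^ 2 *
          E2 hh := by
        rw [lintegral_const_mul' _ _ (by finiteness), E2]
    _ = _ := by
        rw [hhh, E2_l2FourierInv hmem]
        push_cast
        rw [ENNReal.coe_toNNReal hI.ne, ENNReal.coe_toNNReal hJ.ne, ENNReal.ofReal]

lemma lintegral_lintegral_finsetSum {X Y J : Type*} [MeasurableSpace X] [MeasurableSpace Y]
    (μ : Measure X) (ν : Measure Y) [SFinite ν] (s : Finset J) {F : J → X → Y → ℝ≥0∞}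
    (hF : ∀ j ∈ s, Measurable fun w : X × Y => F j w.1 w.2) :
    ∫⁻ x, ∫⁻ y, ∑ j ∈ s, F j x y ∂ν ∂μ = ∑ j ∈ s, ∫⁻ x, ∫⁻ y, F j x y ∂ν ∂μ := by
  rw [← lintegral_finsetSum s fun j hj => (hF j hj).lintegral_prod_right']
  refine lintegral_congr fun x => ?_
  exact lintegral_finsetSum s fun j hj => (hF j hj).comp measurable_prodMk_left

/-- Each transversal tube meets a strip in a short time interval. -/
lemma exists_strip_bound {c₀ : ℝ} (hc₀ : 0 < c₀) (ρ : ℝ) : ∃ C : NNReal, ∀ r : ℝ, 0 < r →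
    ∀ (L : Finset (ι → ℤ)) (g : 𝔼 → ℂ), Nice g → E2 g ≤ 1 → ∀ (a v₀ δ : 𝔼), ‖δ‖ ≤ ρ →
    (∀ l ∈ L, c₀ ≤ ‖P.B (a - pc r l) δ‖) →
    ∫⁻ t : ℂ in Metric.closedBall 0 (4 * r ^ 2), ∫⁻ x, (∑ l ∈ L, ‖P.ext (piece r g l) x t‖ₑ ^ 2) *
      ENNReal.ofReal (wt 3 (r⁻¹ • P.H (x - v₀ + P.A t a) δ)) ≤ C * ENNReal.ofReal r ^ 2 := by
  obtain ⟨C, hC⟩ := P.exists_strip_bound_single hc₀ ρ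
  refine ⟨C, fun r hr L g hg hE a v₀ δ hδ hb => ?_⟩
  have hmeas : ∀ l, Measurable fun w : ℂ × 𝔼 => ‖P.ext (piece r g l) w.2 w.1‖ₑ ^ 2 *
      ENNReal.ofReal (wt 3 (r⁻¹ • P.H (w.2 - v₀ + P.A w.1 a) δ)) := by
    intro l
    have m2 : Measurable fun w : ℂ × 𝔼 =>
        ENNReal.ofReal (wt 3 (r⁻¹ • P.H (w.2 - v₀ + P.A w.1 a) δ)) :=
      ((continuous_wt 3).comp (by fun_prop)).measurable.ennreal_ofReal
    have m1 := P.measurable_ext_swap (nice_piece (r := r) l hg).meas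
    exact (m1.enorm.pow_const 2).mul m2
  calc _ = ∑ l ∈ L, ∫⁻ t : ℂ in Metric.closedBall 0 (4 * r ^ 2),
      ∫⁻ x, ‖P.ext (piece r g l) x t‖ₑ ^ 2 *
      ENNReal.ofReal (wt 3 (r⁻¹ • P.H (x - v₀ + P.A t a) δ)) := by
        simp only [Finset.sum_mul]
        exact lintegral_lintegral_finsetSum _ _ L (F := fun l t x =>
          ‖P.ext (piece r g l) x t‖ₑ ^ 2 * ENNReal.ofReal (wt 3 (r⁻¹ • P.H (x - v₀ + P.A t a) δ)))
          fun l _ => hmeas l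
    _ ≤ ∑ l ∈ L, C * ENNReal.ofReal r ^ 2 * E2 (fun ξ => (packet r l ξ : ℂ) * g ξ) :=
        Finset.sum_le_sum fun l hl => hC r hr l g hg a v₀ δ hδ (hb l hl)
    _ ≤ C * ENNReal.ofReal r ^ 2 * 1 := by
        rw [← Finset.mul_sum]
        gcongr
        exact (sum_E2_packet_le r L g).trans hE
    _ = _ := mul_one _

end QuadPhase

namespace QuadPhase
variable {ι : Type*} [Fintype ι] (P : QuadPhase ι)

local notation "𝔼" => EuclideanSpace ℝ ι

/-- The mass which the packets of `g` deposit, during the time set `q`, along the tube with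
frequency `k` and footpoint `y`, with a positive floor. -/
def mass (q : Set ℂ) (L : Finset (ι → ℤ)) (g : 𝔼 → ℂ) (r : ℝ) (k : ι → ℤ) (y : 𝔼) : ℝ≥0∞ :=
  (ENNReal.ofReal r ^ Fintype.card ι)⁻¹ + ∫⁻ t in q, ∫⁻ x,
    (∑ l ∈ L, ‖P.ext (piece r g l) x t‖ₑ ^ 2) *
      ENNReal.ofReal (wt (2 * Fintype.card ι + 3) (r⁻¹ • (x + P.A t (pc r k) - y)))

lemma mass_ne_zero (q : Set ℂ) (L : Finset (ι → ℤ)) (g : 𝔼 → ℂ) (r : ℝ) (k : ι → ℤ) (y : 𝔼) :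
    P.mass q L g r k y ≠ 0 := by
  unfold mass
  have : (ENNReal.ofReal r ^ Fintype.card ι)⁻¹ ≠ 0 :=
    ENNReal.inv_ne_zero.2 (ENNReal.pow_ne_top ENNReal.ofReal_ne_top)
  exact fun h => this (add_eq_zero.1 h).1

lemma lintegral_sq_ext {f : 𝔼 → ℂ} (hf : Nice f) (t : ℂ) :
    ∫⁻ x, ‖P.ext f x t‖ₑ ^ 2 = E2 f := by
  have h := P.nice_modulate hf t
  simp_rw [P.ext_eq_fourierInv]
  rw [lintegral_sq_fourierInv h.int h.mem, E2]
  refine lintegral_congr fun ξ => ?_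
  rw [enorm_mul, ← ofReal_norm (_ : ℂ), Circle.norm_coe, ENNReal.ofReal_one, one_mul]

lemma lintegral_mul_wt_mono {G : ℂ → 𝔼 → ℝ≥0∞} (q : Set ℂ) (u : ℂ → 𝔼 → 𝔼) (N : ℕ) {r : ℝ}
    (y y' : 𝔼) :
    ENNReal.ofReal (wt N (r⁻¹ • (y' - y))) *
      ∫⁻ t in q, ∫⁻ x, G t x * ENNReal.ofReal (wt N (r⁻¹ • (u t x - y))) ≤
      ∫⁻ t in q, ∫⁻ x, G t x * ENNReal.ofReal (wt N (r⁻¹ • (u t x - y'))) := by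
  rw [← lintegral_const_mul' _ _ (by finiteness)]
  refine lintegral_mono fun t => ?_
  rw [← lintegral_const_mul' _ _ (by finiteness)]
  refine lintegral_mono fun x => ?_
  rw [mul_left_comm, ← ENNReal.ofReal_mul (wt_nonneg _ _)]
  gcongr
  rw [← wt_neg N (r⁻¹ • (y' - y))]
  refine (wt_mul_wt_le _ _ _).trans (le_of_eq ?_)
  rw [← smul_neg, ← smul_add]
  congr 2; abel

/-- The mass varies slowly with the footpoint. -/
lemma wt_mul_mass_le (q : Set ℂ) (L : Finset (ι → ℤ)) (g : 𝔼 → ℂ) (r : ℝ) (k : ι → ℤ)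
    (y y' : 𝔼) :
    ENNReal.ofReal (wt (2 * Fintype.card ι + 3) (r⁻¹ • (y' - y))) * P.mass q L g r k y ≤
      P.mass q L g r k y' := by
  unfold mass
  rw [mul_add]
  refine add_le_add (mul_le_of_le_one_left' ?_) (lintegral_mul_wt_mono q _ _ y y')
  rw [← ENNReal.ofReal_one]
  exact ENNReal.ofReal_le_ofReal (wt_le_one _ _)

lemma measurable_sum_piece (L : Finset (ι → ℤ)) {g : 𝔼 → ℂ} (hg : Nice g) (r : ℝ) :
    Measurable fun w : ℂ × 𝔼 => ∑ l ∈ L, ‖P.ext (piece r g l) w.2 w.1‖ₑ ^ 2 := by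
  refine Finset.measurable_sum _ fun l _ => ?_
  have m1 := P.measurable_ext_swap (nice_piece (r := r) l hg).meas
  exact m1.enorm.pow_const 2

lemma measurable_mass (q : Set ℂ) (L : Finset (ι → ℤ)) {g : 𝔼 → ℂ} (hg : Nice g) (r : ℝ)
    (k : ι → ℤ) : Measurable (P.mass q L g r k) := by
  have cw : Continuous fun w : (𝔼 × ℂ) × 𝔼 =>
      wt (2 * Fintype.card ι + 3) (r⁻¹ • (w.2 + P.A w.1.2 (pc r k) - w.1.1)) :=
    (continuous_wt _).comp (by fun_prop)
  have hs := P.measurable_sum_piece L hg r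
  have h2 : Measurable fun w : (𝔼 × ℂ) × 𝔼 => (w.1.2, w.2) :=
    (measurable_snd.comp measurable_fst).prodMk measurable_snd
  have h3 := (hs.comp h2).mul cw.measurable.ennreal_ofReal
  have h4 := h3.lintegral_prod_right' (ν := volume)
  have h5 := h4.lintegral_prod_right' (ν := volume.restrict q)
  exact measurable_const.add h5

lemma sum_sq_piece_lintegral_le (L : Finset (ι → ℤ)) {g : 𝔼 → ℂ} (hg : Nice g) (r : ℝ) (t : ℂ) :
    ∫⁻ x, ∑ l ∈ L, ‖P.ext (piece r g l) x t‖ₑ ^ 2 ≤ L.card * E2 g := by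
  have hm : ∀ l ∈ L, Measurable fun x => ‖P.ext (piece r g l) x t‖ₑ ^ 2 := by
    intro l _
    have m1 := P.measurable_ext_swap (nice_piece (r := r) l hg).meas
    have m2 := m1.comp (measurable_prodMk_left (x := t))
    exact m2.enorm.pow_const 2
  rw [lintegral_finsetSum _ hm, ← nsmul_eq_mul]
  refine Finset.sum_le_card_nsmul _ _ _ fun l hl => ?_
  rw [P.lintegral_sq_ext (nice_piece l hg)]
  have h1 := sum_E2_packet_le r {l} fun ξ => (packet r l ξ : ℂ) * g ξ
  have h2 := sum_E2_packet_le r {l} g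
  rw [Finset.sum_singleton] at h1 h2
  exact h1.trans h2

lemma mass_ne_top {q : Set ℂ} {r : ℝ} (hr : 0 < r) (hq : q ⊆ Metric.closedBall 0 (4 * r ^ 2))
    (L : Finset (ι → ℤ)) {g : 𝔼 → ℂ} (hg : Nice g) (k : ι → ℤ) (y : 𝔼) :
    P.mass q L g r k y ≠ ∞ := by
  unfold mass
  have h1 : (ENNReal.ofReal r ^ Fintype.card ι)⁻¹ ≠ ∞ := by
    rw [ENNReal.inv_ne_top]; exact pow_ne_zero _ (by simpa using hr)
  refine ENNReal.add_ne_top.2 ⟨h1, ne_top_of_le_ne_top (b := L.card * E2 g * volume q) ?_ ?_⟩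
  · refine ENNReal.mul_ne_top (ENNReal.mul_ne_top (by finiteness)
      (lintegral_sq_lt_top hg.mem).ne) ?_
    exact ((measure_mono hq).trans_lt measure_closedBall_lt_top).ne
  · rw [← setLIntegral_const]
    refine lintegral_mono fun t => le_trans (lintegral_mono fun x => ?_)
      (P.sum_sq_piece_lintegral_le L hg r t)
    refine mul_le_of_le_one_right' ?_
    rw [← ENNReal.ofReal_one]
    exact ENNReal.ofReal_le_ofReal (wt_le_one _ _)

/-- Tubes in nearby directions through a common point collect their masses in a strip. -/
lemma exists_sum_mass_le {c₀ : ℝ} (hc₀ : 0 < c₀) {c : ℝ} (hc : 0 ≤ c) {ρ X : ℝ} (hρ : 0 ≤ ρ)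
    (hX : 0 ≤ X) :
    ∃ C : NNReal, ∀ r h : ℝ, 1 ≤ r → 0 < h → h ≤ r ^ 2 →
    ∀ (K L : Finset (ι → ℤ)) (g : 𝔼 → ℂ), Nice g → E2 g ≤ 1 →
      (K.card : ℝ) ≤ X * r ^ Fintype.card ι →
    ∀ q : Set ℂ, MeasurableSet q → q ⊆ Metric.closedBall 0 (4 * r ^ 2) →
    ∀ t₀, (∀ t ∈ q, h ≤ ‖t - t₀‖ ∧ ‖t - t₀‖ ≤ 8 * r ^ 2) → ∀ k l' : ι → ℤ,
    ‖(pc r l' : 𝔼) - pc r k‖ ≤ ρ →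
    (∀ l ∈ L, c₀ ≤ ‖P.B (pc r k - pc r l) (pc r l' - pc r k)‖) →
    (∀ k' ∈ K, P.Near c r k l' k') → ∀ x₀ : 𝔼,
    ∑ k' ∈ K, P.mass q L g r k' (x₀ + P.A t₀ (pc r k')) ≤
      C * ENNReal.ofReal ((r ^ 2 / h) ^ (2 * Fintype.card ι) * r ^ 2) := by
  obtain ⟨C₁, hC₁0, hC₁⟩ := P.exists_sum_wt_tube_le
  obtain ⟨C₂, hC₂⟩ := P.exists_strip_bound hc₀ ρ
  set C₃ : ℝ := (1 + ‖P.H‖ * ρ + 8 * c) ^ 3 with hC₃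
  have hC₃0 : 0 ≤ C₃ := by positivity
  refine ⟨X.toNNReal + (C₁ * C₃).toNNReal * C₂, ?_⟩
  intro r h hr hh hhr K L g hg hE hK q hqm hq t₀ ht₀ k l' hδ htr hnear x₀
  have hr0 : 0 < r := zero_lt_one.trans_le hr
  set δ : 𝔼 := pc r l' - pc r k with hδd
  set v₀ : 𝔼 := x₀ + P.A t₀ (pc r k) with hv₀
  set D := 2 * Fintype.card ι with hD
  set G : ℂ → 𝔼 → ℝ≥0∞ := fun t x => ∑ l ∈ L, ‖P.ext (piece r g l) x t‖ₑ ^ 2 with hG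
  have hratio : 1 ≤ r ^ 2 / h := (one_le_div hh).2 hhr
  have hpt : ∀ t ∈ q, ∀ x, ∑ k' ∈ K, wt (D + 3) (r⁻¹ • (x + P.A t (pc r k') -
      (x₀ + P.A t₀ (pc r k')))) ≤ C₁ * (r ^ 2 / h) ^ D *
        (C₃ * wt 3 (r⁻¹ • P.H (x - v₀ + P.A t (pc r k)) δ)) := by
    intro t ht x
    obtain ⟨h1, h2⟩ := ht₀ t ht
    have e : ∀ k' : ι → ℤ, x + P.A t (pc r k') - (x₀ + P.A t₀ (pc r k')) =
        (x - x₀) + P.A (t - t₀) (pc r k') := by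
      intro k'; rw [map_sub, _root_.sub_apply]; abel
    have h3 : ∀ k' ∈ K, wt 3 (r⁻¹ • ((x - x₀) + P.A (t - t₀) (pc r k'))) ≤
        C₃ * wt 3 (r⁻¹ • P.H (x - v₀ + P.A t (pc r k)) δ) := by
      intro k' hk'
      refine wt_le_of_norm_le 3 ?_
      set v := r⁻¹ • ((x - x₀) + P.A (t - t₀) (pc r k')) with hv
      have e2 : r⁻¹ • P.H (x - v₀ + P.A t (pc r k)) δ = P.H v δ -
          r⁻¹ • ((t - t₀) * starRingEnd ℂ (P.B (pc r k' - pc r k) δ)) := by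
        rw [← P.H_A, hv, map_smul, _root_.smul_apply, ← smul_sub, ← _root_.sub_apply, ← map_sub]
        congr 3
        rw [hv₀]; simp only [map_sub, _root_.sub_apply]; abel
      have h4 : ‖P.H v δ‖ ≤ ‖P.H‖ * ‖v‖ * ρ := (P.H.le_opNorm₂ _ _).trans (by gcongr)
      have h5 : ‖r⁻¹ • ((t - t₀) * starRingEnd ℂ (P.B (pc r k' - pc r k) δ))‖ ≤ 8 * c := by
        rw [norm_smul, norm_mul, RCLike.norm_conj, Real.norm_of_nonneg (by positivity)]
        have : ‖P.B (pc r k' - pc r k) δ‖ ≤ c / r := hnear k' hk'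
        calc r⁻¹ * (‖t - t₀‖ * ‖P.B (pc r k' - pc r k) δ‖) ≤ r⁻¹ * (8 * r ^ 2 * (c / r)) := by
              gcongr
          _ = 8 * c := by field_simp
      rw [e2]
      have h6 := norm_sub_le (P.H v δ)
        (r⁻¹ • ((t - t₀) * starRingEnd ℂ (P.B (pc r k' - pc r k) δ)))
      have h7 : 0 ≤ ‖P.H‖ * ρ := by positivity
      nlinarith [norm_nonneg v]
    calc _ = ∑ k' ∈ K, wt D (r⁻¹ • ((x - x₀) + P.A (t - t₀) (pc r k'))) *
          wt 3 (r⁻¹ • ((x - x₀) + P.A (t - t₀) (pc r k'))) := by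
          refine Finset.sum_congr rfl fun k' _ => ?_
          rw [e, wt_add]
      _ ≤ ∑ k' ∈ K, wt D (r⁻¹ • ((x - x₀) + P.A (t - t₀) (pc r k'))) *
          (C₃ * wt 3 (r⁻¹ • P.H (x - v₀ + P.A t (pc r k)) δ)) := by
          refine Finset.sum_le_sum fun k' hk' => ?_
          gcongr
          · exact wt_nonneg _ _
          · exact h3 k' hk'
      _ ≤ _ := by
          rw [← Finset.sum_mul]
          gcongr
          · exact mul_nonneg hC₃0 (wt_nonneg _ _)
          · exact hC₁ r h hr0 hh hhr K _ _ h1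
  have hfloor : (K.card : ℝ≥0∞) * (ENNReal.ofReal r ^ Fintype.card ι)⁻¹ ≤
      X.toNNReal * ENNReal.ofReal ((r ^ 2 / h) ^ D * r ^ 2) := by
    have h1 : (K.card : ℝ≥0∞) ≤ X.toNNReal * ENNReal.ofReal r ^ Fintype.card ι := by
      rw [← ENNReal.ofReal_natCast, ← ENNReal.ofReal_pow hr0.le]
      change _ ≤ ENNReal.ofReal X * _
      rw [← ENNReal.ofReal_mul hX]
      exact ENNReal.ofReal_le_ofReal hK
    have h2 : (1 : ℝ≥0∞) ≤ ENNReal.ofReal ((r ^ 2 / h) ^ D * r ^ 2) := by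
      rw [← ENNReal.ofReal_one]
      exact ENNReal.ofReal_le_ofReal (one_le_mul_of_one_le_of_one_le (one_le_pow₀ hratio)
        (one_le_pow₀ hr))
    have h0 : ENNReal.ofReal r ^ Fintype.card ι ≠ 0 := pow_ne_zero _ (by simpa using hr0)
    calc _ ≤ X.toNNReal * ENNReal.ofReal r ^ Fintype.card ι *
          (ENNReal.ofReal r ^ Fintype.card ι)⁻¹ := by gcongr
      _ = X.toNNReal * 1 := by
          rw [mul_assoc, ENNReal.mul_inv_cancel h0 (by finiteness)]
      _ ≤ _ := by gcongr
  have hmain : ∑ k' ∈ K, ∫⁻ t in q, ∫⁻ x, G t x *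
      ENNReal.ofReal (wt (D + 3) (r⁻¹ • (x + P.A t (pc r k') - (x₀ + P.A t₀ (pc r k'))))) ≤
      ((C₁ * C₃).toNNReal * C₂ : NNReal) * ENNReal.ofReal ((r ^ 2 / h) ^ D * r ^ 2) := by
    refine (sum_lintegral_le _ _).trans ?_
    calc _ ≤ ∫⁻ t in q, ENNReal.ofReal (C₁ * (r ^ 2 / h) ^ D * C₃) *
          ∫⁻ x, G t x * ENNReal.ofReal (wt 3 (r⁻¹ • P.H (x - v₀ + P.A t (pc r k)) δ)) := by
          refine setLIntegral_mono' hqm fun t ht => (sum_lintegral_le _ _).trans ?_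
          rw [← lintegral_const_mul' _ _ (by finiteness)]
          refine lintegral_mono fun x => ?_
          rw [← Finset.mul_sum, ← ENNReal.ofReal_sum_of_nonneg fun l _ => wt_nonneg _ _,
            mul_left_comm, ← ENNReal.ofReal_mul (by positivity)]
          gcongr
          exact (hpt t ht x).trans (le_of_eq (by ring))
      _ ≤ ENNReal.ofReal (C₁ * (r ^ 2 / h) ^ D * C₃) *
          ∫⁻ t in Metric.closedBall 0 (4 * r ^ 2), ∫⁻ x, G t x *
            ENNReal.ofReal (wt 3 (r⁻¹ • P.H (x - v₀ + P.A t (pc r k)) δ)) := by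
          rw [lintegral_const_mul' _ _ (by finiteness)]
          gcongr
      _ ≤ ENNReal.ofReal (C₁ * (r ^ 2 / h) ^ D * C₃) * (C₂ * ENNReal.ofReal r ^ 2) := by
          gcongr
          exact hC₂ r hr0 L g hg hE _ v₀ δ hδ htr
      _ = _ := by
          rw [show C₁ * (r ^ 2 / h) ^ D * C₃ = (C₁ * C₃) * (r ^ 2 / h) ^ D by ring,
            ENNReal.ofReal_mul (p := C₁ * C₃) (by positivity),
            ENNReal.ofReal_mul (p := (r ^ 2 / h) ^ D) (by positivity),
            ENNReal.ofReal_pow hr0.le, ENNReal.coe_mul]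
          change ENNReal.ofReal (C₁ * C₃) * _ * _ = ENNReal.ofReal (C₁ * C₃) * _ * _
          ring
  calc _ = K.card * (ENNReal.ofReal r ^ Fintype.card ι)⁻¹ + ∑ k' ∈ K, ∫⁻ t in q, ∫⁻ x, G t x *
      ENNReal.ofReal (wt (D + 3) (r⁻¹ • (x + P.A t (pc r k') - (x₀ + P.A t₀ (pc r k'))))) := by
        unfold mass
        rw [Finset.sum_add_distrib, Finset.sum_const, nsmul_eq_mul]
    _ ≤ _ := by
        rw [ENNReal.coe_add, add_mul]
        exact add_le_add hfloor hmain

end QuadPhase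

section Share
variable {J : Type*} [Fintype J]

/-- The share of `m j` in the total `∑ m`. -/
def share (m : J → ℝ≥0∞) (j : J) : ℝ := (m j / ∑ i, m i).toReal

lemma share_nonneg (m : J → ℝ≥0∞) (j : J) : 0 ≤ share m j := ENNReal.toReal_nonneg

lemma sum_share [Nonempty J] {m : J → ℝ≥0∞} (h0 : ∀ j, m j ≠ 0) (h1 : ∀ j, m j ≠ ∞) :
    ∑ j, share m j = 1 := by
  have hS0 : ∑ i, m i ≠ 0 := by
    intro h
    rw [Finset.sum_eq_zero_iff] at h
    exact h0 (Classical.arbitrary J) (h _ (Finset.mem_univ _))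
  have hS1 : ∑ i, m i ≠ ∞ := (ENNReal.sum_ne_top).2 fun i _ => h1 i
  unfold share
  rw [← ENNReal.toReal_sum fun j _ => (ENNReal.div_lt_top (h1 j) hS0).ne]
  simp_rw [div_eq_mul_inv]
  rw [← Finset.sum_mul, ENNReal.mul_inv_cancel hS0 hS1, ENNReal.toReal_one]

lemma share_le_one [Nonempty J] {m : J → ℝ≥0∞} (h0 : ∀ j, m j ≠ 0) (h1 : ∀ j, m j ≠ ∞) (j : J) :
    share m j ≤ 1 := by
  rw [← sum_share h0 h1]
  exact Finset.single_le_sum (fun i _ => share_nonneg m i) (Finset.mem_univ j)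

lemma ofReal_share_sq_le [Nonempty J] {m : J → ℝ≥0∞} (h0 : ∀ j, m j ≠ 0) (h1 : ∀ j, m j ≠ ∞)
    (i j : J) : ENNReal.ofReal (share m i ^ 2) ≤ m i * (m j)⁻¹ := by
  calc ENNReal.ofReal (share m i ^ 2) ≤ ENNReal.ofReal (share m i) :=
        ENNReal.ofReal_le_ofReal (pow_le_of_le_one (share_nonneg m i) (share_le_one h0 h1 i)
          two_ne_zero)
    _ ≤ m i / ∑ l, m l := ENNReal.ofReal_toReal_le
    _ ≤ m i * (m j)⁻¹ := by
        rw [div_eq_mul_inv]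
        gcongr
        exact Finset.single_le_sum (f := m) (fun _ _ => zero_le) (Finset.mem_univ j)

lemma measurable_share {Y : Type*} [MeasurableSpace Y] {m : J → Y → ℝ≥0∞}
    (hm : ∀ j, Measurable (m j)) (j : J) : Measurable fun y => share (fun i => m i y) j :=
  ((hm j).div (Finset.measurable_sum _ fun i _ => hm i)).ennreal_toReal

end Share

namespace QuadPhase
open scoped FourierTransform
variable {ι : Type*} [Fintype ι] (P : QuadPhase ι) {J : Type*} [Fintype J]

local notation "𝔼" => EuclideanSpace ℝ ι

/-- The part of the wave packet of `f` at frequency `k` assigned to the index `j`. -/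
def wpart (m : J → (ι → ℤ) → 𝔼 → ℝ≥0∞) (r : ℝ) (f : 𝔼 → ℂ) (j : J) (k : ι → ℤ) : 𝔼 → ℂ :=
  l2Fourier fun y => (share (fun i => m i k y) j : ℂ) *
    l2FourierInv (fun ξ => (packet r k ξ : ℂ) * f ξ) y

/-- The part of `f` assigned to the index `j`. -/
def fpart (m : J → (ι → ℤ) → 𝔼 → ℝ≥0∞) (r : ℝ) (K : Finset (ι → ℤ)) (f : 𝔼 → ℂ) (j : J)
    (ξ : 𝔼) : ℂ :=
  ∑ k ∈ K, (packet r k ξ : ℂ) * wpart m r f j k ξ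

/-- A family of positive finite measurable weights. -/
structure MassFamily (m : J → (ι → ℤ) → 𝔼 → ℝ≥0∞) : Prop where
  meas : ∀ j k, Measurable (m j k)
  ne_zero : ∀ j k y, m j k y ≠ 0
  ne_top : ∀ j k y, m j k y ≠ ∞

namespace MassFamily

lemma memLp_share_mul [Nonempty J] {m : J → (ι → ℤ) → 𝔼 → ℝ≥0∞}
    (H : MassFamily m) (k : ι → ℤ) {h : 𝔼 → ℂ} (hh : MemLp h 2 volume) (j : J) :
    MemLp (fun y => (share (fun i => m i k y) j : ℂ) * h y) 2 volume := by
  refine MemLp.of_le hh ?_ (Filter.Eventually.of_forall fun y => ?_)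
  · exact (Complex.measurable_ofReal.comp
      (measurable_share (fun i => H.meas i k) j)).aestronglyMeasurable.mul hh.1
  · rw [norm_mul, Complex.norm_real, Real.norm_of_nonneg (share_nonneg _ _)]
    exact mul_le_of_le_one_left (norm_nonneg _)
      (share_le_one (fun i => H.ne_zero i k y) (fun i => H.ne_top i k y) j)

lemma sum_wpart [Nonempty J] {m : J → (ι → ℤ) → 𝔼 → ℝ≥0∞}
    (H : MassFamily m) (r : ℝ) {f : 𝔼 → ℂ} (hf : MemLp f 2 volume) (k : ι → ℤ) :
    (fun ξ => ∑ j, wpart m r f j k ξ) =ᵐ[volume] fun ξ => (packet r k ξ : ℂ) * f ξ := by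
  have hp := memLp_packet_mul (r := r) k hf
  have h1 := l2Fourier_sum Finset.univ (fun j y => (share (fun i => m i k y) j : ℂ) *
    l2FourierInv (fun ξ => (packet r k ξ : ℂ) * f ξ) y)
    fun j _ => H.memLp_share_mul k (l2FourierInv_memLp hp) j
  have h2 : (fun y => ∑ j, (share (fun i => m i k y) j : ℂ) *
      l2FourierInv (fun ξ => (packet r k ξ : ℂ) * f ξ) y) =
      l2FourierInv fun ξ => (packet r k ξ : ℂ) * f ξ := by
    funext y
    rw [← Finset.sum_mul, ← Complex.ofReal_sum,
      sum_share (fun i => H.ne_zero i k y) (fun i => H.ne_top i k y), Complex.ofReal_one, one_mul]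
  rw [h2] at h1
  exact h1.symm.trans (l2Fourier_l2FourierInv hp)

lemma sum_fpart [Nonempty J] {m : J → (ι → ℤ) → 𝔼 → ℝ≥0∞}
    (H : MassFamily m) {r : ℝ} {K : Finset (ι → ℤ)} {f : 𝔼 → ℂ}
    (hf : MemLp f 2 volume) (hK : ∀ ξ, f ξ ≠ 0 → ∑ k ∈ K, packet r k ξ ^ 2 = 1) :
    (fun ξ => ∑ j, fpart m r K f j ξ) =ᵐ[volume] f := by
  have : ∀ᵐ ξ, ∀ k ∈ K, ∑ j, wpart m r f j k ξ = (packet r k ξ : ℂ) * f ξ :=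
    (Filter.eventually_all_finset K).2 fun k _ => H.sum_wpart r hf k
  filter_upwards [this] with ξ hξ
  unfold fpart
  rw [Finset.sum_comm]
  simp_rw [← Finset.mul_sum]
  rw [Finset.sum_congr rfl fun k hk => by rw [hξ k hk]]
  by_cases h : f ξ = 0
  · simp [h]
  · simp_rw [← mul_assoc, ← sq]
    rw [← Finset.sum_mul]
    have := hK ξ h
    rw [show ∑ k ∈ K, ((packet r k ξ : ℂ)) ^ 2 = ((∑ k ∈ K, packet r k ξ ^ 2 : ℝ) : ℂ) by
      push_cast; rfl, this, Complex.ofReal_one, one_mul]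

lemma sum_E2_wpart_le [Nonempty J] {m : J → (ι → ℤ) → 𝔼 → ℝ≥0∞}
    (H : MassFamily m) (r : ℝ) {f : 𝔼 → ℂ} (hf : MemLp f 2 volume)
    (k : ι → ℤ) :
    ∑ j, E2 (wpart m r f j k) ≤ E2 fun ξ => (packet r k ξ : ℂ) * f ξ := by
  have hp := memLp_packet_mul (r := r) k hf
  rw [← E2_l2FourierInv hp]
  set hh := l2FourierInv fun ξ => (packet r k ξ : ℂ) * f ξ with hhh
  have e : ∀ j, E2 (wpart m r f j k) = E2 fun y => (share (fun i => m i k y) j : ℂ) * hh y :=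
    fun j => E2_l2Fourier (H.memLp_share_mul k (l2FourierInv_memLp hp) j)
  simp_rw [e]
  unfold E2
  refine (sum_lintegral_le _ _).trans (lintegral_mono fun y => ?_)
  calc ∑ j, ‖(share (fun i => m i k y) j : ℂ) * hh y‖ₑ ^ 2
      ≤ ∑ j, ENNReal.ofReal (share (fun i => m i k y) j) * ‖hh y‖ₑ ^ 2 := by
        refine Finset.sum_le_sum fun j _ => ?_
        have h0 := share_nonneg (fun i => m i k y) j
        rw [enorm_mul, mul_pow, ← ofReal_norm (_ : ℂ), Complex.norm_real, Real.norm_of_nonneg h0,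
          ← ENNReal.ofReal_pow h0]
        gcongr
        exact pow_le_of_le_one h0
          (share_le_one (fun i => H.ne_zero i k y) (fun i => H.ne_top i k y) j) two_ne_zero
    _ = ‖hh y‖ₑ ^ 2 := by
        rw [← Finset.sum_mul, ← ENNReal.ofReal_sum_of_nonneg fun j _ => share_nonneg _ _,
          sum_share (fun i => H.ne_zero i k y) (fun i => H.ne_top i k y), ENNReal.ofReal_one,
          one_mul]

lemma E2_wpart_le [Nonempty J] {m : J → (ι → ℤ) → 𝔼 → ℝ≥0∞}
    (H : MassFamily m) (r : ℝ) {f : 𝔼 → ℂ} (hf : MemLp f 2 volume)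
    (j : J) (k : ι → ℤ) : E2 (wpart m r f j k) ≤ E2 f := by
  have h1 := sum_E2_packet_le r {k} f
  rw [Finset.sum_singleton] at h1
  exact (Finset.single_le_sum (f := fun j => E2 (wpart m r f j k)) (fun _ _ => zero_le)
    (Finset.mem_univ j)).trans ((H.sum_E2_wpart_le r hf k).trans h1)

lemma sum_E2_fpart_le [Nonempty J] {m : J → (ι → ℤ) → 𝔼 → ℝ≥0∞}
    (H : MassFamily m) (r : ℝ) (K : Finset (ι → ℤ)) {f : 𝔼 → ℂ}
    (hf : MemLp f 2 volume) : ∑ j, E2 (fpart m r K f j) ≤ E2 f := by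
  have hj : ∀ j, E2 (fpart m r K f j) ≤ ∑ k ∈ K, E2 (wpart m r f j k) := by
    intro j
    unfold E2
    have hmeas : ∀ k ∈ K, Measurable fun ξ => ‖wpart m r f j k ξ‖ₑ ^ 2 := fun k _ =>
      (l2Fourier_measurable _).enorm.pow_const 2
    rw [← lintegral_finsetSum _ hmeas]
    refine lintegral_mono fun ξ => ?_
    have h1 : ‖fpart m r K f j ξ‖ ^ 2 ≤ ∑ k ∈ K, ‖wpart m r f j k ξ‖ ^ 2 := by
      calc ‖fpart m r K f j ξ‖ ^ 2 ≤ (∑ k ∈ K, |packet r k ξ| * ‖wpart m r f j k ξ‖) ^ 2 := by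
            gcongr
            refine (norm_sum_le _ _).trans (Finset.sum_le_sum fun k _ => ?_)
            rw [norm_mul, Complex.norm_real, Real.norm_eq_abs]
        _ ≤ (∑ k ∈ K, |packet r k ξ| ^ 2) * ∑ k ∈ K, ‖wpart m r f j k ξ‖ ^ 2 :=
            Finset.sum_mul_sq_le_sq_mul_sq _ _ _
        _ ≤ 1 * ∑ k ∈ K, ‖wpart m r f j k ξ‖ ^ 2 := by
            gcongr
            simpa using sum_packet_le K r ξ
        _ = _ := one_mul _
    have h2 := ENNReal.ofReal_le_ofReal h1
    rw [ENNReal.ofReal_sum_of_nonneg fun k _ => sq_nonneg _] at h2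
    simpa only [ENNReal.ofReal_pow (norm_nonneg _), ofReal_norm] using h2
  calc _ ≤ ∑ j, ∑ k ∈ K, E2 (wpart m r f j k) := Finset.sum_le_sum fun j _ => hj j
    _ = ∑ k ∈ K, ∑ j, E2 (wpart m r f j k) := Finset.sum_comm
    _ ≤ ∑ k ∈ K, E2 fun ξ => (packet r k ξ : ℂ) * f ξ :=
        Finset.sum_le_sum fun k _ => H.sum_E2_wpart_le r hf k
    _ ≤ E2 f := sum_E2_packet_le r K f

end MassFamily

lemma E2_packet_mul_le (r : ℝ) (k : ι → ℤ) (g : 𝔼 → ℂ) :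
    E2 (fun ξ => (packet r k ξ : ℂ) * g ξ) ≤ E2 g := by
  have h1 := sum_E2_packet_le r {k} g
  rwa [Finset.sum_singleton] at h1

lemma nice_packet_mul_wpart [Nonempty J] {m : J → (ι → ℤ) → 𝔼 → ℝ≥0∞} (H : MassFamily m) {r : ℝ}
    (hr : 0 < r) {f : 𝔼 → ℂ} (hf : MemLp f 2 volume) (j : J) (k : ι → ℤ) :
    Nice fun ξ => (packet r k ξ : ℂ) * wpart m r f j k ξ := by
  refine nice_of_bounded ?_ (hasCompactSupport_packet hr k).isCompact.isBounded ?_ ?_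
  · exact (Complex.continuous_ofReal.comp (continuous_packet r k)).measurable.mul
      (l2Fourier_measurable _)
  · intro ξ hξ
    refine subset_tsupport _ ?_
    rw [Function.mem_support] at hξ ⊢
    intro h
    exact hξ (by simp [h])
  · exact ((E2_packet_mul_le r k _).trans (MassFamily.E2_wpart_le H r hf j k)).trans_lt
      (lintegral_sq_lt_top hf) |>.ne

lemma nice_finsetSum {S : Type*}
    (s : Finset S) {F : S → 𝔼 → ℂ} (hF : ∀ k ∈ s, Nice (F k)) : Nice fun ξ => ∑ k ∈ s, F k ξ :=
  ⟨Finset.measurable_sum s fun k hk => (hF k hk).meas,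
    integrable_finsetSum s fun k hk => (hF k hk).int,
    memLp_finsetSum s fun k hk => (hF k hk).mem⟩

lemma nice_fpart [Nonempty J] {m : J → (ι → ℤ) → 𝔼 → ℝ≥0∞} (H : MassFamily m) {r : ℝ}
    (hr : 0 < r) (K : Finset (ι → ℤ)) {f : 𝔼 → ℂ} (hf : MemLp f 2 volume) (j : J) :
    Nice (fpart m r K f j) :=
  nice_finsetSum K fun k _ => nice_packet_mul_wpart H hr hf j k

lemma ext_finsetSum {S : Type*} (s : Finset S) {F : S → 𝔼 → ℂ} (hF : ∀ k ∈ s, Nice (F k)) (x : 𝔼)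
    (t : ℂ) : P.ext (fun ξ => ∑ k ∈ s, F k ξ) x t = ∑ k ∈ s, P.ext (F k) x t := by
  have hc : Continuous fun ξ : 𝔼 => (𝐞 (inner ℝ ξ x + P.ph t ξ) : ℂ) :=
    contDiff_fourierChar.continuous.comp
      ((continuous_id.inner continuous_const).add
        (P.continuous_ph.comp (Continuous.prodMk_right t)))
  have : ∀ k ∈ s, Integrable fun ξ => (𝐞 (inner ℝ ξ x + P.ph t ξ) : ℂ) * F k ξ := by
    intro k hk
    exact (hF k hk).int.bdd_mul (c := 1) hc.aestronglyMeasurable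
      (Filter.Eventually.of_forall fun ξ => (Circle.norm_coe _).le)
  unfold ext
  rw [← integral_finsetSum s this]
  simp_rw [Finset.mul_sum]

lemma ext_congr {f g : 𝔼 → ℂ} (e : f =ᵐ[volume] g) (x : 𝔼) (t : ℂ) : P.ext f x t = P.ext g x t :=
  integral_congr_ae (by filter_upwards [e] with ξ h; rw [h])

end QuadPhase

lemma lintegral_mul_lintegral_swap {X Y Z : Type*} [MeasurableSpace X] [MeasurableSpace Y]
    [MeasurableSpace Z] (μ : Measure X) (ν : Measure Y) (π : Measure Z) [SFinite μ] [SFinite ν]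
    [SFinite π] {S : X × Y → ℝ≥0∞} {W : (X × Y) × Z → ℝ≥0∞} {u : Z → ℝ≥0∞} (hS : Measurable S)
    (hW : Measurable W) (hu : Measurable u) :
    ∫⁻ x, ∫⁻ y, S (x, y) * ∫⁻ z, W ((x, y), z) * u z ∂π ∂ν ∂μ =
      ∫⁻ z, u z * ∫⁻ x, ∫⁻ y, S (x, y) * W ((x, y), z) ∂ν ∂μ ∂π := by
  have hF : Measurable fun w : (X × Y) × Z => S w.1 * (W w * u w.2) :=
    (hS.comp measurable_fst).mul (hW.mul (hu.comp measurable_snd))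
  have hWz : ∀ p : X × Y, Measurable fun z => W (p, z) := fun p => hW.comp measurable_prodMk_left
  have hWp : ∀ z : Z, Measurable fun p => W (p, z) := fun z => hW.comp measurable_prodMk_right
  calc _ = ∫⁻ x, ∫⁻ y, ∫⁻ z, S (x, y) * (W ((x, y), z) * u z) ∂π ∂ν ∂μ := by
        refine lintegral_congr fun x => lintegral_congr fun y => ?_
        have hm : Measurable fun z => W ((x, y), z) * u z := (hWz (x, y)).mul hu
        rw [lintegral_const_mul _ hm]
    _ = ∫⁻ p, ∫⁻ z, S p * (W (p, z) * u z) ∂π ∂(μ.prod ν) :=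
        (lintegral_prod (fun p => ∫⁻ z, S p * (W (p, z) * u z) ∂π)
          hF.lintegral_prod_right'.aemeasurable).symm
    _ = ∫⁻ z, ∫⁻ p, S p * (W (p, z) * u z) ∂(μ.prod ν) ∂π :=
        lintegral_lintegral_swap hF.aemeasurable
    _ = _ := by
        refine lintegral_congr fun z => ?_
        have hSW : Measurable fun p => S p * W (p, z) := hS.mul (hWp z)
        rw [← lintegral_prod (fun p => S p * W (p, z)) hSW.aemeasurable,
          ← lintegral_const_mul _ hSW]
        refine lintegral_congr fun p => ?_
        ring

namespace QuadPhase
variable {ι : Type*} [Fintype ι] (P : QuadPhase ι) {J : Type*} [Fintype J]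

local notation "𝔼" => EuclideanSpace ℝ ι

lemma wt_mul_share_le [Nonempty J] {m : J → ℝ≥0∞} (h0 : ∀ j, m j ≠ 0) (h1 : ∀ j, m j ≠ ∞) (i j : J)
    {w M' : ℝ≥0∞} (hw0 : w ≠ 0) (hw1 : w ≠ ∞) (h : w * m i ≤ M') :
    w * ENNReal.ofReal (share m i ^ 2) * M'⁻¹ ≤ (m j)⁻¹ := by
  have h2 : w * M'⁻¹ ≤ (m i)⁻¹ := by
    calc w * M'⁻¹ ≤ w * (w * m i)⁻¹ := by gcongr
      _ = w * w⁻¹ * (m i)⁻¹ := by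
          rw [ENNReal.mul_inv (Or.inl hw0) (Or.inl hw1), mul_assoc]
      _ = (m i)⁻¹ := by rw [ENNReal.mul_inv_cancel hw0 hw1, one_mul]
  calc w * ENNReal.ofReal (share m i ^ 2) * M'⁻¹ = ENNReal.ofReal (share m i ^ 2) * (w * M'⁻¹) := by
        ring
    _ ≤ (m i * (m j)⁻¹) * (m i)⁻¹ := by
        gcongr
        exact ofReal_share_sq_le h0 h1 i j
    _ = (m i * (m i)⁻¹) * (m j)⁻¹ := by ring
    _ = (m j)⁻¹ := by rw [ENNReal.mul_inv_cancel (h0 i) (h1 i), one_mul]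

/-- A packet assigned to one mass function is controlled by the other ones. -/
lemma exists_wpart_bound [Nonempty J] : ∃ C : NNReal, ∀ m : J → (ι → ℤ) → 𝔼 → ℝ≥0∞, MassFamily m →
    ∀ r : ℝ, 0 < r →
    (∀ i k y y', ENNReal.ofReal (wt (2 * Fintype.card ι + 3) (r⁻¹ • (y' - y))) * m i k y ≤
      m i k y') → ∀ f : 𝔼 → ℂ, MemLp f 2 volume → ∀ i j k x (t : ℂ), ‖t‖ ≤ 4 * r ^ 2 →
    ‖P.ext (fun ξ => (packet r k ξ : ℂ) * wpart m r f i k ξ) x t‖ₑ ^ 2 *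
        (m i k (x + P.A t (pc r k)))⁻¹ ≤
      C * (ENNReal.ofReal r ^ Fintype.card ι)⁻¹ *
        ∫⁻ y, ENNReal.ofReal (wt (2 * Fintype.card ι + 3) (r⁻¹ • (x + P.A t (pc r k) - y))) *
          (‖l2FourierInv (fun ξ => (packet r k ξ : ℂ) * f ξ) y‖ₑ ^ 2 * (m j k y)⁻¹) := by
  obtain ⟨C, hC⟩ := P.exists_packet_bound
    (N := (2 * Fintype.card ι + 3) + (2 * Fintype.card ι + 3)) (by omega)
  refine ⟨C, fun m H r hr hm f hf i j k x t ht => ?_⟩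
  set N := 2 * Fintype.card ι + 3 with hN
  set hk := l2FourierInv fun ξ => (packet r k ξ : ℂ) * f ξ with hhk
  have hp : MemLp hk 2 volume := l2FourierInv_memLp (memLp_packet_mul k hf)
  have h1 := hC r hr k _ (wpart m r f i k) (H.memLp_share_mul k hp i) Filter.EventuallyEq.rfl x t ht
  have hM : (m i k (x + P.A t (pc r k)))⁻¹ ≠ ∞ := ENNReal.inv_ne_top.2 (H.ne_zero _ _ _)
  refine (mul_le_mul_left h1 _).trans ?_
  rw [mul_assoc]
  refine mul_le_mul_right ?_ _
  rw [← lintegral_mul_const' _ _ hM]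
  refine lintegral_mono fun y => ?_
  have e : r⁻¹ • (x - y + P.A t (pc r k)) = r⁻¹ • (x + P.A t (pc r k) - y) := by
    congr 1; abel
  have hw := wt_pos N (r⁻¹ • (x + P.A t (pc r k) - y))
  have h2 := wt_mul_share_le (J := J) (fun i => H.ne_zero i k y) (fun i => H.ne_top i k y) i j
    (ENNReal.ofReal_pos.2 hw).ne' ENNReal.ofReal_ne_top (hm i k y (x + P.A t (pc r k)))
  have h0 := share_nonneg (fun i => m i k y) i
  rw [e, wt_add, ENNReal.ofReal_mul hw.le, enorm_mul, mul_pow, ← ofReal_norm (_ : ℂ),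
    Complex.norm_real, Real.norm_of_nonneg h0, ← ENNReal.ofReal_pow h0]
  set W := ENNReal.ofReal (wt N (r⁻¹ • (x + P.A t (pc r k) - y)))
  set s := ENNReal.ofReal (share (fun i => m i k y) i ^ 2)
  calc W * W * (s * ‖hk y‖ₑ ^ 2) * (m i k (x + P.A t (pc r k)))⁻¹
      = W * (‖hk y‖ₑ ^ 2 * (W * s * (m i k (x + P.A t (pc r k)))⁻¹)) := by ring
    _ ≤ _ := by gcongr

/-- Multiplying and dividing by the mass functions. -/
lemma exists_weighted_bound [Nonempty J] : ∃ C : NNReal, ∀ (r : ℝ), 0 < r →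
    ∀ (q : J → Set ℂ), (∀ j, MeasurableSet (q j)) →
    (∀ j, q j ⊆ Metric.closedBall 0 (4 * r ^ 2)) → ∀ (K L : Finset (ι → ℤ)) (g : J → 𝔼 → ℂ),
    (∀ j, Nice (g j)) → ∀ f : 𝔼 → ℂ, Nice f → ∀ i j,
    ∫⁻ t in q j, ∫⁻ x, ∑ k ∈ K, ∑ l ∈ L,
      ‖P.ext (fun ξ => (packet r k ξ : ℂ) *
          wpart (fun j => P.mass (q j) L (g j) r) r f i k ξ) x t‖ₑ ^ 2 *
        ‖P.ext (piece r (g j) l) x t‖ₑ ^ 2 *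
        (P.mass (q i) L (g i) r k (x + P.A t (pc r k)))⁻¹ ≤
      C * (ENNReal.ofReal r ^ Fintype.card ι)⁻¹ * E2 f := by
  obtain ⟨C, hC⟩ := P.exists_wpart_bound (J := J)
  refine ⟨C, fun r hr q hqm hq K L g hg f hf i j => ?_⟩
  set m : J → (ι → ℤ) → 𝔼 → ℝ≥0∞ := fun j => P.mass (q j) L (g j) r with hm
  have H : MassFamily m := ⟨fun j k => P.measurable_mass _ _ (hg j) r k,
    fun j k y => P.mass_ne_zero _ _ _ r k y, fun j k y => P.mass_ne_top hr (hq j) _ (hg j) k y⟩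
  have hC' := hC m H r hr (fun i k y y' => P.wt_mul_mass_le _ _ _ r k y y') f hf.mem
  set c := (C : ℝ≥0∞) * (ENNReal.ofReal r ^ Fintype.card ι)⁻¹ with hc
  set S : ℂ × 𝔼 → ℝ≥0∞ := fun w => ∑ l ∈ L, ‖P.ext (piece r (g j) l) w.2 w.1‖ₑ ^ 2 with hS
  have hSm : Measurable S := P.measurable_sum_piece L (hg j) r
  set W : (ι → ℤ) → (ℂ × 𝔼) × 𝔼 → ℝ≥0∞ := fun k w =>
    ENNReal.ofReal (wt (2 * Fintype.card ι + 3) (r⁻¹ • (w.1.2 + P.A w.1.1 (pc r k) - w.2))) with hW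
  have hWm : ∀ k, Measurable (W k) := by
    intro k
    refine ENNReal.measurable_ofReal.comp (Continuous.measurable ?_)
    refine (continuous_wt _).comp ?_
    have : Continuous fun w : (ℂ × 𝔼) × 𝔼 => P.A w.1.1 (pc r k) :=
      (P.A.flip (pc r k)).continuous.comp (continuous_fst.comp continuous_fst)
    fun_prop
  set u : (ι → ℤ) → 𝔼 → ℝ≥0∞ := fun k y =>
    ‖l2FourierInv (fun ξ => (packet r k ξ : ℂ) * f ξ) y‖ₑ ^ 2 * (m j k y)⁻¹ with hu
  have hum : ∀ k, Measurable (u k) := fun k =>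
    ((l2FourierInv_measurable _).enorm.pow_const 2).mul (H.meas j k).inv
  have hG : ∀ k ∈ K, Measurable fun w : ℂ × 𝔼 =>
      S (w.1, w.2) * ∫⁻ y, W k ((w.1, w.2), y) * u k y := by
    intro k _
    have h2 : Measurable fun w : (ℂ × 𝔼) × 𝔼 => W k w * u k w.2 :=
      (hWm k).mul ((hum k).comp measurable_snd)
    exact hSm.mul h2.lintegral_prod_right'
  calc _ ≤ ∫⁻ t in q j, ∫⁻ x, c * ∑ k ∈ K, S (t, x) * ∫⁻ y, W k ((t, x), y) * u k y := by
        refine setLIntegral_mono' (hqm j) fun t ht => lintegral_mono fun x => ?_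
        rw [Finset.mul_sum]
        refine Finset.sum_le_sum fun k _ => ?_
        have ht' : ‖t‖ ≤ 4 * r ^ 2 := by simpa using hq j ht
        calc _ = S (t, x) * (‖P.ext (fun ξ => (packet r k ξ : ℂ) * wpart m r f i k ξ) x t‖ₑ ^ 2 *
              (m i k (x + P.A t (pc r k)))⁻¹) := by
              rw [hS, Finset.sum_mul]
              refine Finset.sum_congr rfl fun l _ => ?_
              ring
          _ ≤ S (t, x) * (c * ∫⁻ y, W k ((t, x), y) * u k y) := by
              exact mul_le_mul_right (hC' i j k x t ht') _
          _ = _ := by ring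
    _ = c * ∑ k ∈ K, ∫⁻ t in q j, ∫⁻ x, S (t, x) * ∫⁻ y, W k ((t, x), y) * u k y := by
        rw [← lintegral_lintegral_finsetSum _ _ K hG]
        have hct : c ≠ ∞ := ENNReal.mul_ne_top ENNReal.coe_ne_top
          (ENNReal.inv_ne_top.2 (pow_ne_zero _ (ENNReal.ofReal_pos.2 hr).ne'))
        rw [← lintegral_const_mul' _ _ hct]
        refine lintegral_congr fun t => ?_
        rw [lintegral_const_mul' _ _ hct]
    _ = c * ∑ k ∈ K, ∫⁻ y, u k y * ∫⁻ t in q j, ∫⁻ x, S (t, x) * W k ((t, x), y) := by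
        congr 1
        refine Finset.sum_congr rfl fun k _ => ?_
        exact lintegral_mul_lintegral_swap _ _ _ hSm (hWm k) (hum k)
    _ ≤ c * ∑ k ∈ K, E2 fun ξ => (packet r k ξ : ℂ) * f ξ := by
        gcongr with k _
        rw [← E2_l2FourierInv (memLp_packet_mul k hf.mem)]
        refine lintegral_mono fun y => ?_
        calc u k y * _ ≤ u k y * m j k y := by
              gcongr
              exact le_add_self
          _ = ‖l2FourierInv (fun ξ => (packet r k ξ : ℂ) * f ξ) y‖ₑ ^ 2 := by
              rw [hu, mul_assoc, ENNReal.inv_mul_cancel (H.ne_zero _ _ _) (H.ne_top _ _ _), mul_one]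
    _ ≤ _ := by
        gcongr
        exact sum_E2_packet_le r K f

end QuadPhase

/-- A bound for all localizations to discs gives a global bound. -/
lemma setLIntegral_le_of_forall_closedBall {F : ℂ → ℝ≥0∞} (hF : Measurable F) {q : Set ℂ}
    (hq : MeasurableSet q) {R h : ℝ} (hh : 0 < h) (hR : h ≤ R) (hqR : q ⊆ Metric.closedBall 0 R)
    {B : ℝ≥0∞} (hB : ∀ t₀, ∫⁻ t in q ∩ Metric.closedBall t₀ (h / 2), F t ≤ B) :
    ∫⁻ t in q, F t ≤ 16 * ENNReal.ofReal ((R / h) ^ 2) * B := by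
  have hπ0 : (NNReal.pi : ℝ≥0∞) ≠ 0 := by simpa using NNReal.pi_ne_zero
  set E : Set (ℂ × ℂ) := {w | dist w.2 w.1 ≤ h / 2} with hE
  have hEm : MeasurableSet E := measurableSet_le (by fun_prop) measurable_const
  have h1 : ∫⁻ t₀ in Metric.closedBall (0 : ℂ) (2 * R), ∫⁻ t in q,
      E.indicator (fun w => F w.2) (t₀, t) =
      ∫⁻ t in q, ∫⁻ t₀ in Metric.closedBall (0 : ℂ) (2 * R), E.indicator (fun w => F w.2) (t₀, t) :=
    lintegral_lintegral_swap ((hF.comp measurable_snd).indicator hEm).aemeasurable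
  have h2 : ∫⁻ t₀ in Metric.closedBall (0 : ℂ) (2 * R), ∫⁻ t in q,
      E.indicator (fun w => F w.2) (t₀, t) ≤ B * (ENNReal.ofReal (2 * R) ^ 2 * NNReal.pi) := by
    calc _ ≤ ∫⁻ t₀ in Metric.closedBall (0 : ℂ) (2 * R), B := by
          refine lintegral_mono fun t₀ => ?_
          refine le_trans (le_of_eq ?_) (hB t₀)
          rw [Set.inter_comm, ← setLIntegral_indicator Metric.isClosed_closedBall.measurableSet]
          rfl
      _ = _ := by
          rw [setLIntegral_const, Complex.volume_closedBall]
  have h3 : ∀ t ∈ q, F t * (ENNReal.ofReal (h / 2) ^ 2 * NNReal.pi) ≤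
      ∫⁻ t₀ in Metric.closedBall (0 : ℂ) (2 * R), E.indicator (fun w => F w.2) (t₀, t) := by
    intro t ht
    calc F t * (ENNReal.ofReal (h / 2) ^ 2 * NNReal.pi)
        = ∫⁻ t₀ in Metric.closedBall t (h / 2), E.indicator (fun w => F w.2) (t₀, t) := by
          rw [← Complex.volume_closedBall t, ← setLIntegral_const]
          refine setLIntegral_congr_fun Metric.isClosed_closedBall.measurableSet fun t₀ h₀ => ?_
          rw [Set.indicator_of_mem]
          rw [Metric.mem_closedBall, dist_comm] at h₀
          exact h₀
      _ ≤ _ := by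
          refine lintegral_mono_set fun t₀ h₀ => ?_
          have := hqR ht
          rw [mem_closedBall_zero_iff] at this ⊢
          rw [Metric.mem_closedBall, dist_eq_norm] at h₀
          calc ‖t₀‖ = ‖(t₀ - t) + t‖ := by rw [sub_add_cancel]
            _ ≤ ‖t₀ - t‖ + ‖t‖ := norm_add_le _ _
            _ ≤ 2 * R := by linarith
  have h4 : (∫⁻ t in q, F t) * (ENNReal.ofReal (h / 2) ^ 2 * NNReal.pi) ≤
      B * (ENNReal.ofReal (2 * R) ^ 2 * NNReal.pi) := by
    rw [← lintegral_mul_const _ hF]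
    exact (setLIntegral_mono' hq h3).trans (h1.symm.le.trans h2)
  have hc0 : ENNReal.ofReal (h / 2) ^ 2 * NNReal.pi ≠ 0 :=
    mul_ne_zero (pow_ne_zero _ (ENNReal.ofReal_pos.2 (by positivity)).ne') hπ0
  have hc1 : ENNReal.ofReal (h / 2) ^ 2 * NNReal.pi ≠ ∞ :=
    ENNReal.mul_ne_top (ENNReal.pow_ne_top ENNReal.ofReal_ne_top) ENNReal.coe_ne_top
  refine (ENNReal.mul_le_mul_iff_left hc0 hc1).1 (h4.trans (le_of_eq ?_))
  have e : ENNReal.ofReal (2 * R) ^ 2 =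
      16 * ENNReal.ofReal ((R / h) ^ 2) * ENNReal.ofReal (h / 2) ^ 2 := by
    have h0 : 0 ≤ R := hh.le.trans hR
    rw [← ENNReal.ofReal_pow (by positivity), ← ENNReal.ofReal_pow (by positivity),
      show (16 : ℝ≥0∞) = ENNReal.ofReal 16 by norm_num, ← ENNReal.ofReal_mul (by positivity),
      ← ENNReal.ofReal_mul (by positivity)]
    congr 1
    field_simp
    ring
  rw [e]; ring

namespace QuadPhase
variable {ι : Type*} [Fintype ι] (P : QuadPhase ι) {J : Type*} [Fintype J]

local notation "𝔼" => EuclideanSpace ℝ ι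

/-- Quantitative transversality of two bounded sets of frequencies. -/
structure Transv (c₀ ρ : ℝ) (S T : Set 𝔼) : Prop where
  norm_left : ∀ ξ ∈ S, ‖ξ‖ ≤ ρ
  norm_right : ∀ η ∈ T, ‖η‖ ≤ ρ
  left : ∀ ξ ∈ S, ∀ η ∈ T, ∀ η' ∈ T, c₀ ≤ ‖P.B (ξ - η) (η' - ξ)‖
  right : ∀ η ∈ T, ∀ ξ ∈ S, ∀ ξ' ∈ S, c₀ ≤ ‖P.B (η - ξ) (ξ' - η)‖

lemma Transv.symm {P : QuadPhase ι} {c₀ ρ : ℝ} {S T : Set 𝔼} (h : P.Transv c₀ ρ S T) :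
    P.Transv c₀ ρ T S :=
  ⟨h.norm_right, h.norm_left, h.right, h.left⟩

lemma Transv.mono {P : QuadPhase ι} {c₀ ρ : ℝ} {S T S' T' : Set 𝔼} (h : P.Transv c₀ ρ S T)
    (hS : S' ⊆ S) (hT : T' ⊆ T) : P.Transv c₀ ρ S' T' :=
  ⟨fun ξ hξ => h.norm_left ξ (hS hξ), fun ξ hξ => h.norm_right ξ (hT hξ),
    fun ξ hξ η hη η' hη' => h.left ξ (hS hξ) η (hT hη) η' (hT hη'),
    fun ξ hξ η hη η' hη' => h.right ξ (hT hξ) η (hS hη) η' (hS hη')⟩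

lemma exists_local_bound [Nonempty J] {c₀ ρ X : ℝ} (hc₀ : 0 < c₀) (hρ : 0 ≤ ρ) (hX : 0 ≤ X)
    (N : ℕ) : ∃ C : NNReal, ∀ (r h : ℝ), 1 ≤ r → 0 < h → h ≤ r ^ 2 → ∀ S T : Set 𝔼,
    P.Transv c₀ ρ S T → ∀ K L : Finset (ι → ℤ), (∀ k ∈ K, pc r k ∈ S) → (∀ l ∈ L, pc r l ∈ T) →
    (K.card : ℝ) ≤ X * r ^ Fintype.card ι → (L.card : ℝ) ≤ X * r ^ Fintype.card ι →
    ∀ (q : J → Set ℂ), (∀ j, MeasurableSet (q j)) →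
    (∀ j, q j ⊆ Metric.closedBall 0 (4 * r ^ 2)) →
    (∀ i j, i ≠ j → ∀ s ∈ q i, ∀ t ∈ q j, h ≤ ‖s - t‖) →
    ∀ f : 𝔼 → ℂ, Nice f → E2 f ≤ 1 → ∀ g : J → 𝔼 → ℂ, (∀ j, Nice (g j)) → (∀ j, E2 (g j) ≤ 1) →
    ∀ i j, i ≠ j → ∀ t₀, (∀ t, ‖t - t₀‖ < h → t ∈ q j) →
    ∫⁻ t, ‖tcut t₀ h t‖ₑ * ∫⁻ x,
      ‖P.ext (fpart (fun j => P.mass (q j) L (g j) r) r K f i) x t *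
        ∑ l ∈ L, P.ext (piece r (g j) l) x t‖ₑ ^ 2 ≤
      C * (ENNReal.ofReal ((r ^ 2 / h) ^ (2 * Fintype.card ι) * r ^ 2) *
          (ENNReal.ofReal r ^ Fintype.card ι)⁻¹ +
        ENNReal.ofReal (r ^ (4 * Fintype.card ι) * (h ^ 2 * (r / h) ^ N))) := by
  classical
  obtain ⟨c, C₁, hc, h₁⟩ := P.exists_bilinear_sq_bound ρ N
  obtain ⟨C₂, h₂⟩ := P.exists_sum_mass_le hc₀ hc (ρ := 2 * ρ) (by positivity) hX
  obtain ⟨C₃, h₃⟩ := P.exists_weighted_bound (J := J)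
  refine ⟨C₁ * C₂ * C₃ + C₁ * (X ^ 4).toNNReal, fun r h hr hh hhr S T hST K L hK hL hKc hLc q hqm hq
    hsep f hf hf1 g hg hg1 i j hij t₀ ht₀ => ?_⟩
  have hr0 : 0 < r := by linarith
  set m : J → (ι → ℤ) → 𝔼 → ℝ≥0∞ := fun j => P.mass (q j) L (g j) r with hm
  have H : MassFamily m := ⟨fun j k => P.measurable_mass _ _ (hg j) r k,
    fun j k y => P.mass_ne_zero _ _ _ r k y, fun j k y => P.mass_ne_top hr0 (hq j) _ (hg j) k y⟩
  set M := ENNReal.ofReal ((r ^ 2 / h) ^ (2 * Fintype.card ι) * r ^ 2) with hM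
  set α : (ι → ℤ) → 𝔼 → ℂ := fun k ξ => (packet r k ξ : ℂ) * wpart m r f i k ξ with hα
  have hαn : ∀ k, Nice (α k) := fun k => nice_packet_mul_wpart H hr0 hf.mem i k
  have hle : ∀ {k ξ} {a : 𝔼 → ℂ}, (packet r k ξ : ℂ) * a ξ ≠ 0 → packet r k ξ ≠ 0 := by
    intro k ξ a h h0
    exact h (by simp [h0])
  have b₁ := h₁ r h hr hh t₀ K L α (fun l => piece r (g j) l)
    (fun k hk => ⟨hαn k, (E2_packet_mul_le r k _).trans ((H.E2_wpart_le r hf.mem i k).trans hf1),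
      fun ξ => hle, hST.norm_left _ (hK k hk)⟩)
    (fun l hl => ⟨nice_piece l (hg j),
      (E2_packet_mul_le r l _).trans ((E2_packet_mul_le r l _).trans (hg1 j)),
      fun ξ => hle (a := fun ξ => (packet r l ξ : ℂ) * g j ξ), hST.norm_right _ (hL l hl)⟩)
    (fun k x t => m i k (x + P.A t (pc r k))) (fun k x t => H.ne_zero _ _ _)
    (fun k x t => H.ne_top _ _ _)
  have e : ∀ x t, P.ext (fpart m r K f i) x t = ∑ k ∈ K, P.ext (α k) x t :=
    fun x t => P.ext_finsetSum K (fun k _ => hαn k) x t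
  simp_rw [e]
  refine b₁.trans ?_
  have b₂ : ∀ t ∈ q j, ∀ x, ∀ k ∈ K, ∀ l' ∈ L,
      ∑ k' ∈ K with P.Near c r k l' k', m i k' (x + P.A t (pc r k')) ≤ C₂ * M := by
    intro t ht x k hk l' hl'
    refine h₂ r h hr hh hhr _ L (g i) (hg i) (hg1 i) ?_ (q i) (hqm i) (hq i) t ?_ k l' ?_ ?_ ?_ x
    · refine le_trans ?_ hKc
      exact_mod_cast Finset.card_filter_le _ _
    · intro s hs
      refine ⟨hsep i j hij s hs t ht, ?_⟩
      have := hq i hs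
      have := hq j ht
      simp only [mem_closedBall_zero_iff] at *
      linarith [norm_sub_le s t]
    · linarith [norm_sub_le (pc r l' : 𝔼) (pc r k), hST.norm_left _ (hK k hk),
        hST.norm_right _ (hL l' hl')]
    · exact fun l hl => hST.left _ (hK k hk) _ (hL l hl) _ (hL l' hl')
    · exact fun k' hk' => (Finset.mem_filter.1 hk').2
  have hCM : (C₂ : ℝ≥0∞) * M ≠ ∞ := ENNReal.mul_ne_top ENNReal.coe_ne_top ENNReal.ofReal_ne_top
  have b₃ : ∫⁻ t : ℂ, ‖tcut t₀ h t‖ₑ * ∫⁻ x, ∑ k ∈ K, ∑ l' ∈ L,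
        ‖P.ext (α k) x t‖ₑ ^ 2 * ‖P.ext (piece r (g j) l') x t‖ₑ ^ 2 *
          (m i k (x + P.A t (pc r k)))⁻¹ *
          ∑ k' ∈ K with P.Near c r k l' k', m i k' (x + P.A t (pc r k')) ≤
      C₂ * M * (C₃ * (ENNReal.ofReal r ^ Fintype.card ι)⁻¹) := by
    calc _ ≤ ∫⁻ t : ℂ, (q j).indicator (fun t => C₂ * M * ∫⁻ x, ∑ k ∈ K, ∑ l' ∈ L,
          ‖P.ext (α k) x t‖ₑ ^ 2 * ‖P.ext (piece r (g j) l') x t‖ₑ ^ 2 *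
          (m i k (x + P.A t (pc r k)))⁻¹) t := by
          refine lintegral_mono fun t => ?_
          by_cases ht : ‖t - t₀‖ < h
          · have htq := ht₀ t ht
            rw [Set.indicator_of_mem htq, ← lintegral_const_mul' _ _ hCM]
            refine (mul_le_of_le_one_left' ?_).trans ?_
            · rw [← ofReal_norm, Real.norm_of_nonneg (tcut_nonneg _ _ _)]
              exact ENNReal.ofReal_le_one.2 (tcut_le_one _ _ _)
            · refine lintegral_mono fun x => ?_
              simp_rw [Finset.mul_sum _ _ ((C₂ : ℝ≥0∞) * M)]
              refine Finset.sum_le_sum fun k hk => Finset.sum_le_sum fun l' hl' => ?_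
              rw [mul_comm]
              exact mul_le_mul_left (b₂ t htq x k hk l' hl') _
          · rw [tcut_eq_zero hh (not_lt.1 ht)]
            simp
      _ = C₂ * M * ∫⁻ t in q j, ∫⁻ x, ∑ k ∈ K, ∑ l' ∈ L,
          ‖P.ext (α k) x t‖ₑ ^ 2 * ‖P.ext (piece r (g j) l') x t‖ₑ ^ 2 *
          (m i k (x + P.A t (pc r k)))⁻¹ := by
          rw [lintegral_indicator (hqm j), lintegral_const_mul' _ _ hCM]
      _ ≤ C₂ * M * (C₃ * (ENNReal.ofReal r ^ Fintype.card ι)⁻¹ * E2 f) := by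
          gcongr
          exact h₃ r hr0 q hqm hq K L g hg f hf i j
      _ ≤ C₂ * M * (C₃ * (ENNReal.ofReal r ^ Fintype.card ι)⁻¹ * 1) := by gcongr
      _ = _ := by rw [mul_one]
  have b₄ : ((K.card : ℝ≥0∞) * L.card) ^ 2 * ENNReal.ofReal (h ^ 2 * (r / h) ^ N) ≤
      ((X ^ 4).toNNReal : ℝ≥0∞) *
        ENNReal.ofReal (r ^ (4 * Fintype.card ι) * (h ^ 2 * (r / h) ^ N)) := by
    rw [← ENNReal.ofReal_natCast, ← ENNReal.ofReal_natCast, ← ENNReal.ofReal_mul (by positivity),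
      ← ENNReal.ofReal_pow (by positivity), ← ENNReal.ofReal_mul (by positivity),
      show ((X ^ 4).toNNReal : ℝ≥0∞) = ENNReal.ofReal (X ^ 4) from rfl,
      ← ENNReal.ofReal_mul (by positivity)]
    refine ENNReal.ofReal_le_ofReal ?_
    rw [← mul_assoc (X ^ 4)]
    refine mul_le_mul_of_nonneg_right ?_ (by positivity)
    calc ((K.card : ℝ) * L.card) ^ 2
        ≤ ((X * r ^ Fintype.card ι) * (X * r ^ Fintype.card ι)) ^ 2 := by gcongr
      _ = X ^ 4 * r ^ (4 * Fintype.card ι) := by ring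
  calc _ ≤ C₁ * (C₂ * M * (C₃ * (ENNReal.ofReal r ^ Fintype.card ι)⁻¹)) +
        C₁ * (((X ^ 4).toNNReal : ℝ≥0∞) *
          ENNReal.ofReal (r ^ (4 * Fintype.card ι) * (h ^ 2 * (r / h) ^ N))) := by
        rw [mul_assoc (C₁ : ℝ≥0∞) (_ ^ 2)]
        gcongr
    _ = C₁ * C₂ * C₃ * (M * (ENNReal.ofReal r ^ Fintype.card ι)⁻¹) +
        C₁ * ((X ^ 4).toNNReal : ℝ≥0∞) *
          ENNReal.ofReal (r ^ (4 * Fintype.card ι) * (h ^ 2 * (r / h) ^ N)) := by ring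
    _ ≤ _ := by
        push_cast
        rw [mul_add]
        gcongr
        · exact le_self_add
        · exact le_add_self

end QuadPhase

namespace QuadPhase
variable {ι : Type*} [Fintype ι] (P : QuadPhase ι) {J : Type*} [Fintype J]

local notation "𝔼" => EuclideanSpace ℝ ι

lemma sum_piece {r : ℝ} {g : 𝔼 → ℂ} {L : Finset (ι → ℤ)}
    (h : ∀ ξ, g ξ ≠ 0 → ∑ l ∈ L, packet r l ξ ^ 2 = 1) :
    (fun ξ => ∑ l ∈ L, piece r g l ξ) = g := by
  funext ξ
  by_cases hξ : g ξ = 0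
  · simp [piece, hξ]
  · have := h ξ hξ
    simp_rw [piece, ← mul_assoc, ← sq]
    rw [← Finset.sum_mul]
    rw [show ∑ k ∈ L, ((packet r k ξ : ℂ)) ^ 2 = ((∑ k ∈ L, packet r k ξ ^ 2 : ℝ) : ℂ) by
      push_cast; rfl, this, Complex.ofReal_one, one_mul]

lemma card_activeSet_ceil_le {r ρ : ℝ} (hr : 1 ≤ r) (hρ : 0 ≤ ρ) (T : Set 𝔼) :
    ((activeSet r ⌈ρ * r + 1⌉₊ T).card : ℝ) ≤
      (2 * ρ + 5) ^ Fintype.card ι * r ^ Fintype.card ι := by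
  have h1 : ((activeSet r ⌈ρ * r + 1⌉₊ T).card : ℝ) ≤
      (2 * (⌈ρ * r + 1⌉₊ : ℝ) + 1) ^ Fintype.card ι := by
    exact_mod_cast card_activeSet_le r ⌈ρ * r + 1⌉₊ T
  rw [← mul_pow]
  refine h1.trans (pow_le_pow_left₀ (by positivity) ?_ _)
  have := (Nat.ceil_lt_add_one (show 0 ≤ ρ * r + 1 by positivity)).le
  nlinarith

lemma sum_packet_activeSet_ceil {r ρ : ℝ} (hr : 1 ≤ r) {T : Set 𝔼} (hT : ∀ ξ ∈ T, ‖ξ‖ ≤ ρ)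
    {f : 𝔼 → ℂ} (hf : Function.support f ⊆ T) (ξ : 𝔼) (hξ : f ξ ≠ 0) :
    ∑ k ∈ activeSet r ⌈ρ * r + 1⌉₊ T, packet r k ξ ^ 2 = 1 := by
  refine sum_packet_activeSet (by linarith) ((?_ : _ ≤ _).trans (Nat.le_ceil _)) (hf hξ)
  have := hT ξ (hf hξ)
  nlinarith

lemma pc_mem_of_mem_activeSet {r : ℝ} (hr : 0 < r) {M : ℕ} {S S' : Set 𝔼}
    (hS : ∀ ξ ∈ S, Metric.closedBall ξ (Fintype.card ι / r) ⊆ S') {k : ι → ℤ}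
    (hk : k ∈ activeSet r M S) : (pc r k : 𝔼) ∈ S' := by
  obtain ⟨ξ, hξ, h⟩ := exists_of_mem_activeSet hk
  refine hS ξ hξ ?_
  rw [Metric.mem_closedBall, dist_comm, dist_eq_norm]
  exact norm_sub_pc_le hr h

lemma exists_near_of_fpart_ne_zero {m : J → (ι → ℤ) → 𝔼 → ℝ≥0∞} {r : ℝ} (hr : 0 < r) {M : ℕ}
    {S : Set 𝔼} {f : 𝔼 → ℂ} {j : J} {ξ : 𝔼} (h : fpart m r (activeSet r M S) f j ξ ≠ 0) :
    ∃ ξ₀ ∈ S, ‖ξ - ξ₀‖ ≤ 2 * Fintype.card ι / r := by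
  obtain ⟨k, hk, hne⟩ := Finset.exists_ne_zero_of_sum_ne_zero h
  obtain ⟨ξ₀, h₀, hne₀⟩ := exists_of_mem_activeSet hk
  have h1 : packet r k ξ ≠ 0 := fun h0 => hne (by simp [h0])
  refine ⟨ξ₀, h₀, ?_⟩
  have h2 := norm_sub_pc_le hr h1
  have h3 := norm_sub_pc_le hr hne₀
  calc ‖ξ - ξ₀‖ = ‖(ξ - pc r k) - (ξ₀ - pc r k)‖ := by congr 1; abel
    _ ≤ _ := norm_sub_le _ _
    _ ≤ Fintype.card ι / r + Fintype.card ι / r := add_le_add h2 h3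
    _ = _ := by ring

lemma measurable_lintegral_ext_mul {f g : 𝔼 → ℂ} (hf : Nice f) (hg : Nice g) :
    Measurable fun t : ℂ => ∫⁻ x, ‖P.ext f x t * P.ext g x t‖ₑ ^ 2 := by
  have h1 := P.measurable_ext_swap hf.meas
  have h2 := P.measurable_ext_swap hg.meas
  have h3 : Measurable fun w : ℂ × 𝔼 => ‖P.ext f w.2 w.1 * P.ext g w.2 w.1‖ₑ ^ 2 :=
    (h1.mul h2).enorm.pow_const 2
  exact h3.lintegral_prod_right'

/-- Splitting `f` relative to separated sets of times so that the parts of `f` interact weakly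
with the functions `g` at the other times. -/
lemma exists_split [Nonempty J] {c₀ ρ : ℝ} (hc₀ : 0 < c₀) (hρ : 0 ≤ ρ) (N : ℕ) :
    ∃ C : NNReal, ∀ (r h : ℝ), 1 ≤ r → 0 < h → h ≤ r ^ 2 → ∀ S T S' T' : Set 𝔼,
    P.Transv c₀ ρ S' T' → (∀ ξ ∈ S, Metric.closedBall ξ (Fintype.card ι / r) ⊆ S') →
    (∀ ξ ∈ T, Metric.closedBall ξ (Fintype.card ι / r) ⊆ T') →
    ∀ (q : J → Set ℂ), (∀ j, MeasurableSet (q j)) → (∀ j, q j ⊆ Metric.closedBall 0 (r ^ 2)) →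
    (∀ i j, i ≠ j → ∀ s ∈ q i, ∀ t ∈ q j, 8 * h ≤ ‖s - t‖) →
    ∀ f : 𝔼 → ℂ, Nice f → E2 f ≤ 1 → Function.support f ⊆ S →
    ∀ g : J → 𝔼 → ℂ, (∀ j, Nice (g j)) → (∀ j, E2 (g j) ≤ 1) →
    (∀ j, Function.support (g j) ⊆ T) →
    ∃ F : J → 𝔼 → ℂ, (∀ j, Nice (F j)) ∧
      (∀ j ξ, F j ξ ≠ 0 → ∃ ξ₀ ∈ S, ‖ξ - ξ₀‖ ≤ 2 * Fintype.card ι / r) ∧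
      (fun ξ => ∑ j, F j ξ) =ᵐ[volume] f ∧ ∑ j, E2 (F j) ≤ E2 f ∧
      ∀ i j, i ≠ j → ∫⁻ t in q j, ∫⁻ x, ‖P.ext (F i) x t * P.ext (g j) x t‖ₑ ^ 2 ≤
        C * (ENNReal.ofReal ((r ^ 2 / h) ^ 2) *
          (ENNReal.ofReal ((r ^ 2 / h) ^ (2 * Fintype.card ι) * r ^ 2) *
            (ENNReal.ofReal r ^ Fintype.card ι)⁻¹ +
          ENNReal.ofReal (r ^ (4 * Fintype.card ι) * (h ^ 2 * (r / h) ^ N)))) := by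
  obtain ⟨C, hC⟩ := P.exists_local_bound (J := J) hc₀ hρ
    (X := (2 * ρ + 5) ^ Fintype.card ι) (by positivity) N
  refine ⟨16 * C, fun r h hr hh hhr S T S' T' hST hS hT q hqm hq hsep f hf hf1
    hfS g hg hg1 hgT => ?_⟩
  have hr0 : 0 < r := by linarith
  have hself : ∀ {A A' : Set 𝔼}, (∀ ξ ∈ A, Metric.closedBall ξ (Fintype.card ι / r) ⊆ A') →
      A ⊆ A' := fun hA ξ hξ => hA ξ hξ (Metric.mem_closedBall_self (by positivity))
  have hSρ : ∀ ξ ∈ S, ‖ξ‖ ≤ ρ := fun ξ hξ => hST.norm_left ξ (hself hS hξ)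
  have hTρ : ∀ ξ ∈ T, ‖ξ‖ ≤ ρ := fun ξ hξ => hST.norm_right ξ (hself hT hξ)
  set K := activeSet r ⌈ρ * r + 1⌉₊ S with hK
  set L := activeSet r ⌈ρ * r + 1⌉₊ T with hL
  set Q : J → Set ℂ := fun j => Metric.thickening (2 * h) (q j) with hQ
  have hQm : ∀ j, MeasurableSet (Q j) := fun j => Metric.isOpen_thickening.measurableSet
  have hQb : ∀ j, Q j ⊆ Metric.closedBall 0 (4 * r ^ 2) := by
    intro j t ht
    obtain ⟨s, hs, hst⟩ := Metric.mem_thickening_iff.1 ht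
    have h1 := hq j hs
    rw [mem_closedBall_zero_iff] at h1 ⊢
    rw [dist_eq_norm] at hst
    calc ‖t‖ = ‖(t - s) + s‖ := by rw [sub_add_cancel]
      _ ≤ ‖t - s‖ + ‖s‖ := norm_add_le _ _
      _ ≤ _ := by linarith
  have hQs : ∀ i j, i ≠ j → ∀ s ∈ Q i, ∀ t ∈ Q j, h ≤ ‖s - t‖ := by
    intro i j hij s hs t ht
    obtain ⟨s', hs', hss⟩ := Metric.mem_thickening_iff.1 hs
    obtain ⟨t', ht', htt⟩ := Metric.mem_thickening_iff.1 ht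
    have h1 := hsep i j hij s' hs' t' ht'
    rw [← dist_eq_norm] at h1 ⊢
    have h2 := dist_triangle s' s t'
    have h3 := dist_triangle s t t'
    rw [dist_comm s' s] at h2
    linarith
  set m : J → (ι → ℤ) → 𝔼 → ℝ≥0∞ := fun j => P.mass (Q j) L (g j) r with hm
  have H : MassFamily m := ⟨fun j k => P.measurable_mass _ _ (hg j) r k,
    fun j k y => P.mass_ne_zero _ _ _ r k y, fun j k y => P.mass_ne_top hr0 (hQb j) _ (hg j) k y⟩
  refine ⟨fpart m r K f, nice_fpart H hr0 K hf.mem, fun j ξ => exists_near_of_fpart_ne_zero hr0,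
    H.sum_fpart hf.mem (sum_packet_activeSet_ceil hr hSρ hfS), H.sum_E2_fpart_le r K hf.mem,
    fun i j hij => ?_⟩
  have hloc := hC r h hr hh hhr S' T' hST K L (fun k hk => pc_mem_of_mem_activeSet hr0 hS hk)
    (fun k hk => pc_mem_of_mem_activeSet hr0 hT hk) (card_activeSet_ceil_le hr hρ S)
    (card_activeSet_ceil_le hr hρ T) Q hQm hQb hQs f hf hf1 g hg hg1 i j hij
  have eg : ∀ x t, ∑ l ∈ L, P.ext (piece r (g j) l) x t = P.ext (g j) x t := by
    intro x t
    rw [← P.ext_finsetSum L (fun l _ => nice_piece l (hg j)),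
      sum_piece (sum_packet_activeSet_ceil hr hTρ (hgT j))]
  simp_rw [eg] at hloc
  have hmeas := P.measurable_lintegral_ext_mul (nice_fpart H hr0 K hf.mem i) (hg j)
  refine (setLIntegral_le_of_forall_closedBall hmeas (hqm j) hh hhr (hq j)
    (B := C * (ENNReal.ofReal ((r ^ 2 / h) ^ (2 * Fintype.card ι) * r ^ 2) *
          (ENNReal.ofReal r ^ Fintype.card ι)⁻¹ +
        ENNReal.ofReal (r ^ (4 * Fintype.card ι) * (h ^ 2 * (r / h) ^ N)))) fun t₀ => ?_).trans
    (le_of_eq (by push_cast; ring))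
  rcases (q j ∩ Metric.closedBall t₀ (h / 2)).eq_empty_or_nonempty with he | ⟨s, hs, hst⟩
  · rw [he]; simp
  refine le_trans ?_ (hloc t₀ fun t ht => ?_)
  · rw [← lintegral_indicator ((hqm j).inter Metric.isClosed_closedBall.measurableSet)]
    refine lintegral_mono fun t => ?_
    by_cases ht : t ∈ q j ∩ Metric.closedBall t₀ (h / 2)
    · rw [Set.indicator_of_mem ht, tcut_eq_one hh (by simpa [dist_eq_norm] using ht.2)]
      simp [hm]
    · rw [Set.indicator_of_notMem ht]
      exact zero_le
  · refine Metric.mem_thickening_iff.2 ⟨s, hs, ?_⟩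
    rw [← dist_eq_norm] at ht
    rw [Metric.mem_closedBall, dist_comm] at hst
    linarith [dist_triangle t t₀ s]

end QuadPhase

section Boxes

/-- The closed square of half side `R` around `c`. -/
def sqBox (c : ℂ) (R : ℝ) : Set ℂ := {t | |t.re - c.re| ≤ R ∧ |t.im - c.im| ≤ R}

lemma isClosed_sqBox (c : ℂ) (R : ℝ) : IsClosed (sqBox c R) := by
  have h1 : IsClosed {t : ℂ | |t.re - c.re| ≤ R} := isClosed_le
    (Complex.continuous_re.sub continuous_const).abs continuous_const
  have h2 : IsClosed {t : ℂ | |t.im - c.im| ≤ R} := isClosed_le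
    (Complex.continuous_im.sub continuous_const).abs continuous_const
  exact h1.inter h2

lemma sqBox_subset_closedBall (c : ℂ) (R : ℝ) : sqBox c R ⊆ Metric.closedBall c (2 * R) := by
  intro t ht
  rw [mem_closedBall_iff_norm]
  refine (Complex.norm_le_abs_re_add_abs_im _).trans ?_
  rw [Complex.sub_re, Complex.sub_im]
  linarith [ht.1, ht.2]

/-- The four parts of a square left after removing a vertical and a horizontal strip. -/
def quarter (R a b w : ℝ) (β : Bool × Bool) : Set ℂ :=
  sqBox 0 R ∩ {t | (if β.1 then t.re < a else a + w ≤ t.re) ∧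
    (if β.2 then t.im < b else b + w ≤ t.im)}

lemma measurableSet_quarter (R a b w : ℝ) (β : Bool × Bool) :
    MeasurableSet (quarter R a b w β) := by
  refine (isClosed_sqBox 0 R).measurableSet.inter (MeasurableSet.inter ?_ ?_)
  · cases β.1
    · exact measurableSet_le measurable_const Complex.measurable_re
    · exact measurableSet_lt Complex.measurable_re measurable_const
  · cases β.2
    · exact measurableSet_le measurable_const Complex.measurable_im
    · exact measurableSet_lt Complex.measurable_im measurable_const

lemma le_norm_sub_of_mem_quarter {R a b w : ℝ} {β β' : Bool × Bool} (h : β ≠ β')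
    {s t : ℂ} (hs : s ∈ quarter R a b w β) (ht : t ∈ quarter R a b w β') : w ≤ ‖s - t‖ := by
  have h1 : w ≤ |s.re - t.re| ∨ w ≤ |s.im - t.im| := by
    obtain ⟨-, hs1, hs2⟩ := hs
    obtain ⟨-, ht1, ht2⟩ := ht
    obtain ⟨β₁, β₂⟩ := β
    obtain ⟨β₁', β₂'⟩ := β'
    cases β₁ <;> cases β₂ <;> cases β₁' <;> cases β₂' <;>
      simp only [Bool.false_eq_true, if_true, if_false] at hs1 hs2 ht1 ht2 <;>
      first
      | exact absurd rfl h
      | (left; rw [le_abs]; left; linarith)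
      | (left; rw [le_abs]; right; linarith)
      | (right; rw [le_abs]; left; linarith)
      | (right; rw [le_abs]; right; linarith)
  rcases h1 with h1 | h1
  · exact h1.trans (by simpa using Complex.abs_re_le_norm (s - t))
  · exact h1.trans (by simpa using Complex.abs_im_le_norm (s - t))

lemma exists_quarter_subset {R a b w : ℝ} (ha : |a| ≤ R / 2) (ha' : |a + w| ≤ R / 2)
    (hb : |b| ≤ R / 2) (hb' : |b + w| ≤ R / 2) (β : Bool × Bool) :
    ∃ c, quarter R a b w β ⊆ sqBox c (3 / 4 * R) := by
  rw [abs_le] at ha ha' hb hb'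
  obtain ⟨β₁, β₂⟩ := β
  refine ⟨⟨if β₁ then -(R / 4) else R / 4, if β₂ then -(R / 4) else R / 4⟩, fun t ht => ?_⟩
  obtain ⟨⟨h1, h2⟩, h3, h4⟩ := ht
  simp only [Complex.zero_re, Complex.zero_im, sub_zero, abs_le] at h1 h2
  cases β₁ <;> cases β₂ <;>
    simp only [Bool.false_eq_true, if_true, if_false] at h3 h4 <;>
    refine ⟨abs_le.2 ⟨?_, ?_⟩, abs_le.2 ⟨?_, ?_⟩⟩ <;>
    simp only [Bool.false_eq_true, if_true, if_false] <;> linarith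

lemma sqBox_subset_union (R a b w : ℝ) : sqBox 0 R ⊆ (⋃ β, quarter R a b w β) ∪
    ({t ∈ sqBox 0 R | a ≤ t.re ∧ t.re < a + w} ∪ {t ∈ sqBox 0 R | b ≤ t.im ∧ t.im < b + w}) := by
  intro t ht
  by_cases h1 : a ≤ t.re ∧ t.re < a + w
  · exact Or.inr (Or.inl ⟨ht, h1⟩)
  by_cases h2 : b ≤ t.im ∧ t.im < b + w
  · exact Or.inr (Or.inr ⟨ht, h2⟩)
  refine Or.inl (Set.mem_iUnion.2 ⟨⟨decide (t.re < a), decide (t.im < b)⟩, ht, ?_, ?_⟩)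
  · by_cases h : t.re < a
    · simp [h]
    · simp only [h, decide_false, Bool.false_eq_true, if_false]
      by_contra hlt
      exact h1 ⟨not_lt.1 h, not_le.1 hlt⟩
  · by_cases h : t.im < b
    · simp [h]
    · simp only [h, decide_false, Bool.false_eq_true, if_false]
      by_contra hlt
      exact h2 ⟨not_lt.1 h, not_le.1 hlt⟩

/-- One of `N` disjoint strips carries at most an `N`-th of the mass. -/
lemma exists_strip_le {F : ℂ → ℝ≥0∞} {Q : Set ℂ} (hQ : MeasurableSet Q) {u : ℂ → ℝ}
    (hu : Measurable u) (a₀ : ℝ) {w : ℝ} (hw : 0 < w) {N : ℕ} (hN : 0 < N) :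
    ∃ i < N, (N : ℝ≥0∞) * ∫⁻ t in {t ∈ Q | a₀ + i * w ≤ u t ∧ u t < a₀ + i * w + w}, F t ≤
      ∫⁻ t in Q, F t := by
  set D : ℕ → Set ℂ := fun i => {t ∈ Q | a₀ + i * w ≤ u t ∧ u t < a₀ + i * w + w} with hD
  have hDm : ∀ i, MeasurableSet (D i) := fun i => hQ.inter
    ((measurableSet_le measurable_const hu).inter (measurableSet_lt hu measurable_const))
  have hdisj : Set.PairwiseDisjoint (↑(Finset.range N)) D := by
    have key : ∀ i j : ℕ, i < j → Disjoint (D i) (D j) := by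
      intro i j hij
      rw [Set.disjoint_left]
      rintro t ⟨-, -, h1⟩ ⟨-, h2, -⟩
      have : (i : ℝ) + 1 ≤ j := by exact_mod_cast hij
      nlinarith
    intro i _ j _ hij
    rcases lt_or_gt_of_ne hij with h | h
    · exact key i j h
    · exact (key j i h).symm
  have hsum : ∑ i ∈ Finset.range N, ∫⁻ t in D i, F t ≤ ∫⁻ t in Q, F t := by
    rw [← lintegral_biUnion_finset hdisj fun i _ => hDm i]
    exact lintegral_mono_set (Set.iUnion₂_subset fun i _ t ht => ht.1)
  obtain ⟨i, hi, hmin⟩ := Finset.exists_min_image (Finset.range N) (fun i => ∫⁻ t in D i, F t)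
    ⟨0, Finset.mem_range.2 hN⟩
  refine ⟨i, Finset.mem_range.1 hi, le_trans ?_ hsum⟩
  have := Finset.card_nsmul_le_sum (Finset.range N) (fun i => ∫⁻ t in D i, F t) _ hmin
  rwa [Finset.card_range, nsmul_eq_mul] at this

/-- A square can be cut into four separated parts while losing little mass. -/
lemma exists_quarters {F : ℂ → ℝ≥0∞} {R : ℝ} (hR : 0 < R) {N : ℕ} (hN : 4 ≤ N)
    (hfin : ∫⁻ t in sqBox 0 R, F t ≠ ∞) :
    ∃ a b : ℝ, (∀ β, ∃ c, quarter R a b (R / N) β ⊆ sqBox c (3 / 4 * R)) ∧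
      ∫⁻ t in sqBox 0 R, F t ≤
        ENNReal.ofReal (1 + 4 / N) * ∫⁻ t in ⋃ β, quarter R a b (R / N) β, F t := by
  have hN0 : 0 < N := by omega
  have hNr : (0 : ℝ) < N := by exact_mod_cast hN0
  have hw : 0 < R / N := by positivity
  have hQ := (isClosed_sqBox 0 R).measurableSet
  obtain ⟨i, hi, h1⟩ := exists_strip_le (F := F) hQ Complex.measurable_re (-(R / 2)) hw hN0
  obtain ⟨j, hj, h2⟩ := exists_strip_le (F := F) hQ Complex.measurable_im (-(R / 2)) hw hN0
  have hb : ∀ i : ℕ, i < N → |-(R / 2) + i * (R / N)| ≤ R / 2 ∧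
      |-(R / 2) + i * (R / N) + R / N| ≤ R / 2 := by
    intro i hi
    have h3 : (i : ℝ) + 1 ≤ N := by exact_mod_cast hi
    have h4 : ((i : ℝ) + 1) * (R / N) ≤ R := by
      calc ((i : ℝ) + 1) * (R / N) ≤ N * (R / N) := by gcongr
        _ = R := by field_simp
    have h5 : 0 ≤ (i : ℝ) * (R / N) := by positivity
    constructor <;> rw [abs_le] <;> constructor <;> linarith
  refine ⟨-(R / 2) + i * (R / N), -(R / 2) + j * (R / N),
    exists_quarter_subset (hb i hi).1 (hb i hi).2 (hb j hj).1 (hb j hj).2, ?_⟩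
  set a := -(R / 2) + i * (R / N)
  set b := -(R / 2) + j * (R / N)
  set I := ∫⁻ t in sqBox 0 R, F t with hI
  set U := ∫⁻ t in ⋃ β, quarter R a b (R / N) β, F t with hU
  have h6 : I ≤ U + ((∫⁻ t in {t ∈ sqBox 0 R | a ≤ t.re ∧ t.re < a + R / N}, F t) +
      ∫⁻ t in {t ∈ sqBox 0 R | b ≤ t.im ∧ t.im < b + R / N}, F t) := by
    refine (lintegral_mono_set (sqBox_subset_union R a b (R / N))).trans ?_
    refine (lintegral_union_le _ _ _).trans ?_
    exact add_le_add_right (lintegral_union_le _ _ _) _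
  have hUI : U ≤ I := lintegral_mono_set (Set.iUnion_subset fun β => Set.inter_subset_left)
  have hUf : U ≠ ∞ := ne_top_of_le_ne_top hfin hUI
  have hd : ∀ x : ℝ≥0∞, (N : ℝ≥0∞) * x ≤ I → x ≤ ENNReal.ofReal (I.toReal / N) := by
    intro x hx
    have hx' : x ≤ I / N := by
      rw [ENNReal.le_div_iff_mul_le (Or.inl (by exact_mod_cast hN0.ne')) (Or.inl (by simp)),
        mul_comm]
      exact hx
    refine hx'.trans (le_of_eq ?_)
    rw [ENNReal.ofReal_div_of_pos hNr, ENNReal.ofReal_toReal hfin, ENNReal.ofReal_natCast]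
  have h7 : I.toReal ≤ U.toReal + 2 * (I.toReal / N) := by
    have := h6.trans (add_le_add_right (add_le_add (hd _ h1) (hd _ h2)) U)
    rw [← ENNReal.ofReal_add (by positivity) (by positivity)] at this
    have h8 := (ENNReal.toReal_le_toReal hfin (by finiteness)).2 this
    rw [ENNReal.toReal_add hUf ENNReal.ofReal_ne_top, ENNReal.toReal_ofReal (by positivity)] at h8
    linarith
  rw [← ENNReal.ofReal_toReal hfin, ← ENNReal.ofReal_toReal hUf,
    ← ENNReal.ofReal_mul (by positivity)]
  refine ENNReal.ofReal_le_ofReal ?_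
  have hN4 : (4 : ℝ) ≤ N := by exact_mod_cast hN
  have hI0 : 0 ≤ I.toReal := ENNReal.toReal_nonneg
  have hk : I.toReal * (1 - 2 / N) ≤ U.toReal := by
    have : 2 * (I.toReal / N) = I.toReal * (2 / N) := by ring
    linarith
  have hx : (4 : ℝ) / N ≤ 1 := by rw [div_le_one hNr]; exact hN4
  set x : ℝ := 2 / N with hxdef
  have hx2 : (4 : ℝ) / N = 2 * x := by rw [hxdef]; ring
  rw [hx2] at hx ⊢
  have hx0 : 0 ≤ x := by positivity
  calc I.toReal ≤ (1 + 2 * x) * (I.toReal * (1 - x)) := by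
        nlinarith [mul_nonneg hI0 (mul_nonneg hx0 (show 0 ≤ 1 - 2 * x by linarith))]
    _ ≤ (1 + 2 * x) * U.toReal := by gcongr

end Boxes

namespace QuadPhase
open scoped FourierTransform
variable {ι : Type*} [Fintype ι] (P : QuadPhase ι)

local notation "𝔼" => EuclideanSpace ℝ ι

/-- The `L^q` norm of the product of two extensions over `U × 𝔼`. -/
def bil (q : ℝ) (U : Set ℂ) (f g : 𝔼 → ℂ) : ℝ≥0∞ :=
  eLpNorm (fun w : ℂ × 𝔼 => P.ext f w.2 w.1 * P.ext g w.2 w.1) (ENNReal.ofReal q)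
    ((volume.restrict U).prod volume)

lemma measurable_ext_mul_ext {f g : 𝔼 → ℂ} (hf : Measurable f) (hg : Measurable g) :
    Measurable fun w : ℂ × 𝔼 => P.ext f w.2 w.1 * P.ext g w.2 w.1 :=
  (P.measurable_ext_swap hf).mul (P.measurable_ext_swap hg)

lemma bil_rpow {q : ℝ} (hq : 0 < q) (U : Set ℂ) {f g : 𝔼 → ℂ} (hf : Measurable f)
    (hg : Measurable g) :
    P.bil q U f g ^ q = ∫⁻ t in U, ∫⁻ x, ‖P.ext f x t * P.ext g x t‖ₑ ^ q := by
  have hm := P.measurable_ext_mul_ext hf hg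
  rw [bil, eLpNorm_eq_lintegral_rpow_enorm_toReal (by simpa using hq) (by simp),
    ENNReal.toReal_ofReal hq.le, ← ENNReal.rpow_mul, one_div_mul_cancel hq.ne', ENNReal.rpow_one]
  exact lintegral_prod _ (hm.enorm.pow_const q).aemeasurable

lemma bil_mono (q : ℝ) {U U' : Set ℂ} (h : U ⊆ U') (f g : 𝔼 → ℂ) :
    P.bil q U f g ≤ P.bil q U' f g := by
  refine eLpNorm_mono_measure _ ?_
  exact Measure.prod_mono (Measure.restrict_mono h le_rfl) le_rfl

lemma bil_comm (q : ℝ) (U : Set ℂ) (f g : 𝔼 → ℂ) : P.bil q U f g = P.bil q U g f := by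
  simp only [bil, mul_comm]

lemma ext_modulate (f : 𝔼 → ℂ) (c t : ℂ) (x : 𝔼) :
    P.ext (fun ξ => (𝐞 (P.ph c ξ) : ℂ) * f ξ) x t = P.ext f x (c + t) := by
  unfold ext
  congr 1
  funext ξ
  rw [← mul_assoc]
  congr 1
  rw [P.ph_add_time, ← Circle.coe_mul, ← AddChar.map_add_eq_mul, add_assoc, add_comm (P.ph t ξ)]

lemma E2_modulate (f : 𝔼 → ℂ) (c : ℂ) : E2 (fun ξ => (𝐞 (P.ph c ξ) : ℂ) * f ξ) = E2 f := by
  have h : ∀ ξ, ‖(𝐞 (P.ph c ξ) : ℂ)‖ₑ = 1 := fun ξ => by rw [← ofReal_norm, Circle.norm_coe]; simp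
  simp [E2, enorm_mul, h]

lemma bil_sqBox {q : ℝ} (hq : 0 < q) (c : ℂ) (R : ℝ) {f g : 𝔼 → ℂ} (hf : Nice f) (hg : Nice g) :
    P.bil q (sqBox c R) f g = P.bil q (sqBox 0 R) (fun ξ => (𝐞 (P.ph c ξ) : ℂ) * f ξ)
      (fun ξ => (𝐞 (P.ph c ξ) : ℂ) * g ξ) := by
  refine ENNReal.rpow_left_injective hq.ne' ?_
  change _ ^ q = _ ^ q
  rw [P.bil_rpow hq _ hf.meas hg.meas,
    P.bil_rpow hq _ (P.nice_modulate hf c).meas (P.nice_modulate hg c).meas]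
  simp_rw [P.ext_modulate]
  rw [← lintegral_indicator (isClosed_sqBox c R).measurableSet,
    ← lintegral_indicator (isClosed_sqBox 0 R).measurableSet,
    ← lintegral_add_left_eq_self _ c]
  refine lintegral_congr fun t => ?_
  have : c + t ∈ sqBox c R ↔ t ∈ sqBox 0 R := by simp [sqBox]
  by_cases h : t ∈ sqBox 0 R
  · rw [Set.indicator_of_mem h, Set.indicator_of_mem (this.2 h)]
  · rw [Set.indicator_of_notMem h, Set.indicator_of_notMem (mt this.1 h)]

lemma ext_const_mul (a : ℂ) (f : 𝔼 → ℂ) (x : 𝔼) (t : ℂ) :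
    P.ext (fun ξ => a * f ξ) x t = a * P.ext f x t := by
  unfold ext
  rw [← integral_const_mul]
  congr 1
  funext ξ
  ring

lemma bil_const_mul (q : ℝ) (U : Set ℂ) (a b : ℂ) (f g : 𝔼 → ℂ) :
    P.bil q U (fun ξ => a * f ξ) (fun ξ => b * g ξ) = ‖a * b‖ₑ * P.bil q U f g := by
  unfold bil
  rw [← eLpNorm_const_smul]
  congr 1
  funext w
  simp only [P.ext_const_mul, Pi.smul_apply, smul_eq_mul]
  ring

lemma nice_const_mul {f : 𝔼 → ℂ} (hf : Nice f) (a : ℂ) : Nice (fun ξ => a * f ξ) :=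
  ⟨hf.meas.const_mul a, hf.int.const_mul a, hf.mem.const_mul a⟩

lemma E2_const_mul (a : ℂ) (f : 𝔼 → ℂ) : E2 (fun ξ => a * f ξ) = ‖a‖ₑ ^ 2 * E2 f := by
  simp only [E2, enorm_mul, mul_pow]
  exact lintegral_const_mul' _ _ (by finiteness)

lemma ae_eq_zero_of_E2 {f : 𝔼 → ℂ} (hf : Nice f) (h : E2 f = 0) : f =ᵐ[volume] 0 := by
  rw [E2, lintegral_eq_zero_iff (hf.meas.enorm.pow_const 2)] at h
  filter_upwards [h] with x hx
  simpa using hx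

lemma bil_eq_zero {q : ℝ} {U : Set ℂ} {f g : 𝔼 → ℂ} (hf : Nice f) (h : E2 f = 0) :
    P.bil q U f g = 0 := by
  have : ∀ x t, P.ext f x t = 0 := by
    intro x t
    rw [P.ext_congr (ae_eq_zero_of_E2 hf h)]
    simp [ext]
  simp [bil, this]

lemma exists_normalize {f : 𝔼 → ℂ} (hf : Nice f) (h : E2 f ≠ 0) : ∃ a : ℂ, a ≠ 0 ∧
    ‖a‖ₑ = E2 f ^ (1 / 2 : ℝ) ∧ E2 (fun ξ => a⁻¹ * f ξ) = 1 := by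
  have hfin : E2 f ≠ ∞ := (lintegral_sq_lt_top hf.mem).ne
  set s := E2 f ^ (1 / 2 : ℝ) with hs
  have hs0 : s ≠ 0 := by simp [hs, h, hfin]
  have hst : s ≠ ∞ := by rw [hs]; finiteness
  have hss : s ^ 2 = E2 f := by
    rw [hs, ← ENNReal.rpow_natCast, ← ENNReal.rpow_mul]
    norm_num
  have hn : ‖(s.toReal : ℂ)‖ₑ = s := by
    rw [← ofReal_norm, Complex.norm_real, Real.norm_of_nonneg ENNReal.toReal_nonneg,
      ENNReal.ofReal_toReal hst]
  have hne : (s.toReal : ℂ) ≠ 0 := by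
    rw [Complex.ofReal_ne_zero]
    exact ENNReal.toReal_ne_zero.2 ⟨hs0, hst⟩
  refine ⟨s.toReal, hne, hn, ?_⟩
  rw [E2_const_mul, enorm_inv hne, hn, ← hss, ← mul_pow, ENNReal.inv_mul_cancel hs0 hst, one_pow]

/-- Homogeneity: normalized bounds imply bounds for all functions. -/
lemma bil_le_of_normalized {q : ℝ} {U : Set ℂ} {A : ℝ≥0∞} {S T : Set 𝔼}
    (H : ∀ f g : 𝔼 → ℂ, Nice f → Nice g → E2 f ≤ 1 → E2 g ≤ 1 → Function.support f ⊆ S →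
      Function.support g ⊆ T → P.bil q U f g ≤ A)
    {f g : 𝔼 → ℂ} (hf : Nice f) (hg : Nice g) (hfS : Function.support f ⊆ S)
    (hgT : Function.support g ⊆ T) :
    P.bil q U f g ≤ A * (E2 f ^ (1 / 2 : ℝ) * E2 g ^ (1 / 2 : ℝ)) := by
  by_cases h1 : E2 f = 0
  · rw [P.bil_eq_zero hf h1]; exact zero_le
  by_cases h2 : E2 g = 0
  · rw [P.bil_comm, P.bil_eq_zero hg h2]; exact zero_le
  obtain ⟨a, ha, han, ha1⟩ := exists_normalize hf h1
  obtain ⟨b, hb, hbn, hb1⟩ := exists_normalize hg h2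
  have h3 := H _ _ (nice_const_mul hf a⁻¹) (nice_const_mul hg b⁻¹) ha1.le hb1.le
    (fun ξ hξ => hfS (right_ne_zero_of_mul hξ)) (fun ξ hξ => hgT (right_ne_zero_of_mul hξ))
  have h4 := P.bil_const_mul q U a b (fun ξ => a⁻¹ * f ξ) (fun ξ => b⁻¹ * g ξ)
  simp only [mul_inv_cancel_left₀ ha, mul_inv_cancel_left₀ hb, enorm_mul, han, hbn] at h4
  rw [h4, mul_comm]
  exact mul_le_mul_left h3 _

/-- Interpolation between the trivial `L¹` bound and an `L²` bound. -/
lemma bil_rpow_le_interpolate {q : ℝ} (hq1 : 1 < q) (hq2 : q < 2) (U : Set ℂ) {f g : 𝔼 → ℂ}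
    (hf : Nice f) (hg : Nice g) (hf1 : E2 f ≤ 1) (hg1 : E2 g ≤ 1) :
    P.bil q U f g ^ q ≤ (2 * volume U) ^ (2 - q) *
      (∫⁻ t in U, ∫⁻ x, ‖P.ext f x t * P.ext g x t‖ₑ ^ 2) ^ (q - 1) := by
  have hm := (P.measurable_ext_mul_ext hf.meas hg.meas).enorm
  have h1 : ∫⁻ w, ‖P.ext f w.2 w.1 * P.ext g w.2 w.1‖ₑ ∂((volume.restrict U).prod volume) ≤
      2 * volume U := by
    rw [lintegral_prod _ hm.aemeasurable]
    calc ∫⁻ t in U, ∫⁻ x, ‖P.ext f x t * P.ext g x t‖ₑ ≤ ∫⁻ t in U, 2 := by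
          refine lintegral_mono fun t => ?_
          calc ∫⁻ x, ‖P.ext f x t * P.ext g x t‖ₑ
              ≤ ∫⁻ x, (‖P.ext f x t‖ₑ ^ 2 + ‖P.ext g x t‖ₑ ^ 2) := by
                refine lintegral_mono fun x => ?_
                rw [enorm_mul]
                exact mul_le_sq_add_sq _ _
            _ = E2 f + E2 g := by
                have h2 := (P.measurable_ext hf.meas).comp (measurable_prodMk_right (y := t))
                have h3 : Measurable fun x => P.ext f x t := h2
                rw [lintegral_add_left (h3.enorm.pow_const 2), P.lintegral_sq_ext hf,
                  P.lintegral_sq_ext hg]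
            _ ≤ 2 := (add_le_add hf1 hg1).trans (by norm_num)
      _ = 2 * volume U := by simp
  rw [P.bil_rpow (by linarith) _ hf.meas hg.meas]
  have e1 : ∫⁻ t in U, ∫⁻ x, ‖P.ext f x t * P.ext g x t‖ₑ ^ q =
      ∫⁻ w, ‖P.ext f w.2 w.1 * P.ext g w.2 w.1‖ₑ ^ q ∂((volume.restrict U).prod volume) :=
    (lintegral_prod _ (hm.pow_const q).aemeasurable).symm
  have e2 : ∫⁻ t in U, ∫⁻ x, ‖P.ext f x t * P.ext g x t‖ₑ ^ 2 =
      ∫⁻ w, ‖P.ext f w.2 w.1 * P.ext g w.2 w.1‖ₑ ^ 2 ∂((volume.restrict U).prod volume) :=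
    (lintegral_prod _ (hm.pow_const 2).aemeasurable).symm
  rw [e1, e2]
  calc _ = ∫⁻ w, ‖P.ext f w.2 w.1 * P.ext g w.2 w.1‖ₑ ^ (2 - q) *
        (‖P.ext f w.2 w.1 * P.ext g w.2 w.1‖ₑ ^ 2) ^ (q - 1)
          ∂((volume.restrict U).prod volume) := by
        refine lintegral_congr fun w => ?_
        rw [← ENNReal.rpow_natCast, ← ENNReal.rpow_mul,
          ← ENNReal.rpow_add_of_nonneg _ _ (by linarith) (by push_cast; nlinarith)]
        congr 1
        push_cast
        ring
    _ ≤ _ := ENNReal.lintegral_mul_norm_pow_le hm.aemeasurable (hm.pow_const 2).aemeasurable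
        (by linarith) (by linarith) (by ring)
    _ ≤ _ := by gcongr

end QuadPhase

lemma sum_sqrt_mul_sqrt_le {J : Type*} (s : Finset J) {a b : J → ℝ≥0∞} (ha : ∑ j ∈ s, a j ≤ 1)
    (hb : ∑ j ∈ s, b j ≤ 1) : ∑ j ∈ s, a j ^ (1 / 2 : ℝ) * b j ^ (1 / 2 : ℝ) ≤ 1 := by
  have h := ENNReal.inner_le_Lp_mul_Lq s (fun j => a j ^ (1 / 2 : ℝ)) (fun j => b j ^ (1 / 2 : ℝ))
    (p := 2) (q := 2) Real.HolderConjugate.two_two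
  simp_rw [← ENNReal.rpow_mul] at h
  norm_num at h
  refine (by norm_num at h ⊢; exact h : _ ≤ (∑ j ∈ s, a j) ^ (1 / 2 : ℝ) *
    (∑ j ∈ s, b j) ^ (1 / 2 : ℝ)).trans ?_
  exact mul_le_one' (ENNReal.rpow_le_one ha (by norm_num)) (ENNReal.rpow_le_one hb (by norm_num))

namespace QuadPhase
open scoped FourierTransform
variable {ι : Type*} [Fintype ι] (P : QuadPhase ι)

local notation "𝔼" => EuclideanSpace ℝ ι

lemma bil_iUnion_rpow_le {J : Type*} [Fintype J] {q : ℝ} (hq : 0 < q) (U : J → Set ℂ)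
    {f g : 𝔼 → ℂ} (hf : Measurable f) (hg : Measurable g) :
    P.bil q (⋃ j, U j) f g ^ q ≤ ∑ j, P.bil q (U j) f g ^ q := by
  simp_rw [P.bil_rpow hq _ hf hg]
  refine (lintegral_iUnion_le _ _).trans ?_
  rw [tsum_fintype]

/-- Splitting a product into a diagonal part and off-diagonal parts. -/
lemma bil_le_diag_add {J : Type*} [Fintype J] [DecidableEq J] {q : ℝ} (hq : 1 ≤ q) (U : Set ℂ)
    {F G : J → 𝔼 → ℂ} {f g : 𝔼 → ℂ} (hF : ∀ j, Nice (F j)) (hG : ∀ j, Nice (G j))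
    (hf : (fun ξ => ∑ j, F j ξ) =ᵐ[volume] f) (hg : (fun ξ => ∑ j, G j ξ) =ᵐ[volume] g)
    (hgm : Measurable g) (j : J) :
    P.bil q U f g ≤ P.bil q U (F j) (G j) + (∑ i ∈ Finset.univ.erase j, P.bil q U (G i) (F j) +
      ∑ i ∈ Finset.univ.erase j, P.bil q U (F i) g) := by
  have hq' : (1 : ℝ≥0∞) ≤ ENNReal.ofReal q := by simpa using hq
  have h1 : ∀ x t, P.ext f x t = ∑ i, P.ext (F i) x t := fun x t => by
    rw [← P.ext_congr hf, P.ext_finsetSum Finset.univ fun k _ => hF k]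
  have h2 : ∀ x t, P.ext g x t = ∑ i, P.ext (G i) x t := fun x t => by
    rw [← P.ext_congr hg, P.ext_finsetSum Finset.univ fun k _ => hG k]
  have e : (fun w : ℂ × 𝔼 => P.ext f w.2 w.1 * P.ext g w.2 w.1) =
      (fun w : ℂ × 𝔼 => P.ext (F j) w.2 w.1 * P.ext (G j) w.2 w.1) +
      ((∑ i ∈ Finset.univ.erase j, fun w : ℂ × 𝔼 => P.ext (G i) w.2 w.1 * P.ext (F j) w.2 w.1) +
      ∑ i ∈ Finset.univ.erase j, fun w : ℂ × 𝔼 => P.ext (F i) w.2 w.1 * P.ext g w.2 w.1) := by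
    funext w
    simp only [Pi.add_apply, Finset.sum_apply, ← Finset.sum_mul]
    have h3 := Finset.add_sum_erase Finset.univ (fun i => P.ext (F i) w.2 w.1) (Finset.mem_univ j)
    have h4 := Finset.add_sum_erase Finset.univ (fun i => P.ext (G i) w.2 w.1) (Finset.mem_univ j)
    rw [h1, ← h3, add_mul]
    nth_rewrite 1 [h2]
    rw [← h4]
    ring
  have m1 : ∀ {a b : 𝔼 → ℂ}, Measurable a → Measurable b → AEStronglyMeasurable
      (fun w : ℂ × 𝔼 => P.ext a w.2 w.1 * P.ext b w.2 w.1) ((volume.restrict U).prod volume) :=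
    fun ha hb => (P.measurable_ext_mul_ext ha hb).aestronglyMeasurable
  have m2 := Finset.aestronglyMeasurable_sum (Finset.univ.erase j)
    fun i _ => m1 (hG i).meas (hF j).meas
  have m3 := Finset.aestronglyMeasurable_sum (Finset.univ.erase j) fun i _ => m1 (hF i).meas hgm
  rw [bil, e]
  refine (eLpNorm_add_le (m1 (hF j).meas (hG j).meas) (m2.add m3) hq').trans
    (add_le_add_right ?_ _)
  refine (eLpNorm_add_le m2 m3 hq').trans (add_le_add ?_ ?_)
  · exact eLpNorm_sum_le (fun i _ => m1 (hG i).meas (hF j).meas) hq'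
  · exact eLpNorm_sum_le (fun i _ => m1 (hF i).meas hgm) hq'

lemma bil_iUnion_le {J : Type*} [Fintype J] [Nonempty J] {q : ℝ} (hq : 1 ≤ q) (U : J → Set ℂ)
    {F G : J → 𝔼 → ℂ} {f g : 𝔼 → ℂ} (hF : ∀ j, Nice (F j)) (hG : ∀ j, Nice (G j))
    (hf : (fun ξ => ∑ j, F j ξ) =ᵐ[volume] f) (hg : (fun ξ => ∑ j, G j ξ) =ᵐ[volume] g)
    (hfm : Measurable f) (hgm : Measurable g) (hF1 : ∑ j, E2 (F j) ≤ 1) (hG1 : ∑ j, E2 (G j) ≤ 1)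
    {A e : ℝ≥0∞}
    (hA : ∀ j, P.bil q (U j) (F j) (G j) ≤ A * (E2 (F j) ^ (1 / 2 : ℝ) * E2 (G j) ^ (1 / 2 : ℝ)))
    (h1 : ∀ i j, i ≠ j → P.bil q (U j) (G i) (F j) ≤ e)
    (h2 : ∀ i j, i ≠ j → P.bil q (U j) (F i) g ≤ e) :
    P.bil q (⋃ j, U j) f g ≤ A + 2 * (Fintype.card J : ℝ≥0∞) ^ 2 * e := by
  classical
  have hq0 : 0 < q := by linarith
  have hJ : (1 : ℝ≥0∞) ≤ Fintype.card J := by exact_mod_cast Fintype.card_pos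
  set c : ℝ≥0∞ := (Fintype.card J : ℝ≥0∞)
  set m : J → ℝ≥0∞ := fun j => A * (E2 (F j) ^ (1 / 2 : ℝ) * E2 (G j) ^ (1 / 2 : ℝ)) with hm
  have hs : ∀ (j : J) (x : J → ℝ≥0∞), (∀ i, i ≠ j → x i ≤ e) →
      ∑ i ∈ Finset.univ.erase j, x i ≤ c * e := by
    intro j x hx
    calc ∑ i ∈ Finset.univ.erase j, x i ≤ ∑ i ∈ Finset.univ.erase j, e :=
          Finset.sum_le_sum fun i hi => hx i (Finset.ne_of_mem_erase hi)
      _ ≤ ∑ i : J, e := Finset.sum_le_sum_of_subset (Finset.erase_subset _ _)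
      _ = c * e := by simp [c]
  have hloc : ∀ j, P.bil q (U j) f g ≤ m j + 2 * c * e := by
    intro j
    refine (P.bil_le_diag_add hq (U j) hF hG hf hg hgm j).trans (add_le_add (hA j) ?_)
    calc _ ≤ c * e + c * e := add_le_add (hs j _ fun i hi => h1 i j hi)
          (hs j _ fun i hi => h2 i j hi)
      _ = 2 * c * e := by ring
  have hm1 : (∑ j, m j ^ q) ^ (1 / q) ≤ A := by
    rw [one_div, ENNReal.rpow_inv_le_iff hq0]
    calc ∑ j, m j ^ q = A ^ q * ∑ j, (E2 (F j) ^ (1 / 2 : ℝ) * E2 (G j) ^ (1 / 2 : ℝ)) ^ q := by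
          rw [Finset.mul_sum]
          exact Finset.sum_congr rfl fun j _ => ENNReal.mul_rpow_of_nonneg _ _ hq0.le
      _ ≤ A ^ q * ∑ j, E2 (F j) ^ (1 / 2 : ℝ) * E2 (G j) ^ (1 / 2 : ℝ) := by
          refine mul_le_mul_right (Finset.sum_le_sum fun j _ => ?_) _
          refine ENNReal.rpow_le_self_of_le_one ?_ hq
          have hj : ∀ (a : J → ℝ≥0∞), ∑ j, a j ≤ 1 → a j ≤ 1 := fun a ha =>
            (Finset.single_le_sum (fun _ _ => zero_le) (Finset.mem_univ j)).trans ha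
          exact mul_le_one' (ENNReal.rpow_le_one (hj _ hF1) (by norm_num))
            (ENNReal.rpow_le_one (hj _ hG1) (by norm_num))
      _ ≤ A ^ q * 1 := mul_le_mul_right (sum_sqrt_mul_sqrt_le _ hF1 hG1) _
      _ = A ^ q := mul_one _
  have he1 : (∑ j : J, (2 * c * e) ^ q) ^ (1 / q) ≤ 2 * c ^ 2 * e := by
    rw [one_div, ENNReal.rpow_inv_le_iff hq0]
    calc ∑ j : J, (2 * c * e) ^ q = c * (2 * c * e) ^ q := by simp [c]
      _ ≤ c ^ q * (2 * c * e) ^ q := mul_le_mul_left (ENNReal.le_rpow_self_of_one_le hJ hq) _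
      _ = (2 * c ^ 2 * e) ^ q := by
          rw [← ENNReal.mul_rpow_of_nonneg _ _ hq0.le]
          congr 1
          ring
  calc P.bil q (⋃ j, U j) f g = (P.bil q (⋃ j, U j) f g ^ q) ^ (1 / q) := by
        rw [← ENNReal.rpow_mul, mul_one_div_cancel hq0.ne', ENNReal.rpow_one]
    _ ≤ (∑ j, (m j + 2 * c * e) ^ q) ^ (1 / q) := by
        refine ENNReal.rpow_le_rpow ?_ (by positivity)
        exact (P.bil_iUnion_rpow_le hq0 U hfm hgm).trans
          (Finset.sum_le_sum fun j _ => ENNReal.rpow_le_rpow (hloc j) hq0.le)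
    _ ≤ (∑ j, m j ^ q) ^ (1 / q) + (∑ j : J, (2 * c * e) ^ q) ^ (1 / q) :=
        ENNReal.Lp_add_le _ _ _ hq
    _ ≤ A + 2 * c ^ 2 * e := add_le_add hm1 he1

end QuadPhase

section Exponents

lemma off_diagonal_real_le (d : ℕ) {σ r M : ℝ} (hσ0 : 0 ≤ σ) (hσ : σ ≤ 1 / 2)
    (hr : 1 ≤ r) (hM : 0 < M)
    (hMr : M ≤ 96 * r ^ σ) :
    M ^ 2 * (M ^ (2 * d) * r ^ 2 * (r ^ d)⁻¹ +
      r ^ (4 * d) * ((r ^ 2 / M) ^ 2 * (M / r) ^ (10 * d + 4))) ≤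
    2 * 96 ^ (10 * d + 4) * ((r ^ σ) ^ (2 + 2 * d) * (r ^ 2 / r ^ d)) := by
  have hr0 : 0 < r := by linarith
  set s := r ^ σ with hs
  have hs1 : 1 ≤ s := Real.one_le_rpow hr hσ0
  have hs2 : s ^ 2 ≤ r := by
    rw [hs, ← Real.rpow_natCast, ← Real.rpow_mul hr0.le]
    calc r ^ (σ * (2 : ℕ)) ≤ r ^ (1 : ℝ) :=
          Real.rpow_le_rpow_of_exponent_le hr (by push_cast; linarith)
      _ = r := Real.rpow_one r
  have h1 : M ^ 2 * (M ^ (2 * d) * r ^ 2 * (r ^ d)⁻¹) ≤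
      96 ^ (10 * d + 4) * (s ^ (2 + 2 * d) * (r ^ 2 / r ^ d)) := by
    calc M ^ 2 * (M ^ (2 * d) * r ^ 2 * (r ^ d)⁻¹) = M ^ (2 + 2 * d) * (r ^ 2 / r ^ d) := by
          rw [pow_add]; ring
      _ ≤ (96 * s) ^ (2 + 2 * d) * (r ^ 2 / r ^ d) := by gcongr
      _ = 96 ^ (2 + 2 * d) * (s ^ (2 + 2 * d) * (r ^ 2 / r ^ d)) := by rw [mul_pow]; ring
      _ ≤ _ := mul_le_mul_of_nonneg_right (pow_le_pow_right₀ (by norm_num) (by omega))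
          (by positivity)
  have h2 : M ^ 2 * (r ^ (4 * d) * ((r ^ 2 / M) ^ 2 * (M / r) ^ (10 * d + 4))) ≤
      96 ^ (10 * d + 4) * (s ^ (2 + 2 * d) * (r ^ 2 / r ^ d)) := by
    calc M ^ 2 * (r ^ (4 * d) * ((r ^ 2 / M) ^ 2 * (M / r) ^ (10 * d + 4)))
        = M ^ (10 * d + 4) * (r ^ (4 * d + 4) / r ^ (10 * d + 4)) := by
          rw [div_pow, div_pow, pow_add r (4 * d) 4]
          field_simp
      _ ≤ (96 * s) ^ (10 * d + 4) * (r ^ (4 * d + 4) / r ^ (10 * d + 4)) := by gcongr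
      _ = 96 ^ (10 * d + 4) * ((s ^ 2) ^ (5 * d + 2) * (r ^ (4 * d + 4) / r ^ (10 * d + 4))) := by
          rw [mul_pow, ← pow_mul]; ring_nf
      _ ≤ 96 ^ (10 * d + 4) * (r ^ (5 * d + 2) * (r ^ (4 * d + 4) / r ^ (10 * d + 4))) := by gcongr
      _ = 96 ^ (10 * d + 4) * (1 * (r ^ 2 / r ^ d)) := by
          congr 1
          rw [one_mul, ← mul_div_assoc, div_eq_div_iff (by positivity) (by positivity)]
          ring
      _ ≤ _ := by
          gcongr
          exact one_le_pow₀ hs1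
  linarith

/-- The off-diagonal errors decay like a power of the scale. -/
lemma exists_off_diagonal_decay (d : ℕ) {q : ℝ} (hq1 : 1 < q) (hq2 : q < 2)
    (hq : ((d : ℝ) + 6) / (d + 2) < q) (C : NNReal) : ∃ σ τ E : ℝ, 0 < σ ∧ 0 < τ ∧ 0 ≤ E ∧
    ∀ r M : ℝ, 1 ≤ r → 0 < M → M ≤ 96 * r ^ σ →
    ((2 * volume (Metric.closedBall (0 : ℂ) (r ^ 2))) ^ (2 - q) *
      (C * (ENNReal.ofReal (M ^ 2) * (ENNReal.ofReal (M ^ (2 * d) * r ^ 2) *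
        (ENNReal.ofReal r ^ d)⁻¹ + ENNReal.ofReal (r ^ (4 * d) *
          ((r ^ 2 / M) ^ 2 * (M / r) ^ (10 * d + 4)))))) ^ (q - 1)) ^ (1 / q) ≤
    ENNReal.ofReal (E * r ^ (-τ)) := by
  have hd : (0 : ℝ) ≤ d := Nat.cast_nonneg d
  have hgap : 0 < (2 + d) * q - 6 - d := by
    rw [div_lt_iff₀ (by positivity)] at hq
    linarith
  set gap : ℝ := (2 + d) * q - 6 - d with hgapd
  set σ : ℝ := min (1 / 2) (gap / (2 * (2 + 2 * d))) with hσ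
  have hσ0 : 0 < σ := lt_min (by norm_num) (by positivity)
  have hσg : σ * (2 * (2 + 2 * d)) ≤ gap := by
    rw [← le_div_iff₀ (by positivity)]
    exact min_le_right _ _
  set K : ℝ := C * (2 * 96 ^ (10 * d + 4)) with hK
  refine ⟨σ, gap / 2 / q, ((2 * Real.pi) ^ (2 - q) * K ^ (q - 1)) ^ (1 / q), hσ0, by positivity,
    by positivity, fun r M hr hM hMr => ?_⟩
  have hr0 : 0 < r := by linarith
  have e1 : 2 * volume (Metric.closedBall (0 : ℂ) (r ^ 2)) =
      ENNReal.ofReal (2 * Real.pi * r ^ (4 : ℝ)) := by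
    rw [Complex.volume_closedBall, ENNReal.ofReal_mul (by positivity),
      ENNReal.ofReal_mul (by norm_num),
      ← ENNReal.ofReal_pow (by positivity), show (r ^ (4 : ℝ)) = (r ^ 2) ^ 2 by
        rw [← pow_mul, ← Real.rpow_natCast]; norm_num]
    have : (NNReal.pi : ℝ≥0∞) = ENNReal.ofReal Real.pi := by
      rw [← NNReal.coe_real_pi, ENNReal.ofReal_coe_nnreal]
    rw [this]
    simp only [ENNReal.ofReal_ofNat]
    ring
  have e2 : (C : ℝ≥0∞) * (ENNReal.ofReal (M ^ 2) * (ENNReal.ofReal (M ^ (2 * d) * r ^ 2) *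
        (ENNReal.ofReal r ^ d)⁻¹ + ENNReal.ofReal (r ^ (4 * d) *
          ((r ^ 2 / M) ^ 2 * (M / r) ^ (10 * d + 4))))) =
      ENNReal.ofReal (C * (M ^ 2 * (M ^ (2 * d) * r ^ 2 * (r ^ d)⁻¹ +
      r ^ (4 * d) * ((r ^ 2 / M) ^ 2 * (M / r) ^ (10 * d + 4))))) := by
    rw [← ENNReal.ofReal_pow hr0.le, ← ENNReal.ofReal_inv_of_pos (by positivity),
      ← ENNReal.ofReal_mul (by positivity), ← ENNReal.ofReal_add (by positivity) (by positivity),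
      ← ENNReal.ofReal_mul (by positivity), ENNReal.ofReal_mul (p := (C : ℝ)) (by positivity),
      ENNReal.ofReal_coe_nnreal]
  have e3 : C * (M ^ 2 * (M ^ (2 * d) * r ^ 2 * (r ^ d)⁻¹ +
      r ^ (4 * d) * ((r ^ 2 / M) ^ 2 * (M / r) ^ (10 * d + 4)))) ≤
      K * r ^ (σ * (2 + 2 * d) + 2 - d) := by
    rw [hK, mul_assoc (C : ℝ) (2 * 96 ^ (10 * d + 4))]
    refine mul_le_mul_of_nonneg_left ((off_diagonal_real_le d hσ0.le
      (min_le_left _ _) hr hM hMr).trans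
      (le_of_eq ?_)) C.2
    congr 1
    rw [Real.rpow_sub hr0, Real.rpow_add hr0, Real.rpow_mul hr0.le, Real.rpow_natCast,
      ← Real.rpow_natCast (r ^ σ)]
    norm_num
    ring
  rw [e1, e2, ENNReal.ofReal_rpow_of_nonneg (by positivity) (by linarith),
    ENNReal.ofReal_rpow_of_nonneg (by positivity) (by linarith),
    ← ENNReal.ofReal_mul (by positivity), ENNReal.ofReal_rpow_of_nonneg
      (by positivity) (by positivity)]
  refine ENNReal.ofReal_le_ofReal ?_
  calc _ ≤ ((2 * Real.pi * r ^ (4 : ℝ)) ^ (2 - q) *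
        (K * r ^ (σ * (2 + 2 * d) + 2 - d)) ^ (q - 1)) ^ (1 / q) := by
        refine Real.rpow_le_rpow (by positivity) (mul_le_mul_of_nonneg_left
          (Real.rpow_le_rpow (by positivity) e3 (by linarith)) (by positivity)) (by positivity)
    _ = ((2 * Real.pi) ^ (2 - q) * K ^ (q - 1) *
        r ^ (4 * (2 - q) + (σ * (2 + 2 * d) + 2 - d) * (q - 1))) ^ (1 / q) := by
        rw [Real.mul_rpow (x := 2 * Real.pi) (by positivity) (by positivity),
          Real.mul_rpow (x := K) (by positivity) (by positivity),
          ← Real.rpow_mul hr0.le, ← Real.rpow_mul hr0.le, Real.rpow_add hr0]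
        ring_nf
    _ ≤ ((2 * Real.pi) ^ (2 - q) * K ^ (q - 1) * r ^ (-(gap / 2))) ^ (1 / q) := by
        refine Real.rpow_le_rpow (by positivity) (mul_le_mul_of_nonneg_left
          (Real.rpow_le_rpow_of_exponent_le hr ?_) (by positivity)) (by positivity)
        have : σ * (2 + 2 * d) * (q - 1) ≤ σ * (2 + 2 * d) * 1 := by
          refine mul_le_mul_of_nonneg_left (by linarith) (by positivity)
        rw [hgapd] at hσg ⊢
        linarith
    _ = _ := by
        rw [Real.mul_rpow (by positivity) (by positivity), ← Real.rpow_mul hr0.le]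
        congr 2
        ring

end Exponents

/-- The points at distance at most `δ` of a point of `S`. -/
def nbhd {V : Type*} [NormedAddCommGroup V] (δ : ℝ) (S : Set V) : Set V :=
  {ξ | ∃ ξ₀ ∈ S, ‖ξ - ξ₀‖ ≤ δ}

lemma nbhd_mono {V : Type*} [NormedAddCommGroup V] {δ δ' : ℝ} (h : δ ≤ δ') (S : Set V) :
    nbhd δ S ⊆ nbhd δ' S := fun _ ⟨ξ₀, h₀, h₁⟩ => ⟨ξ₀, h₀, h₁.trans h⟩

lemma nbhd_nbhd {V : Type*} [NormedAddCommGroup V] {δ δ' : ℝ} {S : Set V} {ξ η : V}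
    (hξ : ξ ∈ nbhd δ S) (h : ‖η - ξ‖ ≤ δ') : η ∈ nbhd (δ + δ') S := by
  obtain ⟨ξ₀, h₀, h₁⟩ := hξ
  refine ⟨ξ₀, h₀, ?_⟩
  calc ‖η - ξ₀‖ = ‖(ξ - ξ₀) + (η - ξ)‖ := by congr 1; abel
    _ ≤ _ := (norm_add_le _ _).trans (add_le_add h₁ h)

namespace QuadPhase
open scoped FourierTransform
variable {ι : Type*} [Fintype ι] (P : QuadPhase ι)

local notation "𝔼" => EuclideanSpace ℝ ι

/-- The bilinear estimate with constant `A` on the square of half side `r² / 2`. -/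
def BoundAt (q : ℝ) (S T : Set 𝔼) (r : ℝ) (A : ℝ≥0∞) : Prop :=
  ∀ f g : 𝔼 → ℂ, Nice f → Nice g → E2 f ≤ 1 → E2 g ≤ 1 →
    Function.support f ⊆ nbhd (14 * Fintype.card ι / r) S →
    Function.support g ⊆ nbhd (14 * Fintype.card ι / r) T →
    P.bil q (sqBox 0 (r ^ 2 / 2)) f g ≤ A

lemma lintegral_lintegral_sq_le {f g : 𝔼 → ℂ} (hg : Nice g) (U : Set ℂ) :
    ∫⁻ t in U, ∫⁻ x, ‖P.ext f x t * P.ext g x t‖ₑ ^ 2 ≤ (∫⁻ ξ, ‖f ξ‖ₑ) ^ 2 * E2 g * volume U := by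
  calc ∫⁻ t in U, ∫⁻ x, ‖P.ext f x t * P.ext g x t‖ₑ ^ 2
      ≤ ∫⁻ t in U, (∫⁻ ξ, ‖f ξ‖ₑ) ^ 2 * E2 g := by
        refine lintegral_mono fun t => ?_
        have h2 := (P.measurable_ext hg.meas).comp (measurable_prodMk_right (y := t))
        have h3 : Measurable fun x => P.ext g x t := h2
        rw [← P.lintegral_sq_ext hg t, ← lintegral_const_mul _ (h3.enorm.pow_const 2)]
        refine lintegral_mono fun x => ?_
        rw [enorm_mul, mul_pow]
        exact mul_le_mul_left (pow_le_pow_left' (P.norm_ext_le f x t) 2) _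
    _ = _ := by simp

lemma bil_rpow_le {q : ℝ} (hq1 : 1 < q) (hq2 : q < 2) (U : Set ℂ) {f g : 𝔼 → ℂ}
    (hf : Nice f) (hg : Nice g) (hf1 : E2 f ≤ 1) (hg1 : E2 g ≤ 1) :
    P.bil q U f g ^ q ≤ (2 * volume U) ^ (2 - q) *
      ((∫⁻ ξ, ‖f ξ‖ₑ) ^ 2 * volume U) ^ (q - 1) := by
  refine (P.bil_rpow_le_interpolate hq1 hq2 U hf hg hf1 hg1).trans
    (mul_le_mul_right (ENNReal.rpow_le_rpow ?_ (by linarith)) _)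
  refine (P.lintegral_lintegral_sq_le hg U).trans (mul_le_mul_left ?_ _)
  exact mul_le_of_le_one_right' hg1

lemma volume_sqBox_lt_top (c : ℂ) (R : ℝ) : volume (sqBox c R) < ∞ :=
  (measure_mono (sqBox_subset_closedBall c R)).trans_lt measure_closedBall_lt_top

lemma bil_ne_top {q : ℝ} (hq1 : 1 < q) (hq2 : q < 2) {U : Set ℂ} (hU : volume U ≠ ∞) {f g : 𝔼 → ℂ}
    (hf : Nice f) (hg : Nice g) (hf1 : E2 f ≤ 1) (hg1 : E2 g ≤ 1) : P.bil q U f g ^ q ≠ ∞ := by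
  refine ne_top_of_le_ne_top ?_ (P.bil_rpow_le hq1 hq2 U hf hg hf1 hg1)
  have h : ∫⁻ ξ, ‖f ξ‖ₑ ≠ ∞ := hf.int.2.ne
  have h1 : 0 ≤ 2 - q := by linarith
  have h2 : 0 ≤ q - 1 := by linarith
  finiteness

/-- A crude bound at a fixed scale. -/
lemma exists_boundAt {q : ℝ} (hq1 : 1 < q) (hq2 : q < 2) {S T : Set 𝔼} {ρ r : ℝ}
    (hS : ∀ ξ ∈ nbhd (14 * Fintype.card ι / r) S, ‖ξ‖ ≤ ρ) :
    ∃ A : NNReal, P.BoundAt q S T r A := by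
  have hq0 : 0 < q := by linarith
  set c : ℝ≥0∞ := volume (Metric.closedBall (0 : 𝔼) ρ) + 1 with hc
  have hct : c ≠ ∞ := by
    have : volume (Metric.closedBall (0 : 𝔼) ρ) ≠ ∞ := measure_closedBall_lt_top.ne
    finiteness
  set U := sqBox 0 (r ^ 2 / 2)
  have hU : volume U ≠ ∞ := (volume_sqBox_lt_top _ _).ne
  set X : ℝ≥0∞ := ((2 * volume U) ^ (2 - q) * (c ^ 2 * volume U) ^ (q - 1)) ^ (1 / q) with hX
  have hXt : X ≠ ∞ := by
    have h1 : 0 ≤ 2 - q := by linarith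
    have h2 : 0 ≤ q - 1 := by linarith
    have h3 : 0 ≤ 1 / q := by positivity
    rw [hX]
    finiteness
  refine ⟨X.toNNReal, fun f g hf hg hf1 hg1 hfS _ => ?_⟩
  rw [ENNReal.coe_toNNReal hXt, hX, one_div, ENNReal.le_rpow_inv_iff hq0]
  refine (P.bil_rpow_le hq1 hq2 U hf hg hf1 hg1).trans (mul_le_mul_right
    (ENNReal.rpow_le_rpow (mul_le_mul_left (pow_le_pow_left' ?_ 2) _) (by linarith)) _)
  calc ∫⁻ ξ, ‖f ξ‖ₑ ≤ ∫⁻ ξ, ((Metric.closedBall (0 : 𝔼) ρ).indicator 1 ξ + ‖f ξ‖ₑ ^ 2) := by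
        refine lintegral_mono fun ξ => ?_
        by_cases h : f ξ = 0
        · simp [h]
        · have : ξ ∈ Metric.closedBall (0 : 𝔼) ρ := by simpa using hS ξ (hfS h)
          rw [Set.indicator_of_mem this]
          exact le_one_add_sq _
    _ = volume (Metric.closedBall (0 : 𝔼) ρ) + E2 f := by
        rw [lintegral_add_right _ (hf.meas.enorm.pow_const 2),
          lintegral_indicator_one Metric.isClosed_closedBall.measurableSet, E2]
    _ ≤ c := add_le_add_right hf1 _

lemma BoundAt.quarter_le {P : QuadPhase ι} {q : ℝ} (hq : 0 < q) {S T : Set 𝔼} {r R : ℝ} {A : ℝ≥0∞}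
    (hA : P.BoundAt q S T r A) {Q : Set ℂ} {c : ℂ} (hQ : Q ⊆ sqBox c R) (hR : R = r ^ 2 / 2)
    {f g : 𝔼 → ℂ} (hf : Nice f) (hg : Nice g)
    (hfS : Function.support f ⊆ nbhd (14 * Fintype.card ι / r) S)
    (hgT : Function.support g ⊆ nbhd (14 * Fintype.card ι / r) T) :
    P.bil q Q f g ≤ A * (E2 f ^ (1 / 2 : ℝ) * E2 g ^ (1 / 2 : ℝ)) := by
  have hs : ∀ h : 𝔼 → ℂ, Function.support (fun ξ => (𝐞 (P.ph c ξ) : ℂ) * h ξ) ⊆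
      Function.support h := fun h ξ hξ => right_ne_zero_of_mul hξ
  rw [hR] at hQ
  refine (P.bil_mono q hQ f g).trans ?_
  rw [P.bil_sqBox hq c _ hf hg, ← P.E2_modulate f c, ← P.E2_modulate g c]
  exact P.bil_le_of_normalized hA (P.nice_modulate hf c) (P.nice_modulate hg c)
    ((hs f).trans hfS) ((hs g).trans hgT)

/-- Passing from one scale to the next. -/
lemma exists_step [Nonempty ι] {q : ℝ} (hq1 : 1 < q) (hq2 : q < 2)
    (hq : ((Fintype.card ι : ℝ) + 6) / (Fintype.card ι + 2) < q) {c₀ ρ ε : ℝ} (hc₀ : 0 < c₀)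
    (hρ : 0 ≤ ρ) (hε : 0 < ε) {S T : Set 𝔼} (hST : P.Transv c₀ ρ (nbhd ε S) (nbhd ε T)) :
    ∃ τ C r₀ : ℝ, 0 < τ ∧ 0 ≤ C ∧ 1 ≤ r₀ ∧ ∀ r, r₀ ≤ r → ∀ A : ℝ≥0∞,
      P.BoundAt q S T (√3 / 2 * r) A →
      P.BoundAt q S T r (ENNReal.ofReal (1 + C * r ^ (-τ)) *
        (A + ENNReal.ofReal (C * r ^ (-τ)))) := by
  obtain ⟨C, hC⟩ := P.exists_split (J := Bool × Bool) hc₀ hρ (10 * Fintype.card ι + 4)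
  set d : ℕ := Fintype.card ι with hd
  obtain ⟨σ, τ, E, hσ, hτ, hE, hdecay⟩ := exists_off_diagonal_decay d hq1 hq2 hq C
  have hq0 : 0 < q := by linarith
  refine ⟨min σ τ, max 4 (32 * E), max 1 (17 * d / ε), lt_min hσ hτ,
    le_max_of_le_left (by norm_num),
    le_max_left _ _, fun r hr A hA f g hf hg hf1 hg1 hfS hgT => ?_⟩
  have hr1 : 1 ≤ r := (le_max_left _ _).trans hr
  have hr0 : 0 < r := by linarith
  have hrε : 17 * d / r ≤ ε := by
    rw [div_le_iff₀ hr0, ← div_le_iff₀' hε]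
    exact (le_max_right _ _).trans hr
  set N : ℕ := ⌈r ^ σ⌉₊ + 4 with hN
  have hrσ : 1 ≤ r ^ σ := Real.one_le_rpow hr1 hσ.le
  have hNle : (N : ℝ) ≤ 6 * r ^ σ := by
    rw [hN]
    push_cast
    linarith [Nat.ceil_lt_add_one (show 0 ≤ r ^ σ by positivity)]
  have hNge : r ^ σ ≤ N := by
    rw [hN]
    push_cast
    linarith [Nat.le_ceil (r ^ σ)]
  have hN0 : (0 : ℝ) < N := by linarith
  set R : ℝ := r ^ 2 / 2 with hR
  have hR0 : 0 < R := by positivity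
  have hfin : ∫⁻ t in sqBox 0 R, ∫⁻ x, ‖P.ext f x t * P.ext g x t‖ₑ ^ q ≠ ∞ := by
    rw [← P.bil_rpow hq0 _ hf.meas hg.meas]
    exact P.bil_ne_top hq1 hq2 (volume_sqBox_lt_top _ _).ne hf hg hf1 hg1
  obtain ⟨a, b, hab, hle⟩ := exists_quarters hR0 (N := N) (by omega) hfin
  set M : ℝ := 16 * N with hM
  have hM0 : 0 < M := by positivity
  set h : ℝ := r ^ 2 / M with hh
  have hh0 : 0 < h := by positivity
  have hrh : r ^ 2 / h = M := by rw [hh]; field_simp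
  have hrh' : r / h = M / r := by rw [hh]; field_simp
  set Q : Bool × Bool → Set ℂ := fun β => quarter R a b (R / N) β with hQ
  have hQm : ∀ β, MeasurableSet (Q β) := measurableSet_quarter _ _ _ _
  have hQb : ∀ β, Q β ⊆ Metric.closedBall 0 (r ^ 2) := fun β => by
    refine Set.inter_subset_left.trans ((sqBox_subset_closedBall 0 R).trans ?_)
    rw [hR, mul_div_cancel₀ _ two_ne_zero]
  have hQs : ∀ i j, i ≠ j → ∀ s ∈ Q i, ∀ t ∈ Q j, 8 * h ≤ ‖s - t‖ := fun i j hij s hs t ht => by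
    refine le_trans (le_of_eq ?_) (le_norm_sub_of_mem_quarter hij hs ht)
    rw [hh, hR, hM]
    field_simp
    norm_num
  have hhr : h ≤ r ^ 2 := by
    rw [hh, hM]
    exact div_le_self (by positivity) (by linarith)
  have hsub : ∀ {k : ℝ} (S : Set 𝔼), k ≤ 16 → ∀ ξ ∈ nbhd (k * d / r) S,
      Metric.closedBall ξ (d / r) ⊆ nbhd ε S := by
    intro k S hk ξ hξ η hη
    rw [mem_closedBall_iff_norm] at hη
    refine nbhd_mono ?_ S (nbhd_nbhd hξ hη)
    calc k * d / r + d / r = (k + 1) * d / r := by ring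
      _ ≤ 17 * d / r := by gcongr; linarith
      _ ≤ ε := hrε
  obtain ⟨F, hF, hFs, hFf, hF1, hFe⟩ := hC r h hr1 hh0 hhr _ _ _ _ hST (hsub S (by norm_num))
    (hsub T (by norm_num)) Q hQm hQb hQs f hf hf1 hfS (fun _ => g) (fun _ => hg) (fun _ => hg1)
    (fun _ => hgT)
  have hnear : ∀ {S : Set 𝔼} {ξ : 𝔼}, (∃ ξ₀ ∈ nbhd (14 * d / r) S, ‖ξ - ξ₀‖ ≤ 2 * d / r) →
      ξ ∈ nbhd (16 * d / r) S := by
    rintro S ξ ⟨ξ₀, h1, h2⟩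
    refine nbhd_mono (le_of_eq ?_) S (nbhd_nbhd h1 h2)
    ring
  have hF1' : ∀ j, E2 (F j) ≤ 1 := fun j =>
    (Finset.single_le_sum (f := fun j => E2 (F j)) (fun _ _ => zero_le) (Finset.mem_univ j)).trans
      (hF1.trans hf1)
  obtain ⟨G, hG, hGs, hGg, hG1, hGe⟩ := hC r h hr1 hh0 hhr _ (nbhd (16 * d / r) S) _ _ hST.symm
    (hsub T (by norm_num)) (hsub S le_rfl) Q hQm hQb hQs g hg hg1 hgT F hF hF1'
    (fun j ξ hξ => hnear (hFs j ξ hξ))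
  have hscale : ∀ S : Set 𝔼, nbhd (16 * d / r) S ⊆ nbhd (14 * d / (√3 / 2 * r)) S := by
    intro S
    refine nbhd_mono ?_ S
    have h3 : √3 ≤ 7 / 4 := by
      rw [Real.sqrt_le_left (by norm_num)]
      norm_num
    rw [div_le_div_iff₀ hr0 (by positivity)]
    have : (0 : ℝ) ≤ d * r := by positivity
    nlinarith
  set B : ℝ≥0∞ := ((2 * volume (Metric.closedBall (0 : ℂ) (r ^ 2))) ^ (2 - q) *
      (C * (ENNReal.ofReal (M ^ 2) * (ENNReal.ofReal (M ^ (2 * d) * r ^ 2) *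
        (ENNReal.ofReal r ^ d)⁻¹ + ENNReal.ofReal (r ^ (4 * d) *
          ((r ^ 2 / M) ^ 2 * (M / r) ^ (10 * d + 4)))))) ^ (q - 1)) ^ (1 / q) with hB
  have herr : ∀ j {f g : 𝔼 → ℂ}, Nice f → Nice g → E2 f ≤ 1 → E2 g ≤ 1 →
      ∫⁻ t in Q j, ∫⁻ x, ‖P.ext f x t * P.ext g x t‖ₑ ^ 2 ≤
        C * (ENNReal.ofReal ((r ^ 2 / h) ^ 2) *
          (ENNReal.ofReal ((r ^ 2 / h) ^ (2 * d) * r ^ 2) * (ENNReal.ofReal r ^ d)⁻¹ +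
          ENNReal.ofReal (r ^ (4 * d) * (h ^ 2 * (r / h) ^ (10 * d + 4))))) →
      P.bil q (Q j) f g ≤ B := by
    intro j f g hf hg hf1 hg1 hle
    rw [hrh, hrh'] at hle
    rw [hB, one_div, ENNReal.le_rpow_inv_iff hq0]
    refine (P.bil_rpow_le_interpolate hq1 hq2 (Q j) hf hg hf1 hg1).trans (mul_le_mul' ?_ ?_)
    · exact ENNReal.rpow_le_rpow (mul_le_mul_right (measure_mono (hQb j)) _) (by linarith)
    · exact ENNReal.rpow_le_rpow hle (by linarith)
  have hmain := P.bil_iUnion_le hq1.le Q hF hG hFf hGg hf.meas hg.meas (hF1.trans hf1)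
    (hG1.trans hg1) (A := A) (e := B) (fun j => by
      obtain ⟨c, hc⟩ := hab j
      refine hA.quarter_le hq0 hc ?_ (hF j) (hG j) ?_ ?_
      · rw [hR, mul_pow, div_pow, Real.sq_sqrt (by norm_num)]
        ring
      · exact fun ξ hξ => hscale S (hnear (hFs j ξ hξ))
      · exact fun ξ hξ => hscale T (hnear (hGs j ξ hξ)))
    (fun i j hij => herr j (hG i) (hF j) ((Finset.single_le_sum (f := fun j => E2 (G j))
      (fun _ _ => zero_le) (Finset.mem_univ i)).trans (hG1.trans hg1)) (hF1' j) (hGe i j hij))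
    (fun i j hij => herr j (hF i) hg (hF1' i) hg1 (hFe i j hij))
  have hBd : B ≤ ENNReal.ofReal (E * r ^ (-τ)) := hdecay r M hr1 hM0 (by linarith)
  have hstep : P.bil q (sqBox 0 R) f g ≤
      ENNReal.ofReal (1 + 4 / N) * P.bil q (⋃ j, Q j) f g := by
    rw [← ENNReal.rpow_le_rpow_iff hq0, ENNReal.mul_rpow_of_nonneg _ _ hq0.le,
      P.bil_rpow hq0 _ hf.meas hg.meas, P.bil_rpow hq0 _ hf.meas hg.meas]
    refine hle.trans (mul_le_mul_left (ENNReal.le_rpow_self_of_one_le ?_ hq1.le) _)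
    rw [ENNReal.one_le_ofReal]
    have : (0 : ℝ) ≤ 4 / N := by positivity
    linarith
  have hrpow : ∀ x, min σ τ ≤ x → r ^ (-x) ≤ r ^ (-min σ τ) := fun x hx =>
    Real.rpow_le_rpow_of_exponent_le hr1 (by linarith)
  refine hstep.trans (mul_le_mul' (ENNReal.ofReal_le_ofReal ?_) (hmain.trans
    (add_le_add_right ?_ _)))
  · have h1 : (4 : ℝ) / N ≤ 4 * r ^ (-σ) := by
      rw [Real.rpow_neg hr0.le, ← div_eq_mul_inv]
      gcongr
    have h2 : 4 * r ^ (-σ) ≤ max 4 (32 * E) * r ^ (-min σ τ) :=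
      mul_le_mul (le_max_left _ _) (hrpow σ (min_le_left _ _)) (by positivity) (by positivity)
    linarith
  · calc 2 * (Fintype.card (Bool × Bool) : ℝ≥0∞) ^ 2 * B ≤ ENNReal.ofReal 32 *
          ENNReal.ofReal (E * r ^ (-τ)) := by
          refine mul_le_mul' (le_of_eq ?_) hBd
          simp
          norm_num
      _ = ENNReal.ofReal (32 * E * r ^ (-τ)) := by
          rw [← ENNReal.ofReal_mul (by norm_num), mul_assoc]
      _ ≤ _ := ENNReal.ofReal_le_ofReal (mul_le_mul (le_max_right _ _) (hrpow τ (min_le_right _ _))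
          (by positivity) (by positivity))

end QuadPhase

lemma subset_nbhd {V : Type*} [NormedAddCommGroup V] {δ : ℝ} (h : 0 ≤ δ) (S : Set V) :
    S ⊆ nbhd δ S := fun ξ hξ => ⟨ξ, hξ, by simpa using h⟩

namespace QuadPhase
variable {ι : Type*} [Fintype ι] (P : QuadPhase ι)

local notation "𝔼" => EuclideanSpace ℝ ι

lemma BoundAt.mono {P : QuadPhase ι} {q : ℝ} {S T : Set 𝔼} {r : ℝ} {A A' : ℝ≥0∞}
    (h : P.BoundAt q S T r A) (hA : A ≤ A') : P.BoundAt q S T r A' :=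
  fun f g hf hg hf1 hg1 hfS hgT => (h f g hf hg hf1 hg1 hfS hgT).trans hA

lemma bil_univ_le {q : ℝ} (hq : 0 < q) {R : ℕ → ℝ} (hR : Monotone R)
    (hR' : Filter.Tendsto R Filter.atTop Filter.atTop) {f g : 𝔼 → ℂ} (hf : Measurable f)
    (hg : Measurable g) {A : ℝ≥0∞} (h : ∀ k, P.bil q (sqBox 0 (R k)) f g ≤ A) :
    P.bil q Set.univ f g ≤ A := by
  have hu : (Set.univ : Set ℂ) = ⋃ k, sqBox 0 (R k) := by
    refine (Set.eq_univ_of_forall fun t => ?_).symm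
    obtain ⟨k, hk⟩ := (hR'.eventually_ge_atTop (max |t.re| |t.im|)).exists
    exact Set.mem_iUnion.2 ⟨k, by simpa using (le_max_left _ _).trans hk,
      by simpa using (le_max_right _ _).trans hk⟩
  have hmono : Monotone fun k => sqBox 0 (R k) := fun i j hij t ht =>
    ⟨ht.1.trans (hR hij), ht.2.trans (hR hij)⟩
  rw [← ENNReal.rpow_le_rpow_iff hq, P.bil_rpow hq _ hf hg, hu,
    setLIntegral_iUnion_of_directed _ hmono.directed_le]
  refine iSup_le fun k => ?_
  rw [← P.bil_rpow hq _ hf hg]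
  exact ENNReal.rpow_le_rpow (h k) hq.le

/-- Induction on scales. -/
lemma exists_boundAt_forall [Nonempty ι] {q : ℝ} (hq1 : 1 < q) (hq2 : q < 2)
    (hq : ((Fintype.card ι : ℝ) + 6) / (Fintype.card ι + 2) < q) {c₀ ρ ε : ℝ} (hc₀ : 0 < c₀)
    (hρ : 0 ≤ ρ) (hε : 0 < ε) {S T : Set 𝔼} (hST : P.Transv c₀ ρ (nbhd ε S) (nbhd ε T)) :
    ∃ (A : NNReal) (r₀ : ℝ), 1 ≤ r₀ ∧ ∀ k : ℕ, P.BoundAt q S T (r₀ * (2 / √3) ^ k) A := by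
  obtain ⟨τ, C, r₁, hτ, hC, hr₁, hstep⟩ := P.exists_step hq1 hq2 hq hc₀ hρ hε hST
  set d : ℕ := Fintype.card ι with hd
  set r₀ : ℝ := max r₁ (14 * d / ε) with hr₀
  have hr01 : 1 ≤ r₀ := hr₁.trans (le_max_left _ _)
  have hr00 : 0 < r₀ := by linarith
  have hS : ∀ ξ ∈ nbhd (14 * d / r₀) S, ‖ξ‖ ≤ ρ := fun ξ hξ => hST.norm_left ξ (nbhd_mono (by
    rw [div_le_iff₀ hr00, ← div_le_iff₀' hε]
    exact le_max_right _ _) S hξ)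
  obtain ⟨A₀, hA₀⟩ := P.exists_boundAt (S := S) (T := T) hq1 hq2 hS
  have h3 : 0 < √3 := by positivity
  have h1 : 1 < 2 / √3 := by
    rw [one_lt_div h3, Real.sqrt_lt' (by norm_num)]
    norm_num
  set θ : ℝ := (2 / √3) ^ (-τ) with hθ
  have hθ0 : 0 ≤ θ := by positivity
  have hθ1 : θ < 1 := Real.rpow_lt_one_of_one_lt_of_neg h1 (by linarith)
  set b₀ : ℝ := 1 + A₀ with hb₀
  have hb1 : 1 ≤ b₀ := by rw [hb₀]; linarith [A₀.2]
  have key : ∀ k : ℕ, P.BoundAt q S T (r₀ * (2 / √3) ^ k)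
      (ENNReal.ofReal (b₀ * Real.exp (2 * C * ∑ j ∈ Finset.range (k + 1), θ ^ j))) := by
    intro k
    induction k with
    | zero =>
      rw [pow_zero, mul_one]
      refine hA₀.mono ?_
      rw [← ENNReal.ofReal_coe_nnreal]
      refine ENNReal.ofReal_le_ofReal ?_
      have : 1 ≤ Real.exp (2 * C * ∑ j ∈ Finset.range (0 + 1), θ ^ j) :=
        Real.one_le_exp (by positivity)
      nlinarith
    | succ k ih =>
      set r : ℝ := r₀ * (2 / √3) ^ (k + 1) with hr
      have hrr : r₀ ≤ r := le_mul_of_one_le_right hr00.le (one_le_pow₀ h1.le)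
      have e1 : √3 / 2 * r = r₀ * (2 / √3) ^ k := by
        rw [hr, pow_succ]
        field_simp
      rw [← e1] at ih
      set b : ℝ := b₀ * Real.exp (2 * C * ∑ j ∈ Finset.range (k + 1), θ ^ j) with hb
      have hb1' : 1 ≤ b := one_le_mul_of_one_le_of_one_le hb1 (Real.one_le_exp (by positivity))
      refine (hstep r ((le_max_left _ _).trans hrr) _ ih).mono ?_
      have hx0 : 0 ≤ r ^ (-τ) := Real.rpow_nonneg (by linarith) _
      have hx : r ^ (-τ) ≤ θ ^ (k + 1) := by
        rw [hr, Real.mul_rpow hr00.le (by positivity), hθ, ← Real.rpow_natCast, ← Real.rpow_natCast,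
          ← Real.rpow_mul (by positivity), ← Real.rpow_mul (by positivity),
          mul_comm (-τ)]
        exact mul_le_of_le_one_left (by positivity)
          (Real.rpow_le_one_of_one_le_of_nonpos hr01 (by linarith))
      rw [← ENNReal.ofReal_add (by linarith) (by positivity),
        ← ENNReal.ofReal_mul (by positivity)]
      refine ENNReal.ofReal_le_ofReal ?_
      set y : ℝ := C * r ^ (-τ) with hy
      have hy0 : 0 ≤ y := by positivity
      have hyθ : y ≤ C * θ ^ (k + 1) := mul_le_mul_of_nonneg_left hx hC
      calc (1 + y) * (b + y) ≤ (1 + y) * ((1 + y) * b) := by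
            refine mul_le_mul_of_nonneg_left ?_ (by linarith)
            nlinarith
        _ = (1 + y) ^ 2 * b := by ring
        _ ≤ Real.exp y ^ 2 * b := by
            gcongr
            linarith [Real.add_one_le_exp y]
        _ = Real.exp (2 * y) * b := by
            rw [← Real.exp_nat_mul]
            norm_num
        _ ≤ Real.exp (2 * (C * θ ^ (k + 1))) * b := by gcongr
        _ = _ := by
            rw [hb, Finset.sum_range_succ _ (k + 1), mul_add, Real.exp_add]
            ring_nf
  refine ⟨(b₀ * Real.exp (2 * C * (1 - θ)⁻¹)).toNNReal, r₀, hr01, fun k => (key k).mono ?_⟩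
  refine ENNReal.ofReal_le_ofReal ?_
  gcongr
  rw [← tsum_geometric_of_lt_one hθ0 hθ1]
  exact (summable_geometric_of_lt_one hθ0 hθ1).sum_le_tsum _ fun _ _ => by positivity

/-- The global bilinear estimate for square-integrable functions, away from the `L²` endpoint. -/
lemma exists_bil_le [Nonempty ι] {q : ℝ} (hq1 : 1 < q) (hq2 : q < 2)
    (hq : ((Fintype.card ι : ℝ) + 6) / (Fintype.card ι + 2) < q) {c₀ ρ ε : ℝ} (hc₀ : 0 < c₀)
    (hρ : 0 ≤ ρ) (hε : 0 < ε) {S T : Set 𝔼} (hST : P.Transv c₀ ρ (nbhd ε S) (nbhd ε T)) :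
    ∃ A : NNReal, ∀ f g : 𝔼 → ℂ, Nice f → Nice g → Function.support f ⊆ S →
      Function.support g ⊆ T →
      P.bil q Set.univ f g ≤ A * (E2 f ^ (1 / 2 : ℝ) * E2 g ^ (1 / 2 : ℝ)) := by
  obtain ⟨A, r₀, hr₀, h⟩ := P.exists_boundAt_forall hq1 hq2 hq hc₀ hρ hε hST
  have hr00 : 0 < r₀ := by linarith
  have h3 : 0 < √3 := by positivity
  have h1 : 1 < 2 / √3 := by
    rw [one_lt_div h3, Real.sqrt_lt' (by norm_num)]
    norm_num
  refine ⟨A, fun f g hf hg hfS hgT => P.bil_le_of_normalized (fun f g hf hg hf1 hg1 hfS hgT => ?_)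
    hf hg hfS hgT⟩
  refine P.bil_univ_le (by linarith) (R := fun k => (r₀ * (2 / √3) ^ k) ^ 2 / 2) ?_ ?_ hf.meas
    hg.meas fun k => h k f g hf hg hf1 hg1 (hfS.trans (subset_nbhd (by positivity) S))
      (hgT.trans (subset_nbhd (by positivity) T))
  · intro i j hij
    dsimp only
    have := pow_le_pow_right₀ h1.le hij
    gcongr
  · refine Filter.Tendsto.atTop_div_const (by norm_num) ?_
    refine (Filter.tendsto_pow_atTop two_ne_zero).comp ?_
    exact (tendsto_pow_atTop_atTop_of_one_lt h1).const_mul_atTop hr00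

end QuadPhase

namespace QuadPhase
open scoped FourierTransform ComplexConjugate
variable {ι : Type*} [Fintype ι] (P : QuadPhase ι)

local notation "𝔼" => EuclideanSpace ℝ ι

/-- Schur's test for the kernel `K (ξ' - ξ)` on the fibres `ξ + η = ζ`. -/
lemma lintegral_quadAmp_mul_le {K : 𝔼 → ℝ≥0∞} (hK : Measurable K) (hKe : ∀ u, K (-u) = K u)
    {f g : 𝔼 → ℂ} (hf : Nice f) (hg : Nice g) :
    ∫⁻ z : 𝔼 × 𝔼 × 𝔼, K (z.2.2 - z.2.1) * ‖quadAmp f g f g z‖ₑ ≤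
      2 * (∫⁻ u, K u) * (E2 f * E2 g) := by
  set F : 𝔼 → 𝔼 → ℝ≥0∞ := fun ζ ξ => ‖f ξ‖ₑ ^ 2 * ‖g (ζ - ξ)‖ₑ ^ 2 with hF
  have mf := hf.meas
  have mg := hg.meas
  have hcj : ∀ z : ℂ, ‖conj z‖ₑ = ‖z‖ₑ := fun z => by
    rw [← ofReal_norm, ← ofReal_norm, RCLike.norm_conj]
  have h1 : ∀ z : 𝔼 × 𝔼 × 𝔼, K (z.2.2 - z.2.1) * ‖quadAmp f g f g z‖ₑ ≤
      K (z.2.2 - z.2.1) * F z.1 z.2.1 + K (z.2.2 - z.2.1) * F z.1 z.2.2 := by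
    intro z
    rw [← mul_add]
    refine mul_le_mul_right ?_ _
    rw [quadAmp, enorm_mul, hcj]
    refine (mul_le_sq_add_sq _ _).trans (le_of_eq ?_)
    simp only [hF, enorm_mul, mul_pow]
  have hFm : Measurable fun w : 𝔼 × 𝔼 => F w.1 w.2 := by
    simp only [hF]; fun_prop
  have hFi : ∫⁻ ζ, ∫⁻ ξ, F ζ ξ = E2 f * E2 g :=
    lintegral_lintegral_conv (mf.enorm.pow_const 2) (mg.enorm.pow_const 2)
  have hFζ : ∀ ζ, Measurable (F ζ) := fun ζ => by simp only [hF]; fun_prop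
  have m1 : Measurable fun z : 𝔼 × 𝔼 × 𝔼 => K (z.2.2 - z.2.1) * F z.1 z.2.1 := by
    simp only [hF]; fun_prop
  have m2 : Measurable fun z : 𝔼 × 𝔼 × 𝔼 => K (z.2.2 - z.2.1) * F z.1 z.2.2 := by
    simp only [hF]; fun_prop
  have e1 : ∫⁻ z : 𝔼 × 𝔼 × 𝔼, K (z.2.2 - z.2.1) * F z.1 z.2.1 = (∫⁻ u, K u) * (E2 f * E2 g) := by
    rw [← hFi, ← lintegral_const_mul _ hFm.lintegral_prod_right',
      show (volume : Measure (𝔼 × 𝔼 × 𝔼)) = volume.prod volume from rfl,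
      lintegral_prod _ m1.aemeasurable]
    refine lintegral_congr fun ζ => ?_
    have := m1.comp (measurable_prodMk_left (x := ζ))
    refine (lintegral_prod _ this.aemeasurable).trans ?_
    rw [← lintegral_const_mul _ (hFζ ζ)]
    refine lintegral_congr fun ξ => ?_
    change ∫⁻ x, K (x - ξ) * F ζ ξ = _
    rw [lintegral_mul_const _ (by fun_prop)]
    congr 1
    exact lintegral_sub_right_eq_self K ξ
  have e2 : ∫⁻ z : 𝔼 × 𝔼 × 𝔼, K (z.2.2 - z.2.1) * F z.1 z.2.2 = (∫⁻ u, K u) * (E2 f * E2 g) := by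
    rw [← hFi, ← lintegral_const_mul _ hFm.lintegral_prod_right',
      show (volume : Measure (𝔼 × 𝔼 × 𝔼)) = volume.prod volume from rfl,
      lintegral_prod _ m2.aemeasurable]
    refine lintegral_congr fun ζ => ?_
    have := m2.comp (measurable_prodMk_left (x := ζ))
    refine (lintegral_prod_symm _ this.aemeasurable).trans ?_
    rw [← lintegral_const_mul _ (hFζ ζ)]
    refine lintegral_congr fun ξ => ?_
    change ∫⁻ x, K (ξ - x) * F ζ ξ = _
    rw [lintegral_mul_const _ (by fun_prop)]
    congr 1
    refine Eq.trans (lintegral_congr fun x => ?_) (lintegral_sub_right_eq_self K ξ)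
    rw [← hKe, neg_sub]
  refine (lintegral_mono h1).trans (le_of_eq ?_)
  rw [lintegral_add_left m1, e1, e2]
  ring

/-- In two real dimensions the `L²` estimate holds directly. -/
lemma exists_bil_two_le (hι : Fintype.card ι = 2) {c₀ : ℝ} (hc₀ : 0 < c₀) {S T : Set 𝔼}
    (hB : ∀ ξ ∈ S, ∀ η ∈ T, ∀ u, c₀ * ‖u‖ ≤ ‖P.B u (η - ξ)‖) :
    ∃ A : NNReal, ∀ f g : 𝔼 → ℂ, Nice f → Nice g → Function.support f ⊆ S →
      Function.support g ⊆ T →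
      P.bil 2 Set.univ f g ≤ A * (E2 f ^ (1 / 2 : ℝ) * E2 g ^ (1 / 2 : ℝ)) := by
  obtain ⟨C, hC, hdec⟩ := exists_tcut_decay 3
  have hfr : Module.finrank ℝ 𝔼 = 2 := by rw [finrank_euclideanSpace, hι]
  set κ : ℝ≥0∞ := 2 * (ENNReal.ofReal (C * c₀⁻¹ ^ 2) * ∫⁻ u : 𝔼, ENNReal.ofReal (wt 3 u)) with hκ
  have hκt : κ ≠ ∞ := by
    have := (lintegral_wt_lt_top (volume : Measure 𝔼) (N := 3) (by omega)).ne
    finiteness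
  have hdQ : ∀ f g : 𝔼 → ℂ, Function.support f ⊆ S → Function.support g ⊆ T → ∀ z,
      quadAmp f g f g z ≠ 0 → c₀ * ‖z.2.2 - z.2.1‖ ≤ ‖P.dQ z‖ := by
    intro f g hf hg z hz
    have h1 := left_ne_zero_of_mul (left_ne_zero_of_mul hz)
    have h2 : g (z.1 - z.2.2) ≠ 0 := by
      have := right_ne_zero_of_mul hz
      rw [map_ne_zero] at this
      exact right_ne_zero_of_mul this
    rw [P.dQ_eq]
    exact hB _ (hf h1) _ (hg h2) _
  have hloc : ∀ f g : 𝔼 → ℂ, Nice f → Nice g → Function.support f ⊆ S →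
      Function.support g ⊆ T → ∀ h : ℝ, 0 < h →
      ∫⁻ t : ℂ, ‖tcut 0 h t‖ₑ * ∫⁻ x, ‖P.ext f x t * P.ext g x t‖ₑ ^ 2 ≤
        κ * (E2 f * E2 g) := by
    intro f g hf hg hfS hgT h hh
    set K : 𝔼 → ℝ≥0∞ := fun u => ENNReal.ofReal (C * h ^ 2) *
      ENNReal.ofReal (wt 3 (((h * c₀)⁻¹)⁻¹ • u)) with hK
    have hwm : Measurable fun u : 𝔼 => ENNReal.ofReal (wt 3 u) :=
      (continuous_wt 3).measurable.ennreal_ofReal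
    have hKm : Measurable K := by
      have := hwm.comp (measurable_const_smul (α := 𝔼) ((h * c₀)⁻¹)⁻¹)
      exact this.const_mul _
    have hKi : 2 * ∫⁻ u, K u = κ := by
      have e := lintegral_comp_smul_sub (volume : Measure 𝔼)
        (fun u => ENNReal.ofReal (wt 3 u)) 0 (r := (h * c₀)⁻¹) (by positivity)
      simp only [sub_zero] at e
      rw [hκ, lintegral_const_mul' _ _ (by finiteness), e, hfr, ← mul_assoc (ENNReal.ofReal _),
        ← ENNReal.ofReal_pow (by positivity), ← ENNReal.ofReal_mul (by positivity)]
      congr 3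
      field_simp
    have h2 := P.lintegral_sq_sum_le {()} (fun _ : Unit => f) (fun _ => g) (fun _ _ => hf)
      (fun _ _ => hg) (integrable_tcut 0 hh) (tcut_nonneg 0 h) (fun _ _ => False)
      (κ * (E2 f * E2 g)) ?_
    · simpa using h2
    intro _ _ _ _ _
    rw [P.integral_chi_quadrilinear (integrable_tcut 0 hh) hf hg hf hg]
    refine (enorm_integral_le_lintegral_enorm _).trans ?_
    rw [← hKi]
    refine le_trans (lintegral_mono fun z => ?_)
      (lintegral_quadAmp_mul_le hKm (fun u => by simp [hK, wt]) hf hg)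
    rw [enorm_mul]
    by_cases hz : quadAmp f g f g z = 0
    · simp [hz]
    refine mul_le_mul_left ?_ _
    simp only [hK]
    rw [← ofReal_norm, ← ENNReal.ofReal_mul (by positivity)]
    refine ENNReal.ofReal_le_ofReal ((hdec 0 h hh _).trans ?_)
    refine mul_le_mul_of_nonneg_left ?_ (by positivity)
    rw [inv_inv]
    unfold wt
    have h3 := hdQ f g hfS hgT z hz
    have h4 : ‖(h * c₀) • (z.2.2 - z.2.1)‖ ≤ ‖h • P.dQ z‖ := by
      rw [norm_smul, norm_smul, Real.norm_of_nonneg (by positivity), Real.norm_of_nonneg hh.le,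
        mul_assoc]
      gcongr
    gcongr
  refine ⟨(κ ^ (1 / 2 : ℝ)).toNNReal, fun f g hf hg hfS hgT => ?_⟩
  rw [ENNReal.coe_toNNReal (by finiteness), ← ENNReal.mul_rpow_of_nonneg _ _ (by norm_num),
    ← ENNReal.mul_rpow_of_nonneg _ _ (by norm_num)]
  refine P.bil_univ_le (by norm_num) (R := fun k : ℕ => (k : ℝ)) Nat.mono_cast
    tendsto_natCast_atTop_atTop hf.meas hg.meas fun k => ?_
  rw [← ENNReal.rpow_le_rpow_iff (z := 2) (by norm_num), ← ENNReal.rpow_mul,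
    P.bil_rpow (by norm_num) _ hf.meas hg.meas]
  norm_num
  refine le_trans ?_ (hloc f g hf hg hfS hgT (4 * k + 1) (by positivity))
  rw [← lintegral_indicator (isClosed_sqBox 0 _).measurableSet]
  refine lintegral_mono fun t => ?_
  by_cases ht : t ∈ sqBox 0 k
  · have h5 := sqBox_subset_closedBall _ _ ht
    rw [Set.indicator_of_mem ht, tcut_eq_one (by positivity)
      (by rw [mem_closedBall_iff_norm] at h5; linarith)]
    simp
  · rw [Set.indicator_of_notMem ht]
    exact zero_le

end QuadPhase

lemma Nice.indicator {V : Type*} [NormedAddCommGroup V] [InnerProductSpace ℝ V]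
    [FiniteDimensional ℝ V] [MeasurableSpace V] [BorelSpace V] {f : V → ℂ} (hf : Nice f)
    {M : Set V} (hM : MeasurableSet M) : Nice (M.indicator f) :=
  ⟨hf.meas.indicator hM, hf.int.indicator hM, hf.mem.indicator hM⟩

lemma E2_indicator_le {V : Type*} [NormedAddCommGroup V] [InnerProductSpace ℝ V]
    [FiniteDimensional ℝ V] [MeasurableSpace V] [BorelSpace V] (f : V → ℂ) (M : Set V) :
    E2 (M.indicator f) ≤ E2 f := by
  refine lintegral_mono fun x => ?_
  by_cases h : x ∈ M <;> simp [h]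

namespace QuadPhase
open scoped Topology
variable {ι : Type*} [Fintype ι] (P : QuadPhase ι)

local notation "𝔼" => EuclideanSpace ℝ ι

lemma bil_finsetSum_le {q : ℝ} (hq : 1 ≤ q) (U : Set ℂ) {J : Type*} (s : Finset J) {F : J → 𝔼 → ℂ}
    (hF : ∀ k ∈ s, Nice (F k)) {g : 𝔼 → ℂ} (hg : Nice g) :
    P.bil q U (fun ξ => ∑ k ∈ s, F k ξ) g ≤ ∑ k ∈ s, P.bil q U (F k) g := by
  unfold bil
  have e : (fun w : ℂ × 𝔼 => P.ext (fun ξ => ∑ k ∈ s, F k ξ) w.2 w.1 * P.ext g w.2 w.1) =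
      ∑ k ∈ s, fun w : ℂ × 𝔼 => P.ext (F k) w.2 w.1 * P.ext g w.2 w.1 := by
    funext w
    rw [P.ext_finsetSum s hF, Finset.sum_mul, Finset.sum_apply]
  rw [e]
  exact eLpNorm_sum_le (fun k hk => (P.measurable_ext_mul_ext (hF k hk).meas
    hg.meas).aestronglyMeasurable) (by simpa using hq)

/-- A global `L² × L² → L^q` bound for functions supported in `S` and `T`. -/
def BilBound (q : ℝ) (S T : Set 𝔼) : Prop :=
  ∃ A : NNReal, ∀ f g : 𝔼 → ℂ, Nice f → Nice g → Function.support f ⊆ S →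
    Function.support g ⊆ T → P.bil q Set.univ f g ≤ A * (E2 f ^ (1 / 2 : ℝ) * E2 g ^ (1 / 2 : ℝ))

variable {P}

lemma BilBound.mono {q : ℝ} {S T S' T' : Set 𝔼} (h : P.BilBound q S T) (hS : S' ⊆ S)
    (hT : T' ⊆ T) : P.BilBound q S' T' := by
  obtain ⟨A, hA⟩ := h
  exact ⟨A, fun f g hf hg hfS hgT => hA f g hf hg (hfS.trans hS) (hgT.trans hT)⟩

lemma BilBound.symm {q : ℝ} {S T : Set 𝔼} (h : P.BilBound q S T) : P.BilBound q T S := by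
  obtain ⟨A, hA⟩ := h
  refine ⟨A, fun f g hf hg hfS hgT => ?_⟩
  rw [P.bil_comm, mul_comm (E2 f ^ (1 / 2 : ℝ))]
  exact hA g f hg hf hgT hfS

lemma BilBound.union {q : ℝ} (hq : 1 ≤ q) {S S' T : Set 𝔼} (hS : MeasurableSet S)
    (h : P.BilBound q S T) (h' : P.BilBound q S' T) : P.BilBound q (S ∪ S') T := by
  obtain ⟨A, hA⟩ := h
  obtain ⟨A', hA'⟩ := h'
  refine ⟨A + A', fun f g hf hg hfS hgT => ?_⟩
  set F : Bool → 𝔼 → ℂ := fun b => cond b (S.indicator f) (Sᶜ.indicator f) with hF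
  have e : f = fun ξ => ∑ b, F b ξ := by
    funext ξ
    simp only [hF, Fintype.sum_bool, cond_true, cond_false]
    exact (Set.indicator_self_add_compl_apply S f ξ).symm
  have hb := P.bil_finsetSum_le hq Set.univ Finset.univ (F := F)
    (fun b _ => by cases b <;> [exact hf.indicator hS.compl; exact hf.indicator hS]) hg
  rw [← e, Fintype.sum_bool] at hb
  refine hb.trans ?_
  push_cast
  rw [add_mul]
  have hle : ∀ M : Set 𝔼, E2 (M.indicator f) ^ (1 / 2 : ℝ) ≤ E2 f ^ (1 / 2 : ℝ) := fun M =>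
    ENNReal.rpow_le_rpow (E2_indicator_le f M) (by norm_num)
  refine add_le_add ((hA _ g (hf.indicator hS) hg ?_ hgT).trans ?_)
    ((hA' _ g (hf.indicator hS.compl) hg ?_ hgT).trans ?_)
  · exact Set.support_indicator_subset
  · exact mul_le_mul_right (mul_le_mul_left (hle _) _) _
  · intro ξ hξ
    rw [Set.support_indicator] at hξ
    exact (hfS hξ.2).resolve_left hξ.1
  · exact mul_le_mul_right (mul_le_mul_left (hle _) _) _

variable (P)

lemma bilBound_empty_left (q : ℝ) (T : Set 𝔼) : P.BilBound q ∅ T := by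
  refine ⟨0, fun f g hf hg hfS hgT => ?_⟩
  have : f = fun _ => 0 := by
    funext ξ
    by_contra h
    exact hfS h
  rw [P.bil_eq_zero hf (by simp [E2, this])]
  exact zero_le

/-- Transversality is an open condition. -/
lemma exists_transv {ξ₀ η₀ : 𝔼} (h : P.B (η₀ - ξ₀) (η₀ - ξ₀) ≠ 0) :
    ∃ c₀ > 0, ∃ ρ, 0 ≤ ρ ∧ ∃ δ > 0,
      P.Transv c₀ ρ (Metric.ball ξ₀ δ) (Metric.ball η₀ δ) := by
  set b := P.B (η₀ - ξ₀) (η₀ - ξ₀) with hb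
  have hb0 : ‖b‖ / 2 < ‖b‖ := by linarith [norm_pos_iff.2 h]
  have hB : Continuous fun w : 𝔼 × 𝔼 => P.B w.1 w.2 := P.B.continuous₂
  have c1 : Continuous fun w : 𝔼 × 𝔼 × 𝔼 => ‖P.B (w.1 - w.2.1) (w.2.2 - w.1)‖ :=
    (hB.comp (f := fun w : 𝔼 × 𝔼 × 𝔼 => (w.1 - w.2.1, w.2.2 - w.1)) (by fun_prop)).norm
  have h1 : ∀ᶠ w in 𝓝 (ξ₀, η₀, η₀), ‖b‖ / 2 < ‖P.B (w.1 - w.2.1) (w.2.2 - w.1)‖ := by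
    refine c1.continuousAt.eventually_const_lt ?_
    change ‖b‖ / 2 < ‖P.B (ξ₀ - η₀) (η₀ - ξ₀)‖
    rwa [← neg_sub η₀ ξ₀, map_neg, _root_.neg_apply, norm_neg]
  have h2 : ∀ᶠ w in 𝓝 (η₀, ξ₀, ξ₀), ‖b‖ / 2 < ‖P.B (w.1 - w.2.1) (w.2.2 - w.1)‖ := by
    refine c1.continuousAt.eventually_const_lt ?_
    change ‖b‖ / 2 < ‖P.B (η₀ - ξ₀) (ξ₀ - η₀)‖
    rwa [← neg_sub η₀ ξ₀, map_neg, norm_neg]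
  obtain ⟨δ₁, hδ₁, H1⟩ := Metric.eventually_nhds_iff.1 h1
  obtain ⟨δ₂, hδ₂, H2⟩ := Metric.eventually_nhds_iff.1 h2
  have hm := lt_min hδ₁ hδ₂
  have aux : ∀ {x y : 𝔼}, x ∈ Metric.ball y (min δ₁ δ₂) → dist x y < δ₁ ∧ dist x y < δ₂ :=
    fun h => lt_min_iff.1 h
  refine ⟨‖b‖ / 2, by positivity, max ‖ξ₀‖ ‖η₀‖ + min δ₁ δ₂, by positivity, min δ₁ δ₂, hm, ?_, ?_,
    ?_, ?_⟩
  · intro ξ hξ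
    rw [mem_ball_iff_norm] at hξ
    linarith [norm_le_norm_add_norm_sub' ξ ξ₀, le_max_left ‖ξ₀‖ ‖η₀‖]
  · intro ξ hξ
    rw [mem_ball_iff_norm] at hξ
    linarith [norm_le_norm_add_norm_sub' ξ η₀, le_max_right ‖ξ₀‖ ‖η₀‖]
  · intro ξ hξ η hη η' hη'
    refine (H1 (y := (ξ, η, η')) ?_).le
    simp only [Prod.dist_eq, max_lt_iff]
    exact ⟨(aux hξ).1, (aux hη).1, (aux hη').1⟩
  · intro ξ hξ η hη η' hη'
    refine (H2 (y := (ξ, η, η')) ?_).le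
    simp only [Prod.dist_eq, max_lt_iff]
    exact ⟨(aux hξ).2, (aux hη).2, (aux hη').2⟩

lemma exists_bilBound_nhds [Nonempty ι] {q : ℝ} (hq1 : 1 < q) (hq2 : q < 2)
    (hq : ((Fintype.card ι : ℝ) + 6) / (Fintype.card ι + 2) < q) {ξ₀ η₀ : 𝔼}
    (h : P.B (η₀ - ξ₀) (η₀ - ξ₀) ≠ 0) :
    ∃ δ > 0, P.BilBound q (Metric.ball ξ₀ δ) (Metric.ball η₀ δ) := by
  obtain ⟨c₀, hc₀, ρ, hρ, δ, hδ, hT⟩ := P.exists_transv h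
  have hn : ∀ x : 𝔼, nbhd (δ / 3) (Metric.ball x (δ / 3)) ⊆ Metric.ball x δ := by
    rintro x ξ ⟨ξ', h1, h2⟩
    rw [mem_ball_iff_norm] at h1 ⊢
    linarith [norm_sub_le_norm_sub_add_norm_sub ξ ξ' x]
  exact ⟨δ / 3, by positivity, P.exists_bil_le hq1 hq2 hq hc₀ hρ (by positivity)
    (hT.mono (hn _) (hn _))⟩

lemma bilBound_of_isCompact [Nonempty ι] {q : ℝ} (hq1 : 1 < q) (hq2 : q < 2)
    (hq : ((Fintype.card ι : ℝ) + 6) / (Fintype.card ι + 2) < q) {S T : Set 𝔼}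
    (hS : IsCompact S) (hT : IsCompact T) (h : ∀ ξ ∈ S, ∀ η ∈ T, P.B (η - ξ) (η - ξ) ≠ 0) :
    P.BilBound q S T := by
  have key : ∀ ξ ∈ S, ∃ M, IsOpen M ∧ ξ ∈ M ∧ ∃ N, IsOpen N ∧ T ⊆ N ∧ P.BilBound q M N := by
    intro ξ hξ
    refine hT.induction_on (p := fun T => ∃ M, IsOpen M ∧ ξ ∈ M ∧ ∃ N, IsOpen N ∧ T ⊆ N ∧
      P.BilBound q M N) ?_ ?_ ?_ ?_
    · exact ⟨Set.univ, isOpen_univ, Set.mem_univ _, ∅, isOpen_empty, subset_rfl,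
        (P.bilBound_empty_left q _).symm⟩
    · rintro T₁ T₂ hT ⟨M, hM, hξM, N, hN, hTN, hb⟩
      exact ⟨M, hM, hξM, N, hN, hT.trans hTN, hb⟩
    · rintro T₁ T₂ ⟨M, hM, hξM, N, hN, hTN, hb⟩ ⟨M', hM', hξM', N', hN', hTN', hb'⟩
      exact ⟨M ∩ M', hM.inter hM', ⟨hξM, hξM'⟩, N ∪ N', hN.union hN',
          Set.union_subset_union hTN hTN',
        (BilBound.union hq1.le hN.measurableSet (hb.mono Set.inter_subset_left subset_rfl).symm
          (hb'.mono Set.inter_subset_right subset_rfl).symm).symm⟩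
    · intro η hη
      obtain ⟨δ, hδ, hb⟩ := P.exists_bilBound_nhds hq1 hq2 hq (h ξ hξ η hη)
      exact ⟨Metric.ball η δ, mem_nhdsWithin_of_mem_nhds (Metric.ball_mem_nhds _ hδ), _,
        Metric.isOpen_ball, Metric.mem_ball_self hδ, _, Metric.isOpen_ball, subset_rfl, hb⟩
  obtain ⟨M, -, hSM, hb⟩ := hS.induction_on (p := fun S => ∃ M, IsOpen M ∧ S ⊆ M ∧ P.BilBound q M T)
    ⟨∅, isOpen_empty, subset_rfl, P.bilBound_empty_left q _⟩
    (by
      rintro S₁ S₂ hS ⟨M, hM, hSM, hb⟩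
      exact ⟨M, hM, hS.trans hSM, hb⟩)
    (by
      rintro S₁ S₂ ⟨M, hM, hSM, hb⟩ ⟨M', hM', hSM', hb'⟩
      exact ⟨M ∪ M', hM.union hM', Set.union_subset_union hSM hSM',
        hb.union hq1.le hM.measurableSet hb'⟩)
    (by
      intro ξ hξ
      obtain ⟨M, hM, hξM, N, hN, hTN, hb⟩ := key ξ hξ
      exact ⟨M, mem_nhdsWithin_of_mem_nhds (hM.mem_nhds hξM), M, hM, subset_rfl,
        hb.mono subset_rfl hTN⟩)
  exact hb.mono hSM subset_rfl

end QuadPhase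

section Slices
variable {V : Type*} [NormedAddCommGroup V] [InnerProductSpace ℝ V]
    [FiniteDimensional ℝ V] [MeasurableSpace V] [BorelSpace V]

/-- The geometric mean of the `L¹` and `L²` norms with weights `1 - s` and `s`. -/
def interNorm (s : ℝ) (f : V → ℂ) : ℝ≥0∞ := (∫⁻ x, ‖f x‖ₑ) ^ (1 - s) * E2 f ^ (s / 2)

lemma lintegral_enorm_pow_le {f : V → ℂ} {E : Set V} (hE : Function.support f ⊆ E) {a : ℝ≥0∞}
    (ha : ∀ x, ‖f x‖ₑ ≤ a) {k : ℕ} (hk : k ≠ 0) : ∫⁻ x, ‖f x‖ₑ ^ k ≤ a ^ k * volume E := by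
  refine le_trans (lintegral_mono fun x => ?_) (lintegral_indicator_const_le E (a ^ k))
  by_cases hx : x ∈ E
  · rw [Set.indicator_of_mem hx]
    exact pow_le_pow_left' (ha x) k
  · have : f x = 0 := by
      by_contra h
      exact hx (hE h)
    simp [this, hk]

lemma interNorm_le {s : ℝ} (hs0 : 0 ≤ s) (hs1 : s ≤ 1) {f : V → ℂ} {E : Set V}
    (hE : Function.support f ⊆ E) {a : ℝ≥0∞} (ha0 : a ≠ 0) (hat : a ≠ ∞) (ha : ∀ x, ‖f x‖ₑ ≤ a) :
    interNorm s f ≤ a * volume E ^ (1 - s / 2) := by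
  have h1 := lintegral_enorm_pow_le hE ha one_ne_zero
  have h2 := lintegral_enorm_pow_le hE ha two_ne_zero
  simp only [pow_one] at h1
  have h3 : 0 ≤ 1 - s := by linarith
  calc interNorm s f ≤ (a * volume E) ^ (1 - s) * (a ^ 2 * volume E) ^ (s / 2) :=
        mul_le_mul' (ENNReal.rpow_le_rpow h1 h3) (ENNReal.rpow_le_rpow h2 (by linarith))
    _ = (a ^ (1 - s) * a ^ s) * (volume E ^ (1 - s) * volume E ^ (s / 2)) := by
        rw [ENNReal.mul_rpow_of_nonneg _ _ h3, ENNReal.mul_rpow_of_nonneg _ _ (by linarith),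
          ← ENNReal.rpow_natCast a 2, ← ENNReal.rpow_mul]
        rw [show ((2 : ℕ) : ℝ) * (s / 2) = s by push_cast; ring]
        ring
    _ = _ := by
        rw [← ENNReal.rpow_add _ _ ha0 hat, ← ENNReal.rpow_add_of_nonneg _ _ h3 (by linarith),
          sub_add_cancel, ENNReal.rpow_one]
        congr 2
        ring

/-- The set where `f` is smaller than `2 ^ j`. -/
def sublevel (f : V → ℂ) (j : ℕ) : Set V := {x | ‖f x‖ₑ < 2 ^ j}

/-- The dyadic level pieces of `f`. -/
def slice (f : V → ℂ) : ℕ → V → ℂ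
  | 0 => (sublevel f 0).indicator f
  | j + 1 => (sublevel f (j + 1) \ sublevel f j).indicator f

lemma measurableSet_sublevel {X : Type*} [MeasurableSpace X] {f : X → ℂ} (hf : Measurable f)
    (j : ℕ) : MeasurableSet (sublevel f j) := measurableSet_lt hf.enorm measurable_const

lemma sublevel_mono {X : Type*} (f : X → ℂ) : Monotone (sublevel f) := fun _ _ h x hx =>
  show ‖f x‖ₑ < _ from lt_of_lt_of_le hx (pow_le_pow_right₀ one_le_two h)

lemma sum_slice {X : Type*} (f : X → ℂ) (J : ℕ) (x : X) :
    ∑ j ∈ Finset.range (J + 1), slice f j x = (sublevel f J).indicator f x := by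
  induction J with
  | zero => simp [slice]
  | succ J ih =>
    rw [Finset.sum_range_succ, ih, slice]
    by_cases h : x ∈ sublevel f J
    · have h' := sublevel_mono f (Nat.le_succ J) h
      simp [h, h']
    · by_cases h' : x ∈ sublevel f (J + 1) <;> simp [h, h']

lemma slice_eq_indicator {X : Type*} (f : X → ℂ) (j : ℕ) :
    ∃ E ⊆ sublevel f j, slice f j = E.indicator f := by
  cases j with
  | zero => exact ⟨_, subset_rfl, rfl⟩
  | succ j => exact ⟨_, Set.sdiff_subset, rfl⟩

lemma support_slice_subset {X : Type*} (f : X → ℂ) (j : ℕ) :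
    Function.support (slice f j) ⊆ Function.support f := by
  obtain ⟨E, -, h⟩ := slice_eq_indicator f j
  rw [h, Set.support_indicator]
  exact Set.inter_subset_right

lemma enorm_slice_le {X : Type*} (f : X → ℂ) (j : ℕ) (x : X) :
    ‖slice f j x‖ₑ ≤ 2 ^ j := by
  obtain ⟨E, hE, h⟩ := slice_eq_indicator f j
  rw [h]
  by_cases hx : x ∈ E
  · rw [Set.indicator_of_mem hx]
    exact (hE hx).le
  · simp [hx]

lemma measurable_slice {X : Type*} [MeasurableSpace X] {f : X → ℂ} (hf : Measurable f) (j : ℕ) :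
    Measurable (slice f j) := by
  cases j with
  | zero => exact hf.indicator (measurableSet_sublevel hf 0)
  | succ j =>
    exact hf.indicator ((measurableSet_sublevel hf (j + 1)).diff (measurableSet_sublevel hf j))

lemma nice_slice {f : V → ℂ} (hf : Measurable f) {S : Set V} (hS : Bornology.IsBounded S)
    (hfS : Function.support f ⊆ S) (j : ℕ) : Nice (slice f j) := by
  have h := (support_slice_subset f j).trans hfS
  refine nice_of_bounded (measurable_slice hf j) hS h ?_
  have hv : volume S ≠ ∞ := hS.measure_lt_top.ne
  exact ne_top_of_le_ne_top (by finiteness)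
    (lintegral_enorm_pow_le h (enorm_slice_le f j) two_ne_zero)

lemma volume_support_slice_le {p : ℝ} (hp : 1 ≤ p) {f : V → ℂ} (hf : Measurable f) {S : Set V}
    (hfS : Function.support f ⊆ S) (h1 : eLpNorm f (ENNReal.ofReal p) volume ≤ 1) (j : ℕ) :
    volume (Function.support (slice f j)) ≤ (volume S + 2 ^ p) * ((2 : ℝ≥0∞) ^ (-p)) ^ j := by
  cases j with
  | zero =>
    rw [pow_zero, mul_one]
    exact (measure_mono ((support_slice_subset f 0).trans hfS)).trans le_self_add
  | succ j =>
    have hp0 : 0 < p := by linarith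
    have hm := mul_meas_ge_le_pow_eLpNorm' (μ := volume) (p := ENNReal.ofReal p)
      (by simpa using hp0)
      (by simp) hf.aestronglyMeasurable (2 ^ j)
    rw [ENNReal.toReal_ofReal hp0.le] at hm
    have h2 : eLpNorm f (ENNReal.ofReal p) volume ^ p ≤ 1 := by
      simpa using ENNReal.rpow_le_rpow h1 hp0.le
    have hsub : Function.support (slice f (j + 1)) ⊆ {x | 2 ^ j ≤ ‖f x‖ₑ} := by
      intro x hx
      rw [slice, Set.support_indicator] at hx
      exact not_lt.1 (show ¬ ‖f x‖ₑ < 2 ^ j from hx.1.2)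
    have e : (2 : ℝ≥0∞) ^ p * ((2 : ℝ≥0∞) ^ (-p)) ^ (j + 1) = (((2 : ℝ≥0∞) ^ j) ^ p)⁻¹ := by
      rw [← ENNReal.rpow_natCast, ← ENNReal.rpow_mul, ← ENNReal.rpow_natCast 2 j,
        ← ENNReal.rpow_mul, ← ENNReal.rpow_neg, ← ENNReal.rpow_add _ _ (by simp) (by simp)]
      congr 1
      push_cast
      ring
    calc volume (Function.support (slice f (j + 1)))
        ≤ volume {x | 2 ^ j ≤ ‖f x‖ₑ} := measure_mono hsub
      _ ≤ (((2 : ℝ≥0∞) ^ j) ^ p)⁻¹ := by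
          rw [← one_mul (_⁻¹), ← div_eq_mul_inv, ENNReal.le_div_iff_mul_le (by simp) (by simp),
            mul_comm]
          exact hm.trans h2
      _ ≤ _ := by
          rw [← e, add_mul]
          exact le_add_self

/-- Real interpolation: the dyadic pieces of an `L^p` function are summable. -/
lemma exists_sum_interNorm_slice_le {p s : ℝ} (hp : 1 ≤ p) (hs0 : 0 ≤ s) (hs1 : s ≤ 1)
    (hps : 1 / p + s / 2 < 1) {S : Set V} (hS : Bornology.IsBounded S) :
    ∃ C : NNReal, ∀ f : V → ℂ, Measurable f → Function.support f ⊆ S →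
      eLpNorm f (ENNReal.ofReal p) volume ≤ 1 →
      ∀ J, ∑ j ∈ Finset.range J, interNorm s (slice f j) ≤ C := by
  have hv : volume S ≠ ∞ := hS.measure_lt_top.ne
  have hp0 : 0 < p := by linarith
  set σ := 1 - s / 2 with hσ
  have hσ0 : 0 < σ := by linarith
  have hpσ : 1 < p * σ := by
    have : 1 / p < σ := by linarith
    rwa [div_lt_iff₀ hp0, mul_comm] at this
  set r : ℝ≥0∞ := 2 ^ (1 - p * σ) with hr
  have hr1 : r < 1 := ENNReal.rpow_lt_one_of_one_lt_of_neg (by norm_num) (by linarith)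
  set K : ℝ≥0∞ := (volume S + 2 ^ p) ^ σ with hK
  have hKt : K ≠ ∞ := by finiteness
  have hfin : K * (1 - r)⁻¹ ≠ ∞ :=
    ENNReal.mul_ne_top hKt (ENNReal.inv_ne_top.2 (tsub_pos_of_lt hr1).ne')
  refine ⟨(K * (1 - r)⁻¹).toNNReal, fun f hf hfS h1 J => ?_⟩
  rw [ENNReal.coe_toNNReal hfin, ← ENNReal.tsum_geometric, ← ENNReal.tsum_mul_left]
  refine le_trans (Finset.sum_le_sum fun j _ => ?_) (ENNReal.sum_le_tsum (Finset.range J))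
  calc interNorm s (slice f j) ≤ 2 ^ j * volume (Function.support (slice f j)) ^ σ :=
        interNorm_le hs0 hs1 subset_rfl (by simp) (by simp) (enorm_slice_le f j)
    _ ≤ 2 ^ j * ((volume S + 2 ^ p) * ((2 : ℝ≥0∞) ^ (-p)) ^ j) ^ σ :=
        mul_le_mul_right (ENNReal.rpow_le_rpow (volume_support_slice_le hp hf hfS h1 j) hσ0.le) _
    _ = K * r ^ j := by
        rw [ENNReal.mul_rpow_of_nonneg _ _ hσ0.le, ← hK, hr, mul_left_comm]
        congr 1
        rw [← ENNReal.rpow_natCast, ← ENNReal.rpow_natCast, ← ENNReal.rpow_natCast,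
          ← ENNReal.rpow_mul, ← ENNReal.rpow_mul, ← ENNReal.rpow_mul,
          ← ENNReal.rpow_add _ _ (by simp) (by simp)]
        congr 1
        ring

end Slices

namespace QuadPhase
open scoped Topology FourierTransform
variable {ι : Type*} [Fintype ι] {P : QuadPhase ι}

local notation "𝔼" => EuclideanSpace ℝ ι

lemma BilBound.exists_interNorm {q₁ q : ℝ} (hq₁ : 0 < q₁) (hq : q₁ ≤ q) {S T : Set 𝔼}
    (h : P.BilBound q₁ S T) : ∃ A : NNReal, ∀ f g : 𝔼 → ℂ, Nice f → Nice g →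
      Function.support f ⊆ S → Function.support g ⊆ T →
      P.bil q Set.univ f g ≤ A * (interNorm (q₁ / q) f * interNorm (q₁ / q) g) := by
  obtain ⟨A, hA⟩ := h
  have hq0 : 0 < q := by linarith
  set s := q₁ / q with hs
  have hs0 : 0 < s := by positivity
  have hs1 : s ≤ 1 := (div_le_one hq0).2 hq
  refine ⟨A ^ s, fun f g hf hg hfS hgT => ?_⟩
  set M : ℝ≥0∞ := (∫⁻ x, ‖f x‖ₑ) * ∫⁻ x, ‖g x‖ₑ with hM
  have hMt : M ≠ ∞ := ENNReal.mul_ne_top hf.int.2.ne hg.int.2.ne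
  have h1 : P.bil q Set.univ f g ^ q ≤ M ^ (q - q₁) * P.bil q₁ Set.univ f g ^ q₁ := by
    rw [P.bil_rpow hq0 _ hf.meas hg.meas, P.bil_rpow hq₁ _ hf.meas hg.meas]
    have hqq : 0 ≤ q - q₁ := by linarith
    have hMt' : M ^ (q - q₁) ≠ ∞ := by finiteness
    rw [← lintegral_const_mul' _ _ hMt']
    refine lintegral_mono fun t => ?_
    rw [← lintegral_const_mul' _ _ hMt']
    refine lintegral_mono fun x => ?_
    have hle : ‖P.ext f x t * P.ext g x t‖ₑ ≤ M := by
      rw [enorm_mul]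
      exact mul_le_mul' (P.norm_ext_le f x t) (P.norm_ext_le g x t)
    calc ‖P.ext f x t * P.ext g x t‖ₑ ^ q =
          ‖P.ext f x t * P.ext g x t‖ₑ ^ (q - q₁) * ‖P.ext f x t * P.ext g x t‖ₑ ^ q₁ := by
          rw [← ENNReal.rpow_add_of_nonneg _ _ hqq hq₁.le, sub_add_cancel]
      _ ≤ _ := mul_le_mul_left (ENNReal.rpow_le_rpow hle hqq) _
  have h2 : P.bil q Set.univ f g ≤ M ^ (1 - s) * P.bil q₁ Set.univ f g ^ s := by
    rw [← ENNReal.rpow_le_rpow_iff hq0]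
    refine h1.trans (le_of_eq ?_)
    rw [ENNReal.mul_rpow_of_nonneg _ _ hq0.le, ← ENNReal.rpow_mul, ← ENNReal.rpow_mul, sub_mul,
      hs, div_mul_cancel₀ _ hq0.ne', one_mul]
  refine h2.trans ((mul_le_mul_right (ENNReal.rpow_le_rpow (hA f g hf hg hfS hgT) hs0.le) _).trans
    (le_of_eq ?_))
  rw [hM, ENNReal.mul_rpow_of_nonneg _ _ (by linarith : 0 ≤ 1 - s),
    ENNReal.mul_rpow_of_nonneg _ _ hs0.le, ENNReal.mul_rpow_of_nonneg _ _ hs0.le,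
    ← ENNReal.rpow_mul, ← ENNReal.rpow_mul, one_div_mul_eq_div, interNorm, interNorm,
    ENNReal.coe_rpow_of_nonneg _ hs0.le]
  ring

lemma tendsto_ext_sublevel (P : QuadPhase ι) {f : 𝔼 → ℂ} (hf : Measurable f) (hi : Integrable f)
    (x : 𝔼) (t : ℂ) :
    Filter.Tendsto (fun J => P.ext ((sublevel f J).indicator f) x t) Filter.atTop
      (𝓝 (P.ext f x t)) := by
  have hc : Continuous fun ξ : 𝔼 => (𝐞 (inner ℝ ξ x + P.ph t ξ) : ℂ) :=
    contDiff_fourierChar.continuous.comp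
      ((continuous_id.inner continuous_const).add
        (P.continuous_ph.comp (Continuous.prodMk_right t)))
  refine tendsto_integral_of_dominated_convergence (fun ξ => ‖f ξ‖) (fun J => ?_) hi.norm
    (fun J => Filter.Eventually.of_forall fun ξ => ?_) (Filter.Eventually.of_forall fun ξ => ?_)
  · exact (hc.measurable.mul
      (hf.indicator (measurableSet_sublevel hf J))).aestronglyMeasurable
  · rw [norm_mul, Circle.norm_coe, one_mul]
    exact norm_indicator_le_norm_self f ξ
  · refine tendsto_const_nhds.congr' ?_
    obtain ⟨J₀, hJ₀⟩ := pow_unbounded_of_one_lt ‖f ξ‖ one_lt_two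
    have hmem : ξ ∈ sublevel f J₀ := by
      change ‖f ξ‖ₑ < 2 ^ J₀
      rw [← ofReal_norm, show (2 : ℝ≥0∞) ^ J₀ = ENNReal.ofReal (2 ^ J₀) by
        rw [ENNReal.ofReal_pow (by norm_num)]; simp]
      exact (ENNReal.ofReal_lt_ofReal_iff (by positivity)).2 hJ₀
    filter_upwards [Filter.eventually_ge_atTop J₀] with J hJ
    rw [Set.indicator_of_mem (sublevel_mono f hJ hmem)]

lemma BilBound.exists_eLpNorm_le {q₁ q p : ℝ} (hq₁ : 1 ≤ q₁) (hq : q₁ ≤ q) (hp : 1 ≤ p)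
    (hpq : 1 / p + q₁ / q / 2 < 1) {S T : Set 𝔼} (hS : Bornology.IsBounded S)
    (hT : Bornology.IsBounded T) (h : P.BilBound q₁ S T) :
    ∃ C : NNReal, ∀ f g : 𝔼 → ℂ, Measurable f → Measurable g → Function.support f ⊆ S →
      Function.support g ⊆ T → eLpNorm f (ENNReal.ofReal p) volume ≤ 1 →
      eLpNorm g (ENNReal.ofReal p) volume ≤ 1 → P.bil q Set.univ f g ≤ C := by
  have hq0 : 0 < q := by linarith
  obtain ⟨A, hA⟩ := h.exists_interNorm (by linarith) hq
  have hs0 : 0 ≤ q₁ / q := by positivity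
  have hs1 : q₁ / q ≤ 1 := (div_le_one hq0).2 hq
  obtain ⟨C₁, hC₁⟩ := exists_sum_interNorm_slice_le hp hs0 hs1 hpq hS
  obtain ⟨C₂, hC₂⟩ := exists_sum_interNorm_slice_le hp hs0 hs1 hpq hT
  refine ⟨A * (C₁ * C₂), fun f g hf hg hfS hgT hf1 hg1 => ?_⟩
  have h_integ : ∀ (f : 𝔼 → ℂ) (S : Set 𝔼), Bornology.IsBounded S → Measurable f →
      Function.support f ⊆ S → eLpNorm f (ENNReal.ofReal p) volume ≤ 1 → Integrable f := by
    intro f S hS hf hfS hf1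
    have hm : MemLp f (ENNReal.ofReal p) volume :=
      ⟨hf.aestronglyMeasurable, hf1.trans_lt ENNReal.one_lt_top⟩
    exact memLp_one_iff_integrable.1 (hm.mono_exponent_of_measure_support_ne_top
      (s := S) (fun x hx => by by_contra h; exact hx (hfS h)) hS.measure_lt_top.ne
      (by simpa using hp))
  have hfi := h_integ f S hS hf hfS hf1
  have hgi := h_integ g T hT hg hgT hg1
  have hF := fun J => hf.indicator (measurableSet_sublevel hf J)
  have hG := fun J => hg.indicator (measurableSet_sublevel hg J)
  have hbound : ∀ J, P.bil q Set.univ ((sublevel f J).indicator f) ((sublevel g J).indicator g) ≤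
      A * (C₁ * C₂) := by
    intro J
    have e : ∀ f : 𝔼 → ℂ, (sublevel f J).indicator f =
        fun ξ => ∑ j ∈ Finset.range (J + 1), slice f j ξ := fun f =>
      funext fun ξ => (sum_slice f J ξ).symm
    rw [e f, e g]
    have nf := fun j => nice_slice hf hS hfS j
    have ng := fun j => nice_slice hg hT hgT j
    refine (P.bil_finsetSum_le (by linarith) _ _ (fun j _ => nf j)
      (nice_finsetSum _ fun j _ => ng j)).trans ?_
    calc ∑ j ∈ Finset.range (J + 1), P.bil q Set.univ (slice f j)
          (fun ξ => ∑ k ∈ Finset.range (J + 1), slice g k ξ)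
        ≤ ∑ j ∈ Finset.range (J + 1), ∑ k ∈ Finset.range (J + 1),
            A * (interNorm (q₁ / q) (slice f j) * interNorm (q₁ / q) (slice g k)) := by
          refine Finset.sum_le_sum fun j _ => ?_
          rw [P.bil_comm]
          refine (P.bil_finsetSum_le (by linarith) _ _ (fun k _ => ng k) (nf j)).trans
            (Finset.sum_le_sum fun k _ => ?_)
          rw [P.bil_comm]
          exact hA _ _ (nf j) (ng k) ((support_slice_subset f j).trans hfS)
            ((support_slice_subset g k).trans hgT)
      _ = A * ((∑ j ∈ Finset.range (J + 1), interNorm (q₁ / q) (slice f j)) *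
            ∑ k ∈ Finset.range (J + 1), interNorm (q₁ / q) (slice g k)) := by
          rw [Finset.sum_mul_sum, Finset.mul_sum]
          simp only [Finset.mul_sum]
      _ ≤ _ := mul_le_mul_right (mul_le_mul' (hC₁ f hf hfS hf1 _) (hC₂ g hg hgT hg1 _)) _
  push_cast
  refine (Lp.eLpNorm_lim_le_liminf_eLpNorm (fun J =>
    (P.measurable_ext_mul_ext (hF J) (hG J)).aestronglyMeasurable) _
    (Filter.Eventually.of_forall fun w => ?_)).trans
    (Filter.liminf_le_of_frequently_le' (Filter.Frequently.of_forall hbound))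
  exact (P.tendsto_ext_sublevel hf hfi w.2 w.1).mul (P.tendsto_ext_sublevel hg hgi w.2 w.1)

end QuadPhase

namespace QuadPhase
open scoped Topology FourierTransform
variable {ι : Type*} [Fintype ι] (P : QuadPhase ι)

local notation "𝔼" => EuclideanSpace ℝ ι

lemma bil_eq_zero_of_ae {q : ℝ} {U : Set ℂ} {f : 𝔼 → ℂ} (g : 𝔼 → ℂ) (h : f =ᵐ[volume] 0) :
    P.bil q U f g = 0 := by
  have : ∀ x t, P.ext f x t = 0 := by
    intro x t
    rw [P.ext_congr h]
    simp [ext]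
  simp [bil, this]

lemma exists_normalize_eLpNorm {p : ℝ≥0∞} {f : 𝔼 → ℂ} (h0 : eLpNorm f p volume ≠ 0)
    (ht : eLpNorm f p volume ≠ ∞) : ∃ a : ℂ, a ≠ 0 ∧ ‖a‖ₑ = eLpNorm f p volume ∧
      eLpNorm (fun ξ => a⁻¹ * f ξ) p volume ≤ 1 := by
  set N := eLpNorm f p volume with hN
  have hn : ‖(N.toReal : ℂ)‖ₑ = N := by
    rw [← ofReal_norm, Complex.norm_real, Real.norm_of_nonneg ENNReal.toReal_nonneg,
      ENNReal.ofReal_toReal ht]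
  have hne : (N.toReal : ℂ) ≠ 0 := by
    rw [Complex.ofReal_ne_zero]
    exact ENNReal.toReal_ne_zero.2 ⟨h0, ht⟩
  refine ⟨N.toReal, hne, hn, ?_⟩
  have := eLpNorm_const_smul (N.toReal : ℂ)⁻¹ f p volume
  refine (this.trans ?_).le
  rw [enorm_inv hne, hn, ← hN, ENNReal.inv_mul_cancel h0 ht]

/-- The bilinear `L^p × L^p → L^q` estimate for functions with normalized `L^p` norms implies the
estimate for all functions. -/
lemma bil_le_mul_eLpNorm {q : ℝ} {p : ℝ≥0∞} (hp : p ≠ 0) {S T : Set 𝔼} {C : NNReal} (hC : C ≠ 0)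
    (H : ∀ f g : 𝔼 → ℂ, Measurable f → Measurable g → Function.support f ⊆ S →
      Function.support g ⊆ T → eLpNorm f p volume ≤ 1 → eLpNorm g p volume ≤ 1 →
      P.bil q Set.univ f g ≤ C)
    {f g : 𝔼 → ℂ} (hf : Measurable f) (hg : Measurable g) (hfS : Function.support f ⊆ S)
    (hgT : Function.support g ⊆ T) :
    P.bil q Set.univ f g ≤ C * eLpNorm f p volume * eLpNorm g p volume := by
  by_cases h1 : eLpNorm f p volume = 0
  · rw [P.bil_eq_zero_of_ae g ((eLpNorm_eq_zero_iff hf.aestronglyMeasurable hp).1 h1)]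
    exact zero_le
  by_cases h2 : eLpNorm g p volume = 0
  · rw [P.bil_comm, P.bil_eq_zero_of_ae f ((eLpNorm_eq_zero_iff hg.aestronglyMeasurable hp).1 h2)]
    exact zero_le
  have hC' : (C : ℝ≥0∞) ≠ 0 := by simpa using hC
  by_cases h3 : eLpNorm f p volume = ∞
  · rw [h3, ENNReal.mul_top hC', ENNReal.top_mul h2]
    exact le_top
  by_cases h4 : eLpNorm g p volume = ∞
  · rw [h4, ENNReal.mul_top (mul_ne_zero hC' h1)]
    exact le_top
  obtain ⟨a, ha, han, ha1⟩ := exists_normalize_eLpNorm h1 h3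
  obtain ⟨b, hb, hbn, hb1⟩ := exists_normalize_eLpNorm h2 h4
  have h5 := H _ _ (hf.const_mul a⁻¹) (hg.const_mul b⁻¹)
    (fun ξ hξ => hfS (right_ne_zero_of_mul hξ)) (fun ξ hξ => hgT (right_ne_zero_of_mul hξ)) ha1 hb1
  have h6 := P.bil_const_mul q Set.univ a b (fun ξ => a⁻¹ * f ξ) (fun ξ => b⁻¹ * g ξ)
  simp only [mul_inv_cancel_left₀ ha, mul_inv_cancel_left₀ hb, enorm_mul, han, hbn] at h6
  rw [h6, mul_assoc (C : ℝ≥0∞), mul_comm (C : ℝ≥0∞)]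
  exact mul_le_mul_right h5 _

/-- In two real dimensions a nondegenerate complex bilinear form gives the `L²` bound. -/
lemma bilBound_two_of_isCompact (hι : Fintype.card ι = 2) {a : ℝ} (ha : 0 < a)
    (hB : ∀ u v, a * (‖u‖ * ‖v‖) ≤ ‖P.B u v‖) {S T : Set 𝔼}
    (hS : IsCompact S) (hT : IsCompact T) (h : ∀ ξ ∈ S, ∀ η ∈ T, P.B (η - ξ) (η - ξ) ≠ 0) :
    P.BilBound 2 S T := by
  rcases S.eq_empty_or_nonempty with rfl | hSn
  · exact P.bilBound_empty_left 2 T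
  rcases T.eq_empty_or_nonempty with rfl | hTn
  · exact (P.bilBound_empty_left 2 S).symm
  have hc : Continuous fun w : 𝔼 × 𝔼 => ‖w.2 - w.1‖ := (continuous_snd.sub continuous_fst).norm
  obtain ⟨⟨ξ₀, η₀⟩, hw, hmin⟩ := (hS.prod hT).exists_isMinOn (hSn.prod hTn) hc.continuousOn
  have hpos : 0 < ‖η₀ - ξ₀‖ := by
    refine norm_pos_iff.2 fun h0 => h ξ₀ hw.1 η₀ hw.2 ?_
    rw [h0, map_zero]
  refine P.exists_bil_two_le hι (c₀ := a * ‖η₀ - ξ₀‖) (by positivity) fun ξ hξ η hη u => ?_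
  refine le_trans ?_ (hB u (η - ξ))
  have h1 : ‖η₀ - ξ₀‖ ≤ ‖η - ξ‖ := isMinOn_iff.1 hmin (ξ, η) (Set.mk_mem_prod hξ hη)
  rw [mul_assoc, mul_comm ‖u‖]
  gcongr

/-- The bilinear restriction theorem for separated compact sets. -/
theorem exists_bil_le_eLpNorm (hι : 2 ≤ Fintype.card ι)
    (h2 : Fintype.card ι = 2 → ∃ a > 0, ∀ u v, a * (‖u‖ * ‖v‖) ≤ ‖P.B u v‖) {q p : ℝ} (hp : 1 ≤ p)
    (hq : ((Fintype.card ι : ℝ) + 6) / (Fintype.card ι + 2) < q)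
    (hpq : 1 / p + ((Fintype.card ι : ℝ) + 6) / (Fintype.card ι + 2) * (1 / (2 * q)) < 1)
    {S T : Set 𝔼} (hS : IsCompact S) (hT : IsCompact T)
    (h : ∀ ξ ∈ S, ∀ η ∈ T, P.B (η - ξ) (η - ξ) ≠ 0) :
    ∃ C : NNReal, ∀ f g : 𝔼 → ℂ, Measurable f → Measurable g → Function.support f ⊆ S →
      Function.support g ⊆ T → P.bil q Set.univ f g ≤
        C * eLpNorm f (ENNReal.ofReal p) volume * eLpNorm g (ENNReal.ofReal p) volume := by
  have : Nonempty ι := Fintype.card_pos_iff.1 (by omega)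
  set d : ℝ := (Fintype.card ι : ℝ) with hd
  have hd2 : 2 ≤ d := by rw [hd]; exact_mod_cast hι
  set q₀ := (d + 6) / (d + 2) with hq₀
  have hq01 : 1 < q₀ := by rw [hq₀, one_lt_div (by linarith)]; linarith
  have hq0 : 0 < q := by linarith
  obtain ⟨q₁, hq₁, hq₁q, hpq₁, hb⟩ : ∃ q₁, 1 ≤ q₁ ∧ q₁ ≤ q ∧ 1 / p + q₁ / q / 2 < 1 ∧
      P.BilBound q₁ S T := by
    rcases hι.lt_or_eq with hlt | heq
    · have hd2' : 2 < d := by rw [hd]; exact_mod_cast hlt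
      have hq02 : q₀ < 2 := by rw [hq₀, div_lt_iff₀ (by linarith)]; linarith
      have hlim : q₀ < (1 - 1 / p) * (2 * q) := by
        rw [← div_lt_iff₀ (by positivity), div_eq_mul_one_div]
        linarith
      obtain ⟨q₁, h1, h2⟩ := exists_between (lt_min (lt_min hq02 hq) hlim)
      simp only [lt_min_iff] at h2
      refine ⟨q₁, by linarith, h2.1.2.le, ?_,
        P.bilBound_of_isCompact (by linarith) h2.1.1 h1 hS hT h⟩
      have := (div_lt_iff₀ (by positivity)).2 h2.2
      rw [div_div, mul_comm q]
      linarith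
    · obtain ⟨a, ha, hB⟩ := h2 heq.symm
      have hd' : d = 2 := by rw [hd, ← heq]; norm_num
      have hq02 : q₀ = 2 := by rw [hq₀, hd']; norm_num
      refine ⟨2, by norm_num, hq02 ▸ hq.le, ?_, P.bilBound_two_of_isCompact heq.symm ha hB hS hT h⟩
      rw [div_div, mul_comm q, div_eq_mul_one_div 2, ← hq02]
      nth_rewrite 2 [hq02]
      exact hpq
  obtain ⟨C, hC⟩ := hb.exists_eLpNorm_le hq₁ hq₁q hp hpq₁ hS.isBounded hT.isBounded
  refine ⟨C + 1, fun f g hf hg hfS hgT => P.bil_le_mul_eLpNorm ?_ (by positivity)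
    (fun f g hf hg hfS hgT hf1 hg1 => (hC f g hf hg hfS hgT hf1 hg1).trans ?_) hf hg hfS hgT⟩
  · simp only [ne_eq, ENNReal.ofReal_eq_zero, not_le]
    linarith
  · push_cast
    exact le_self_add

end QuadPhase

section Coordinates
variable {n : ℕ}

/-- The real coordinates of a vector in `ℂ^n`. -/
def realify (n : ℕ) : (Fin n → ℂ) ≃L[ℝ] EuclideanSpace ℝ (Fin n × Fin 2) :=
  LinearEquiv.toContinuousLinearEquiv
    { toFun := fun z => WithLp.toLp 2 fun k => if k.2 = 0 then (z k.1).re else (z k.1).im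
      invFun := fun x j => ⟨x (j, 0), x (j, 1)⟩
      map_add' := fun z w => by
        ext k
        by_cases h : k.2 = 0 <;> simp [h]
      map_smul' := fun c z => by
        ext k
        by_cases h : k.2 = 0 <;> simp [h]
      left_inv := fun z => by
        funext j
        apply Complex.ext <;> simp
      right_inv := fun x => by
        ext ⟨j, k⟩
        fin_cases k <;> simp }

lemma realify_zero (z : Fin n → ℂ) (j : Fin n) : realify n z (j, 0) = (z j).re := rfl

lemma realify_one (z : Fin n → ℂ) (j : Fin n) : realify n z (j, 1) = (z j).im := rfl

lemma inner_realify (z w : Fin n → ℂ) :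
    inner ℝ (realify n z) (realify n w) = ∑ j, ((z j).re * (w j).re + (z j).im * (w j).im) := by
  rw [PiLp.inner_apply, Fintype.sum_prod_type]
  refine Finset.sum_congr rfl fun j _ => ?_
  rw [Fin.sum_univ_two, realify_zero, realify_zero, realify_one, realify_one]
  simp [mul_comm]

lemma measurePreserving_realify : MeasurePreserving (realify n) := by
  have h : MeasurePreserving (fun (z : Fin n → ℂ) (k : Fin n × Fin 2) =>
      if k.2 = 0 then (z k.1).re else (z k.1).im) volume volume := by
    have hm : Measurable (fun (z : Fin n → ℂ) (k : Fin n × Fin 2) =>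
        if k.2 = 0 then (z k.1).re else (z k.1).im) := by
      refine measurable_pi_iff.2 fun k => ?_
      by_cases h : k.2 = 0
      · simp only [h, if_true]
        exact Complex.measurable_re.comp (measurable_pi_apply k.1)
      · simp only [h, if_false]
        exact Complex.measurable_im.comp (measurable_pi_apply k.1)
    refine ⟨hm, (Measure.pi_eq fun s hs => ?_).symm⟩
    rw [Measure.map_apply hm (MeasurableSet.univ_pi hs)]
    have e : (fun (z : Fin n → ℂ) (k : Fin n × Fin 2) =>
        if k.2 = 0 then (z k.1).re else (z k.1).im) ⁻¹' Set.univ.pi s =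
        Set.univ.pi fun j => Complex.measurableEquivRealProd ⁻¹' (s (j, 0) ×ˢ s (j, 1)) := by
      ext z
      simp only [Set.mem_preimage, Set.mem_pi, Set.mem_univ, forall_const, Prod.forall,
        Fin.forall_fin_two, Set.mem_prod]
      rfl
    rw [e, volume_pi_pi, Fintype.prod_prod_type]
    refine Finset.prod_congr rfl fun j _ => ?_
    rw [Complex.volume_preserving_equiv_real_prod.measure_preimage
      ((hs _).prod (hs _)).nullMeasurableSet, Measure.volume_eq_prod, Measure.prod_prod,
      Fin.prod_univ_two]
  exact (PiLp.volume_preserving_toLp _).comp h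

lemma measurableEmbedding_realify : MeasurableEmbedding (realify n) :=
  (realify n).toHomeomorph.measurableEmbedding

lemma norm_realify_sq (z : Fin n → ℂ) : ‖realify n z‖ ^ 2 = ∑ j, ‖z j‖ ^ 2 := by
  rw [← real_inner_self_eq_norm_sq, inner_realify]
  refine Finset.sum_congr rfl fun j _ => ?_
  rw [Complex.sq_norm, Complex.normSq_apply]

lemma norm_realify_eq {z w : Fin n → ℂ} {a : ℝ} (ha : 0 ≤ a) (h : ∀ j, ‖z j‖ = a * ‖w j‖) :
    ‖realify n z‖ = a * ‖realify n w‖ := by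
  refine (sq_eq_sq₀ (norm_nonneg _) (by positivity)).1 ?_
  rw [mul_pow, norm_realify_sq, norm_realify_sq, Finset.mul_sum]
  refine Finset.sum_congr rfl fun j _ => ?_
  rw [h, mul_pow]

/-- The linear map `z ↦ D z` on `ℂ^n`. -/
def mulD (D : Matrix (Fin n) (Fin n) ℝ) : (Fin n → ℂ) →ₗ[ℝ] Fin n → ℂ where
  toFun z i := ∑ j, (D i j : ℂ) * z j
  map_add' z w := by
    funext i
    simp [mul_add, Finset.sum_add_distrib]
  map_smul' c z := by
    funext i
    simp [Finset.mul_sum, mul_left_comm]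

lemma mulD_injective {D : Matrix (Fin n) (Fin n) ℝ} (hD : IsUnit D.det) :
    Function.Injective (mulD D) := by
  have h : IsUnit (D.map (algebraMap ℝ ℂ)) := by
    rw [Matrix.isUnit_iff_isUnit_det, ← RingHom.mapMatrix_apply, ← RingHom.map_det]
    exact hD.map _
  intro z w hzw
  exact Matrix.mulVec_injective_of_isUnit h hzw

/-- The bilinear form `zᵗ D w` in real coordinates. -/
def formD (D : Matrix (Fin n) (Fin n) ℝ) : EuclideanSpace ℝ (Fin n × Fin 2) →L[ℝ]
    EuclideanSpace ℝ (Fin n × Fin 2) →L[ℝ] ℂ :=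
  (LinearMap.mk₂ ℝ (fun x y => ∑ i, mulD D ((realify n).symm x) i * (realify n).symm y i)
    (fun x x' y => by simp [add_mul, Finset.sum_add_distrib])
    (fun c x y => by simp [Finset.mul_sum, mul_assoc])
    (fun x y y' => by simp [mul_add, Finset.sum_add_distrib])
    (fun c x y => by simp [Finset.mul_sum, mul_left_comm])).toContinuousBilinearMap

lemma formD_apply (D : Matrix (Fin n) (Fin n) ℝ) (x y : EuclideanSpace ℝ (Fin n × Fin 2)) :
    formD D x y = ∑ i, mulD D ((realify n).symm x) i * (realify n).symm y i := rfl

/-- The Hermitian form `∑ zⱼ conj wⱼ` in real coordinates. -/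
def hermForm (n : ℕ) : EuclideanSpace ℝ (Fin n × Fin 2) →L[ℝ]
    EuclideanSpace ℝ (Fin n × Fin 2) →L[ℝ] ℂ :=
  (LinearMap.mk₂ ℝ (fun x y => ∑ i, (realify n).symm x i * starRingEnd ℂ ((realify n).symm y i))
    (fun x x' y => by simp [add_mul, Finset.sum_add_distrib])
    (fun c x y => by simp [Finset.mul_sum, mul_assoc])
    (fun x y y' => by simp [mul_add, Finset.sum_add_distrib])
    (fun c x y => by simp [Finset.mul_sum, mul_left_comm])).toContinuousBilinearMap

lemma hermForm_apply (x y : EuclideanSpace ℝ (Fin n × Fin 2)) :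
    hermForm n x y = ∑ i, (realify n).symm x i * starRingEnd ℂ ((realify n).symm y i) := rfl

/-- The family of real-linear maps `z ↦ t conj (D z)` in real coordinates. -/
def gradD (D : Matrix (Fin n) (Fin n) ℝ) : ℂ →L[ℝ] EuclideanSpace ℝ (Fin n × Fin 2) →L[ℝ]
    EuclideanSpace ℝ (Fin n × Fin 2) :=
  (LinearMap.mk₂ ℝ (fun (t : ℂ) x =>
      realify n fun i => t * starRingEnd ℂ (mulD D ((realify n).symm x) i))
    (fun t t' x => by rw [← map_add]; congr 1; funext i; simp [add_mul])
    (fun c t x => by rw [← map_smul]; congr 1; funext i; simp [mul_assoc])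
    (fun t x x' => by rw [← map_add]; congr 1; funext i; simp [mul_add])
    (fun c t x => by
      rw [← map_smul]; congr 1; funext i; simp [mul_left_comm])).toContinuousBilinearMap

lemma gradD_apply (D : Matrix (Fin n) (Fin n) ℝ) (t : ℂ) (x : EuclideanSpace ℝ (Fin n × Fin 2)) :
    gradD D t x = realify n fun i => t * starRingEnd ℂ (mulD D ((realify n).symm x) i) := rfl

lemma exists_norm_mulD_ge {D : Matrix (Fin n) (Fin n) ℝ} (hD : IsUnit D.det) :
    ∃ c > 0, ∀ x, c * ‖x‖ ≤ ‖realify n (mulD D ((realify n).symm x))‖ := by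
  set L : EuclideanSpace ℝ (Fin n × Fin 2) →ₗ[ℝ] EuclideanSpace ℝ (Fin n × Fin 2) :=
    (realify n).toLinearMap ∘ₗ mulD D ∘ₗ (realify n).symm.toLinearMap with hL
  have hinj : Function.Injective L :=
    (realify n).injective.comp ((mulD_injective hD).comp (realify n).symm.injective)
  obtain ⟨K, hK, h⟩ := L.exists_antilipschitzWith (LinearMap.ker_eq_bot.2 hinj)
  refine ⟨(K : ℝ)⁻¹, by positivity, fun x => ?_⟩
  have := h.le_mul_dist x 0
  rw [map_zero, dist_zero_right, dist_zero_right] at this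
  rw [inv_mul_le_iff₀ (by positivity)]
  exact this

/-- The complex quadratic surface attached to a real symmetric invertible matrix. -/
def phaseD (D : Matrix (Fin n) (Fin n) ℝ) (hs : D.IsSymm) (hD : IsUnit D.det) :
    QuadPhase (Fin n × Fin 2) where
  B := formD D
  symm x y := by
    simp only [formD_apply, mulD, LinearMap.coe_mk, AddHom.coe_mk, Finset.sum_mul]
    rw [Finset.sum_comm]
    refine Finset.sum_congr rfl fun i _ => Finset.sum_congr rfl fun j _ => ?_
    rw [hs.apply]
    ring
  A := gradD D
  inner_A t x y := by
    obtain ⟨w, rfl⟩ := (realify n).surjective y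
    rw [gradD_apply, inner_realify, formD_apply, Finset.mul_sum, Complex.re_sum]
    refine Finset.sum_congr rfl fun i _ => ?_
    simp
    ring
  H := hermForm n
  H_A t x y := by
    rw [gradD_apply, formD_apply, hermForm_apply, map_sum, Finset.mul_sum]
    refine Finset.sum_congr rfl fun i _ => ?_
    simp
    ring
  c := (exists_norm_mulD_ge hD).choose
  c_pos := (exists_norm_mulD_ge hD).choose_spec.1
  lower t x := by
    rw [gradD_apply, norm_realify_eq (norm_nonneg t)
      (w := mulD D ((realify n).symm x)) (fun j => by simp)]
    have := (exists_norm_mulD_ge hD).choose_spec.2 x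
    rw [mul_comm _ ‖t‖, mul_assoc]
    exact mul_le_mul_of_nonneg_left this (norm_nonneg t)

end Coordinates

section Transfer
variable {n : ℕ}

open scoped FourierTransform

lemma card_coordinates : (Fintype.card (Fin n × Fin 2) : ℝ) = n * 2 := by simp

lemma formD_realify (D : Matrix (Fin n) (Fin n) ℝ) (z w : Fin n → ℂ) :
    formD D (realify n z) (realify n w) = ∑ i, ∑ j, (D i j : ℂ) * w i * z j := by
  simp only [formD_apply, mulD, LinearMap.coe_mk, AddHom.coe_mk,
    ContinuousLinearEquiv.symm_apply_apply, Finset.sum_mul]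
  exact Finset.sum_congr rfl fun i _ => Finset.sum_congr rfl fun j _ => by ring

lemma norm_formD_of_card_eq_two {D : Matrix (Fin n) (Fin n) ℝ} (hD : IsUnit D.det)
    (h : Fintype.card (Fin n × Fin 2) = 2) :
    ∃ a > 0, ∀ u v, a * (‖u‖ * ‖v‖) ≤ ‖formD D u v‖ := by
  obtain rfl : n = 1 := by
    simp at h
    omega
  have h0 : D 0 0 ≠ 0 := by
    rw [Matrix.det_fin_one] at hD
    exact hD.ne_zero
  refine ⟨‖D 0 0‖, norm_pos_iff.2 h0, fun u v => ?_⟩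
  obtain ⟨z, rfl⟩ := (realify 1).surjective u
  obtain ⟨w, rfl⟩ := (realify 1).surjective v
  have e : ∀ z : Fin 1 → ℂ, ‖realify 1 z‖ = ‖z 0‖ := fun z => by
    refine (sq_eq_sq₀ (norm_nonneg _) (norm_nonneg _)).1 ?_
    rw [norm_realify_sq, Fin.sum_univ_one]
  rw [formD_realify, Fin.sum_univ_one, Fin.sum_univ_one, e, e, norm_mul, norm_mul,
    Complex.norm_real]
  exact le_of_eq (by ring)

lemma extGamma_eq_ext {D : Matrix (Fin n) (Fin n) ℝ} (hs : D.IsSymm) (hD : IsUnit D.det)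
    (f : (Fin n → ℂ) → ℂ) (w : (Fin n → ℂ) × ℂ) :
    extGamma n D f w = (phaseD D hs hD).ext (f ∘ (realify n).symm) (realify n w.1) w.2 := by
  rw [QuadPhase.ext, ← measurePreserving_realify.integral_comp measurableEmbedding_realify,
    extGamma]
  refine integral_congr_ae (.of_forall fun z => ?_)
  have e : odot n w.1 z + odot1 w.2 (quadD n D z) =
      inner ℝ (realify n z) (realify n w.1) + (phaseD D hs hD).ph w.2 (realify n z) := by
    congr 1
    · rw [inner_realify]
      exact Finset.sum_congr rfl fun j _ => by ring
    · have e' : quadD n D z = (1 / 2 : ℝ) * formD D (realify n z) (realify n z) := by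
        rw [formD_realify, quadD]
        push_cast
        rfl
      rw [e', QuadPhase.ph, odot1, Complex.re_ofReal_mul, Complex.im_ofReal_mul, Complex.mul_re,
        Complex.conj_re, Complex.conj_im]
      change _ = (w.2.re * (formD D _ _).re - _ * (formD D _ _).im) / 2
      ring
  simp only [Function.comp_apply, ContinuousLinearEquiv.symm_apply_apply]
  rw [e, Real.fourierChar_apply]
  congr 2
  push_cast
  ring

lemma eLpNorm_extGamma_mul {D : Matrix (Fin n) (Fin n) ℝ} (hs : D.IsSymm) (hD : IsUnit D.det)
    {f g : (Fin n → ℂ) → ℂ} (hf : Measurable f) (hg : Measurable g) (q : ℝ) :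
    eLpNorm (fun w => extGamma n D f w * extGamma n D g w) (ENNReal.ofReal q) volume =
      (phaseD D hs hD).bil q Set.univ (f ∘ (realify n).symm) (g ∘ (realify n).symm) := by
  have hsm : Measurable (realify n).symm := (realify n).symm.continuous.measurable
  have hmp : MeasurePreserving (fun w : (Fin n → ℂ) × ℂ => (w.2, realify n w.1)) volume
      ((volume.restrict Set.univ).prod volume) := by
    rw [Measure.restrict_univ]
    exact ((MeasurePreserving.id volume).prod measurePreserving_realify).comp
      Measure.measurePreserving_swap
  rw [QuadPhase.bil, ← eLpNorm_comp_measurePreserving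
    ((phaseD D hs hD).measurable_ext_mul_ext (hf.comp hsm) (hg.comp hsm)).aestronglyMeasurable hmp]
  congr 1
  funext w
  simp only [extGamma_eq_ext hs hD, Function.comp_apply]

lemma eLpNorm_comp_realify_symm {f : (Fin n → ℂ) → ℂ} (hf : Measurable f) (p : ℝ≥0∞) :
    eLpNorm (f ∘ (realify n).symm) p volume = eLpNorm f p volume := by
  have hsm : Measurable (realify n).symm := (realify n).symm.continuous.measurable
  rw [← eLpNorm_comp_measurePreserving (hf.comp hsm).aestronglyMeasurable
    measurePreserving_realify]
  congr 1

lemma extGamma_congr (D : Matrix (Fin n) (Fin n) ℝ) {f g : (Fin n → ℂ) → ℂ}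
    (h : f =ᵐ[volume] g) : extGamma n D f = extGamma n D g :=
  funext fun w => integral_congr_ae (by filter_upwards [h] with z hz; rw [hz])

lemma extGamma_of_not_aestronglyMeasurable (D : Matrix (Fin n) (Fin n) ℝ)
    {f : (Fin n → ℂ) → ℂ} (h : ¬ AEStronglyMeasurable f volume) (w : (Fin n → ℂ) × ℂ) :
    extGamma n D f w = 0 := by
  refine integral_undef fun hi => h ?_
  set φ : (Fin n → ℂ) → ℂ := fun z => 2 * Real.pi * Complex.I *
    ((odot n w.1 z + odot1 w.2 (quadD n D z) : ℝ) : ℂ)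
  have hφ : Continuous fun z => Complex.exp (-φ z) := by
    simp only [φ, odot, odot1, quadD]
    fun_prop
  refine (hφ.aestronglyMeasurable.mul hi.aestronglyMeasurable).congr (.of_forall fun z => ?_)
  simp only [Pi.mul_apply]
  rw [← mul_assoc, ← Complex.exp_add, neg_add_cancel, Complex.exp_zero, one_mul]

lemma IsClosedCubeC.isCompact {S : Set (Fin n → ℂ)} (hS : IsClosedCubeC n S) : IsCompact S := by
  obtain ⟨a, r, -, rfl⟩ := hS
  refine Metric.isCompact_of_isClosed_isBounded ?_ ?_
  · simp only [Set.ofPred_forall]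
    refine isClosed_iInter fun j => ?_
    rw [Set.ofPred_and]
    exact (isClosed_le (by fun_prop) continuous_const).inter
      (isClosed_le (by fun_prop) continuous_const)
  · refine (Metric.isBounded_closedBall (x := a) (r := |r| + |r|)).subset fun z hz => ?_
    rw [Metric.mem_closedBall, dist_pi_le_iff (by positivity)]
    intro j
    rw [dist_eq_norm]
    refine (Complex.norm_le_abs_re_add_abs_im _).trans ?_
    rw [Complex.sub_re, Complex.sub_im]
    exact add_le_add ((hz j).1.trans (le_abs_self r)) ((hz j).2.trans (le_abs_self r))

lemma exists_measurable_supported {S : Set (Fin n → ℂ)} (hS : MeasurableSet S)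
    {f : (Fin n → ℂ) → ℂ} (hf : AEStronglyMeasurable f volume) (hfS : f.support ⊆ S) :
    ∃ f', Measurable f' ∧ f =ᵐ[volume] f' ∧ f'.support ⊆ S := by
  refine ⟨S.indicator (hf.mk f), hf.stronglyMeasurable_mk.measurable.indicator hS, ?_,
    Set.support_indicator_subset⟩
  filter_upwards [hf.ae_eq_mk] with z hz
  by_cases h : z ∈ S
  · rw [Set.indicator_of_mem h, hz]
  · rw [Set.indicator_of_notMem h]
    exact Function.notMem_support.1 fun h' => h (hfS h')

end Transfer

/-- **Corollary (bilinear restriction for complex quadratic surfaces).**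
If `D` is an `n × n` real symmetric invertible matrix and `S₁, S₂ ⊆ ℂ^n` are
closed cubes with `(z₂-z₁)ᵗ D (z₂-z₁) ≠ 0` for all `z₁ ∈ S₁`, `z₂ ∈ S₂`, then
for `q > (n+3)/(n+1)` and `1/p + ((n+3)/(n+1))·(1/(2q)) < 1` there is `C` with
`‖E_γ f · E_γ g‖_{L^q(ℂ^{n+1})} ≤ C ‖f‖_{L^p(ℂ^n)} ‖g‖_{L^p(ℂ^n)}` whenever
`f`, `g` are supported in `S₁`, `S₂`. -/
theorem bilinear_restriction_complex
    (n : ℕ) (hn : 1 ≤ n)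
    (D : Matrix (Fin n) (Fin n) ℝ) (hDsymm : D.IsSymm) (hDinv : IsUnit D.det)
    (S₁ S₂ : Set (Fin n → ℂ))
    (hS₁ : IsClosedCubeC n S₁) (hS₂ : IsClosedCubeC n S₂)
    (hsep : ∀ z₁ ∈ S₁, ∀ z₂ ∈ S₂,
      (∑ i, ∑ j, (D i j : ℂ) * (z₂ i - z₁ i) * (z₂ j - z₁ j)) ≠ 0)
    (q p : ℝ) (hp : 1 ≤ p)
    (hq : ((n : ℝ) + 3) / ((n : ℝ) + 1) < q)
    (hpq : 1 / p + (((n : ℝ) + 3) / ((n : ℝ) + 1)) * (1 / (2 * q)) < 1) :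
    ∃ C : ℝ, ∀ f g : (Fin n → ℂ) → ℂ,
      Function.support f ⊆ S₁ → Function.support g ⊆ S₂ →
      eLpNorm (fun w => extGamma n D f w * extGamma n D g w)
          (ENNReal.ofReal q) volume ≤
        ENNReal.ofReal C * eLpNorm f (ENNReal.ofReal p) volume *
          eLpNorm g (ENNReal.ofReal p) volume := by
  have hcard : ((Fintype.card (Fin n × Fin 2) : ℝ) + 6) / (Fintype.card (Fin n × Fin 2) + 2) =
      ((n : ℝ) + 3) / ((n : ℝ) + 1) := by
    rw [card_coordinates, div_eq_div_iff (by positivity) (by positivity)]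
    ring
  obtain ⟨C, hC⟩ := (phaseD D hDsymm hDinv).exists_bil_le_eLpNorm (by simp; omega)
    (norm_formD_of_card_eq_two hDinv) hp (by rwa [hcard]) (by rwa [hcard])
    (hS₁.isCompact.image (realify n).continuous) (hS₂.isCompact.image (realify n).continuous)
    (by
      rintro _ ⟨z, hz, rfl⟩ _ ⟨w, hw, rfl⟩
      rw [← map_sub]
      exact (formD_realify D _ _).trans_ne (hsep z hz w hw))
  refine ⟨C, fun f g hf hg => ?_⟩
  rw [ENNReal.ofReal_coe_nnreal]
  by_cases hfm : AEStronglyMeasurable f volume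
  swap
  · simp [extGamma_of_not_aestronglyMeasurable D hfm]
  by_cases hgm : AEStronglyMeasurable g volume
  swap
  · simp [extGamma_of_not_aestronglyMeasurable D hgm]
  obtain ⟨f', hf', ef, hfS⟩ := exists_measurable_supported hS₁.isCompact.measurableSet hfm hf
  obtain ⟨g', hg', eg, hgS⟩ := exists_measurable_supported hS₂.isCompact.measurableSet hgm hg
  have hsm : Measurable (realify n).symm := (realify n).symm.continuous.measurable
  have hsupp : ∀ {S : Set (Fin n → ℂ)} {h : (Fin n → ℂ) → ℂ}, h.support ⊆ S →
      (h ∘ (realify n).symm).support ⊆ realify n '' S := fun hS x hx =>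
    ⟨(realify n).symm x, hS hx, (realify n).apply_symm_apply x⟩
  rw [extGamma_congr D ef, extGamma_congr D eg, eLpNorm_congr_ae ef, eLpNorm_congr_ae eg,
    eLpNorm_extGamma_mul hDsymm hDinv hf' hg', ← eLpNorm_comp_realify_symm hf',
    ← eLpNorm_comp_realify_symm hg']
  exact hC _ _ (hf'.comp hsm) (hg'.comp hsm) (hsupp hfS) (hsupp hgS)

end
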